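/- Let n ≥ 1, let Ω ⊂ ℝ^n be open, and let f ∈ L^1_loc(Ω) with Var(f, Ω) < ∞. Then there exists a sequence {f_i}_{i=1}^∞ ⊂ SBV_loc(Ω) such that f_i − f → 0 in L^∞(Ω), limsup_{i→∞} |D^a f_i|(Ω) ≤ |D^a f|(Ω) + |D^c f|(Ω), and limsup_{i→∞} |D^j f_i|(Ω) ≤ |D^j f|(Ω). -/

import Mathlib

open MeasureTheory Filter Topology Metric
open scoped ENNReal RealInnerProductSpace Classical

noncomputable section

/-- An open cube in `ℝⁿ` with side length `ε` and arbitrary orientation. -/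
def IsCube (n : ℕ) (ε : ℝ) (Q : Set (EuclideanSpace ℝ (Fin n))) : Prop :=
  ∃ (T : EuclideanSpace ℝ (Fin n) ≃ₗᵢ[ℝ] EuclideanSpace ℝ (Fin n))
    (x : EuclideanSpace ℝ (Fin n)),
    Q = (fun y => x + T y) '' {y : EuclideanSpace ℝ (Fin n) | ∀ i, |y i| < ε / 2}

/-- The BMO-type functional `κ_ε(f, Ω)`. -/
def kappa (n : ℕ) (ε : ℝ) (f : EuclideanSpace ℝ (Fin n) → ℝ)
    (Ω : Set (EuclideanSpace ℝ (Fin n))) : ℝ≥0∞ :=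
  ENNReal.ofReal (ε ^ (n - 1)) *
    ⨆ (F : Set (Set (EuclideanSpace ℝ (Fin n))))
      (_ : ∀ Q ∈ F, IsCube n ε Q ∧ Q ⊆ Ω) (_ : F.Pairwise Disjoint),
      ∑' Q : F, ENNReal.ofReal
        (⨍ x in (Q : Set (EuclideanSpace ℝ (Fin n))),
          |f x - ⨍ y in (Q : Set (EuclideanSpace ℝ (Fin n))), f y ∂volume| ∂volume)

/-- The divergence of a vector field on `ℝⁿ`. -/
def vdiv (n : ℕ) (Φ : EuclideanSpace ℝ (Fin n) → EuclideanSpace ℝ (Fin n))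
    (x : EuclideanSpace ℝ (Fin n)) : ℝ :=
  ∑ i : Fin n, fderiv ℝ Φ x (EuclideanSpace.single i 1) i

/-- The variation `Var(f, Ω)`. -/
def variation (n : ℕ) (f : EuclideanSpace ℝ (Fin n) → ℝ)
    (Ω : Set (EuclideanSpace ℝ (Fin n))) : ℝ≥0∞ :=
  ⨆ (Φ : EuclideanSpace ℝ (Fin n) → EuclideanSpace ℝ (Fin n))
    (_ : ContDiff ℝ 1 Φ) (_ : HasCompactSupport Φ) (_ : tsupport Φ ⊆ Ω)
    (_ : ∀ x, ‖Φ x‖ ≤ 1),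
    ENNReal.ofReal (∫ x in Ω, f x * vdiv n Φ x)

/-- The approximate jump set `J_f`. -/
def jumpSet (n : ℕ) (f : EuclideanSpace ℝ (Fin n) → ℝ) : Set (EuclideanSpace ℝ (Fin n)) :=
  {x | ∃ ν : EuclideanSpace ℝ (Fin n), ‖ν‖ = 1 ∧ ∃ a b : ℝ, a ≠ b ∧
    Tendsto (fun r : ℝ =>
        ⨍ y in {y ∈ ball x r | 0 < ⟪y - x, ν⟫}, |f y - a| ∂volume)
      (𝓝[>] 0) (𝓝 0) ∧
    Tendsto (fun r : ℝ =>
        ⨍ y in {y ∈ ball x r | ⟪y - x, ν⟫ < 0}, |f y - b| ∂volume)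
      (𝓝[>] 0) (𝓝 0)}

/-- The approximate discontinuity set `S_f` (the set of non-Lebesgue points). -/
def approxDiscontSet (n : ℕ) (f : EuclideanSpace ℝ (Fin n) → ℝ) :
    Set (EuclideanSpace ℝ (Fin n)) :=
  {x | ¬ ∃ c : ℝ,
    Tendsto (fun r : ℝ => ⨍ y in ball x r, |f y - c| ∂volume) (𝓝[>] 0) (𝓝 0)}

/-- `(μ, σ)` is the polar decomposition `Df = σ |Df|` of the gradient measure of `f` on `Ω`:
`μ` plays the role of the total variation measure `|Df|` and `σ` of the polar vector field. -/
def IsVariationPair (n : ℕ) (f : EuclideanSpace ℝ (Fin n) → ℝ)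
    (Ω : Set (EuclideanSpace ℝ (Fin n))) (μ : Measure (EuclideanSpace ℝ (Fin n)))
    (σ : EuclideanSpace ℝ (Fin n) → EuclideanSpace ℝ (Fin n)) : Prop :=
  IsFiniteMeasure μ ∧ μ Ωᶜ = 0 ∧ AEStronglyMeasurable σ μ ∧ (∀ᵐ x ∂μ, ‖σ x‖ = 1) ∧
  ∀ Φ : EuclideanSpace ℝ (Fin n) → EuclideanSpace ℝ (Fin n),
    ContDiff ℝ 1 Φ → HasCompactSupport Φ → tsupport Φ ⊆ Ω →
    ∫ x in Ω, f x * vdiv n Φ x = - ∫ x, ⟪Φ x, σ x⟫ ∂μ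

/-- `|D^a f|(Ω)`, the total variation of the absolutely continuous part of `Df`,
with the convention that it is `∞` if `f` is not of bounded variation in `Ω`. -/
def absVar (n : ℕ) (f : EuclideanSpace ℝ (Fin n) → ℝ)
    (Ω : Set (EuclideanSpace ℝ (Fin n))) : ℝ≥0∞ :=
  if h : ∃ p : Measure (EuclideanSpace ℝ (Fin n)) ×
      (EuclideanSpace ℝ (Fin n) → EuclideanSpace ℝ (Fin n)),
      IsVariationPair n f Ω p.1 p.2 then
    volume.withDensity ((h.choose.1).rnDeriv volume) Ω
  else ⊤

/-- `|D^c f|(Ω)`, the total variation of the Cantor part of `Df`,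
with the convention that it is `∞` if `f` is not of bounded variation in `Ω`. -/
def cantorVar (n : ℕ) (f : EuclideanSpace ℝ (Fin n) → ℝ)
    (Ω : Set (EuclideanSpace ℝ (Fin n))) : ℝ≥0∞ :=
  if h : ∃ p : Measure (EuclideanSpace ℝ (Fin n)) ×
      (EuclideanSpace ℝ (Fin n) → EuclideanSpace ℝ (Fin n)),
      IsVariationPair n f Ω p.1 p.2 then
    (h.choose.1.singularPart volume) (Ω \ approxDiscontSet n f)
  else ⊤

/-- `|D^j f|(Ω)`, the total variation of the jump part of `Df`,
with the convention that it is `∞` if `f` is not of bounded variation in `Ω`. -/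
def jumpVar (n : ℕ) (f : EuclideanSpace ℝ (Fin n) → ℝ)
    (Ω : Set (EuclideanSpace ℝ (Fin n))) : ℝ≥0∞ :=
  if h : ∃ p : Measure (EuclideanSpace ℝ (Fin n)) ×
      (EuclideanSpace ℝ (Fin n) → EuclideanSpace ℝ (Fin n)),
      IsVariationPair n f Ω p.1 p.2 then
    (h.choose.1.singularPart volume) (jumpSet n f ∩ Ω)
  else ⊤

/-- `g` is the weak (distributional) gradient of `u` on `Ω`. -/
def HasWeakGradientOn (n : ℕ) (u : EuclideanSpace ℝ (Fin n) → ℝ)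
    (g : EuclideanSpace ℝ (Fin n) → EuclideanSpace ℝ (Fin n))
    (Ω : Set (EuclideanSpace ℝ (Fin n))) : Prop :=
  ∀ φ : EuclideanSpace ℝ (Fin n) → ℝ,
    ContDiff ℝ 1 φ → HasCompactSupport φ → tsupport φ ⊆ Ω →
    ∀ k : Fin n,
      ∫ x in Ω, u x * fderiv ℝ φ x (EuclideanSpace.single k 1) =
        - ∫ x in Ω, φ x * g x k

/-- `f ∈ BV(Ω)`: `f` is integrable on `Ω` and has finite variation in `Ω`. -/
def IsBVOn (n : ℕ) (f : EuclideanSpace ℝ (Fin n) → ℝ)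
    (Ω : Set (EuclideanSpace ℝ (Fin n))) : Prop :=
  IntegrableOn f Ω volume ∧ variation n f Ω < ⊤

/-- `f ∈ SBV(Ω)`: `f ∈ BV(Ω)` and the Cantor part of `Df` vanishes. -/
def IsSBVOn (n : ℕ) (f : EuclideanSpace ℝ (Fin n) → ℝ)
    (Ω : Set (EuclideanSpace ℝ (Fin n))) : Prop :=
  IsBVOn n f Ω ∧ cantorVar n f Ω = 0

section Auxiliary

variable {n : ℕ}

local notation "𝔼" => EuclideanSpace ℝ (Fin n)

section FunctionalAnalysis

/-- Hahn–Banach extension of a linear functional dominated by a norm along a linear map. -/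
theorem exists_clm_of_abs_le_norm {V X : Type*} [AddCommGroup V] [Module ℝ V]
    [NormedAddCommGroup X] [NormedSpace ℝ X] (ι : V →ₗ[ℝ] X) (ℓ : V →ₗ[ℝ] ℝ) (C : ℝ)
    (hC : 0 ≤ C) (h : ∀ v, |ℓ v| ≤ C * ‖ι v‖) :
    ∃ L : X →L[ℝ] ℝ, ‖L‖ ≤ C ∧ ∀ v, L (ι v) = ℓ v := by
  obtain ⟨s, hs⟩ := ι.rangeRestrict.exists_rightInverse_of_surjective
    (LinearMap.range_rangeRestrict ι)
  have hs' : ∀ y, ι (s y) = y := fun y => by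
    have := congrArg Subtype.val (LinearMap.congr_fun hs y)
    simpa using this
  let g : StrongDual ℝ (LinearMap.range ι) := (ℓ ∘ₗ s).mkContinuous C (fun y => by
    have := h (s y)
    rw [hs'] at this
    simpa using this)
  obtain ⟨L, hL, hLn⟩ := exists_extension_norm_eq (LinearMap.range ι) g
  refine ⟨L, hLn.trans_le (LinearMap.mkContinuous_norm_le _ hC _), fun v => ?_⟩
  have h1 : L (ι v) = ℓ (s ⟨ι v, v, rfl⟩) := hL ⟨ι v, v, rfl⟩
  have h2 := h (v - s ⟨ι v, v, rfl⟩)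
  rw [map_sub, map_sub, hs', sub_self, norm_zero, mul_zero] at h2
  rw [h1]
  exact (sub_eq_zero.1 (abs_eq_zero.1 (le_antisymm h2 (abs_nonneg _)))).symm

/-- A contractive functional on `L¹` of a finite measure acts on `L²` by integration against a
function bounded by one. -/
theorem exists_density_of_clm_L1 {α : Type*} [MeasurableSpace α] (μ : Measure α)
    [IsFiniteMeasure μ] (L : Lp ℝ 1 μ →L[ℝ] ℝ) (hL : ‖L‖ ≤ 1) :
    ∃ σ : α → ℝ, Measurable σ ∧ (∀ x, |σ x| ≤ 1) ∧
      ∀ (g : α → ℝ) (_ : MemLp g 2 μ) (h1 : MemLp g 1 μ), L (h1.toLp g) = ∫ x, g x * σ x ∂μ := by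
  have h12 : (1 : ℝ≥0∞) ≤ 2 := by norm_num
  let J : Lp ℝ 2 μ →ₗ[ℝ] Lp ℝ 1 μ :=
    { toFun := fun g => ((Lp.memLp g).mono_exponent h12).toLp g
      map_add' := fun g h => by
        rw [← MemLp.toLp_add]
        exact MemLp.toLp_congr _ _ (Lp.coeFn_add g h)
      map_smul' := fun c g => by
        rw [RingHom.id_apply, ← MemLp.toLp_const_smul]
        exact MemLp.toLp_congr _ _ (Lp.coeFn_smul c g) }
  have hJ : ∀ g, ‖J g‖ ≤ (μ Set.univ ^ (1 / (1 : ℝ≥0∞).toReal - 1 / (2 : ℝ≥0∞).toReal)).toReal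
      * ‖g‖ := by
    intro g
    have h := eLpNorm_le_eLpNorm_mul_rpow_measure_univ (μ := μ) h12 (Lp.memLp g).1
    change ‖((Lp.memLp g).mono_exponent h12).toLp g‖ ≤ _
    rw [Lp.norm_toLp, Lp.norm_def, mul_comm, ← ENNReal.toReal_mul]
    refine ENNReal.toReal_mono (ENNReal.mul_ne_top (Lp.memLp g).2.ne ?_) h
    exact ENNReal.rpow_ne_top_of_nonneg (by norm_num) (measure_ne_top _ _)
  let Jc : Lp ℝ 2 μ →L[ℝ] Lp ℝ 1 μ := J.mkContinuous _ hJ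
  let s : Lp ℝ 2 μ := (InnerProductSpace.toDual ℝ (Lp ℝ 2 μ)).symm (L.comp Jc)
  have hs : ∀ (g : α → ℝ) (h2 : MemLp g 2 μ) (h1 : MemLp g 1 μ),
      L (h1.toLp g) = ∫ x, g x * s x ∂μ := by
    intro g h2 h1
    have e1 : L (h1.toLp g) = (L.comp Jc) (h2.toLp g) := by
      change L _ = L _
      congr 1
      exact MemLp.toLp_congr h1 ((Lp.memLp (h2.toLp g)).mono_exponent h12) h2.coeFn_toLp.symm
    have e2 : (L.comp Jc) (h2.toLp g) = ⟪s, h2.toLp g⟫ := by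
      rw [InnerProductSpace.toDual_symm_apply]
    rw [e1, e2, L2.inner_def]
    refine integral_congr_ae ?_
    filter_upwards [h2.coeFn_toLp] with x hx
    rw [hx]
    simp
  have hsm : StronglyMeasurable (s : α → ℝ) := Lp.stronglyMeasurable s
  have hle : ∀ᵐ x ∂μ, |s x| ≤ 1 := by
    let A : Set α := {x | 1 < |s x|}
    have hA : MeasurableSet A := measurableSet_lt measurable_const hsm.measurable.abs
    let g : α → ℝ := A.indicator fun x => SignType.sign (s x)
    have hsg : Measurable fun x => ((SignType.sign (s x) : SignType) : ℝ) := by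
      have : (fun x => ((SignType.sign (s x) : SignType) : ℝ)) =
          fun x => if 0 < s x then (1 : ℝ) else if s x < 0 then -1 else 0 := by
        funext x
        rw [sign_apply]
        split_ifs <;> simp
      rw [this]
      exact Measurable.ite (measurableSet_lt measurable_const hsm.measurable) measurable_const
        (Measurable.ite (measurableSet_lt hsm.measurable measurable_const) measurable_const
          measurable_const)
    have hgm : Measurable g := hsg.indicator hA
    have hgb : ∀ x, ‖g x‖ ≤ 1 := by
      intro x
      refine (norm_indicator_le_norm_self _ _).trans ?_
      rcases lt_trichotomy (s x) 0 with h | h | h <;> simp [h]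
    have hg : ∀ p, MemLp g p μ := fun p =>
      MemLp.of_bound hgm.aestronglyMeasurable 1 (Eventually.of_forall hgb)
    have e := hs g (hg 2) (hg 1)
    have hsi : Integrable (fun x => |s x|) μ := ((Lp.memLp s).integrable h12).abs
    have e3 : ∫ x, g x * s x ∂μ = ∫ x in A, |s x| ∂μ := by
      rw [← integral_indicator hA]
      refine integral_congr_ae (Eventually.of_forall fun x => ?_)
      by_cases hx : x ∈ A
      · simp only [g, Set.indicator_of_mem hx]
        exact sign_mul_self _
      · simp only [g, Set.indicator_of_notMem hx, zero_mul]
    have e4 : ‖(hg 1).toLp g‖ ≤ ∫ x in A, (1 : ℝ) ∂μ := by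
      rw [L1.norm_eq_integral_norm, ← integral_indicator hA]
      refine integral_mono_ae (L1.integrable_coeFn _).norm
        ((integrable_const (1 : ℝ)).indicator hA) ?_
      filter_upwards [(hg 1).coeFn_toLp] with x hx
      rw [hx]
      by_cases hxA : x ∈ A
      · simp only [Set.indicator_of_mem hxA]; exact hgb x
      · simp [g, Set.indicator_of_notMem hxA]
    have e5 : ∫ x in A, |s x| ∂μ ≤ ∫ x in A, (1 : ℝ) ∂μ := by
      rw [← e3, ← e]
      calc L ((hg 1).toLp g) ≤ ‖L ((hg 1).toLp g)‖ := le_abs_self _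
        _ ≤ ‖L‖ * ‖(hg 1).toLp g‖ := L.le_opNorm _
        _ ≤ 1 * ‖(hg 1).toLp g‖ := by gcongr
        _ ≤ _ := by rw [one_mul]; exact e4
    have e6 : ∫ x in A, (|s x| - 1) ∂μ = 0 := by
      refine le_antisymm ?_ (setIntegral_nonneg hA fun x hx => sub_nonneg.2 (le_of_lt hx))
      rw [integral_sub hsi.integrableOn (integrable_const _)]
      exact sub_nonpos.2 e5
    rw [setIntegral_eq_zero_iff_of_nonneg_ae] at e6
    · rw [EventuallyEq, ae_restrict_iff' hA] at e6
      filter_upwards [e6] with x hx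
      by_contra hlt
      have h0 := hx (not_le.1 hlt)
      simp only [Pi.zero_apply] at h0
      linarith
    · exact (ae_restrict_iff' hA).2 (Eventually.of_forall fun x hx => sub_nonneg.2 (le_of_lt hx))
    · exact (hsi.sub (integrable_const _)).integrableOn
  refine ⟨fun x => max (-1) (min 1 (s x)), ?_, fun x => ?_, fun g h2 h1 => ?_⟩
  · exact measurable_const.max (measurable_const.min hsm.measurable)
  · exact abs_le.2 ⟨le_max_left _ _, max_le (by norm_num) (min_le_left _ _)⟩
  · rw [hs g h2 h1]
    refine integral_congr_ae ?_
    filter_upwards [hle] with x hx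
    rw [abs_le] at hx
    rw [min_eq_right hx.2, max_eq_right hx.1]

end FunctionalAnalysis

section RieszDomination

open scoped BoundedContinuousFunction CompactlySupported NNReal

variable {X : Type*} [TopologicalSpace X]

/-- The values of `L` on the functions dominated in absolute value by `ψ`. -/
def dominatedValues (L : (X →ᵇ ℝ) →L[ℝ] ℝ) (ψ : X → ℝ) : Set ℝ :=
  {t | ∃ g : X →ᵇ ℝ, (∀ x, |g x| ≤ ψ x) ∧ t = L g}

theorem dominatedValues_nonempty (L : (X →ᵇ ℝ) →L[ℝ] ℝ) {ψ : X → ℝ} (h : ∀ x, 0 ≤ ψ x) :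
    (dominatedValues L ψ).Nonempty :=
  ⟨0, 0, fun x => by simpa using h x, by simp⟩

theorem le_of_mem_dominatedValues (L : (X →ᵇ ℝ) →L[ℝ] ℝ) {ψ : X → ℝ} {M : ℝ} (hM : 0 ≤ M)
    (h : ∀ x, ψ x ≤ M) {t : ℝ} (ht : t ∈ dominatedValues L ψ) : t ≤ ‖L‖ * M := by
  obtain ⟨g, hg, rfl⟩ := ht
  calc L g ≤ ‖L g‖ := le_abs_self _
    _ ≤ ‖L‖ * ‖g‖ := L.le_opNorm g
    _ ≤ ‖L‖ * M := by
      gcongr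
      exact (BoundedContinuousFunction.norm_le hM).2 fun x => (hg x).trans (h x)

theorem exists_bound_compactlySupported (ψ : C_c(X, ℝ≥0)) :
    ∃ M : ℝ, 0 ≤ M ∧ ∀ x, (ψ x : ℝ) ≤ M := by
  obtain ⟨M, hM⟩ := (ψ.toReal).hasCompactSupport.exists_bound_of_continuous ψ.toReal.continuous
  refine ⟨max M 0, le_max_right _ _, fun x => le_max_of_le_left ?_⟩
  have h := hM x
  rw [CompactlySupportedContinuousMap.toReal_apply] at h
  exact (Real.le_norm_self _).trans h

theorem bddAbove_dominatedValues (L : (X →ᵇ ℝ) →L[ℝ] ℝ) (ψ : C_c(X, ℝ≥0)) :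
    BddAbove (dominatedValues L fun x => (ψ x : ℝ)) := by
  obtain ⟨M, hM, h⟩ := exists_bound_compactlySupported ψ
  exact ⟨‖L‖ * M, fun t ht => le_of_mem_dominatedValues L hM h ht⟩

theorem sSup_dominatedValues_nonneg (L : (X →ᵇ ℝ) →L[ℝ] ℝ) (ψ : C_c(X, ℝ≥0)) :
    0 ≤ sSup (dominatedValues L fun x => (ψ x : ℝ)) :=
  le_csSup (bddAbove_dominatedValues L ψ) ⟨0, fun x => by simp, by simp⟩

theorem sSup_dominatedValues_add (L : (X →ᵇ ℝ) →L[ℝ] ℝ) (ψ₁ ψ₂ : C_c(X, ℝ≥0)) :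
    sSup (dominatedValues L fun x => ((ψ₁ + ψ₂) x : ℝ)) =
      sSup (dominatedValues L fun x => (ψ₁ x : ℝ)) +
        sSup (dominatedValues L fun x => (ψ₂ x : ℝ)) := by
  have hb₁ := bddAbove_dominatedValues L ψ₁
  have hb₂ := bddAbove_dominatedValues L ψ₂
  have hb := bddAbove_dominatedValues L (ψ₁ + ψ₂)
  apply le_antisymm
  · refine csSup_le (dominatedValues_nonempty L fun x => by positivity) ?_
    rintro t ⟨g, hg, rfl⟩
    let c : C(X, ℝ) := ⟨fun x => max (-(ψ₁ x : ℝ)) (min (ψ₁ x) (g x)), by fun_prop⟩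
    have hc : ∀ x, |c x| ≤ ψ₁ x := fun x =>
      abs_le.2 ⟨le_max_left _ _, max_le (by simp) (min_le_left _ _)⟩
    obtain ⟨M, hM, hψ⟩ := exists_bound_compactlySupported ψ₁
    let g₁ : X →ᵇ ℝ := BoundedContinuousFunction.ofNormedAddCommGroup c c.continuous M
      fun x => (hc x).trans (hψ x)
    have hg₂ : ∀ x, |(g - g₁) x| ≤ ψ₂ x := fun x => by
      have h := abs_le.1 (hg x)
      simp only [CompactlySupportedContinuousMap.coe_add, Pi.add_apply, NNReal.coe_add] at h
      have h1 : (0 : ℝ) ≤ ψ₁ x := (ψ₁ x).2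
      have h2 : (0 : ℝ) ≤ ψ₂ x := (ψ₂ x).2
      change |g x - max (-(ψ₁ x : ℝ)) (min (ψ₁ x) (g x))| ≤ ψ₂ x
      rw [abs_le]
      rcases max_cases (-(ψ₁ x : ℝ)) (min (ψ₁ x : ℝ) (g x)) with ⟨e, _⟩ | ⟨e, _⟩ <;>
      rcases min_cases (ψ₁ x : ℝ) (g x) with ⟨e', _⟩ | ⟨e', _⟩ <;>
      rw [e] <;> constructor <;> linarith
    have e : L g = L g₁ + L (g - g₁) := by rw [← map_add, add_sub_cancel]
    rw [e]
    exact add_le_add (le_csSup hb₁ ⟨g₁, hc, rfl⟩) (le_csSup hb₂ ⟨g - g₁, hg₂, rfl⟩)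
  · rw [← le_sub_iff_add_le]
    refine csSup_le (dominatedValues_nonempty L fun x => by positivity) ?_
    rintro t ⟨g₁, hg₁, rfl⟩
    rw [le_sub_comm]
    refine csSup_le (dominatedValues_nonempty L fun x => by positivity) ?_
    rintro s ⟨g₂, hg₂, rfl⟩
    rw [le_sub_iff_add_le, add_comm, ← map_add]
    refine le_csSup hb ⟨g₁ + g₂, fun x => ?_, rfl⟩
    simpa using (abs_add_le _ _).trans (add_le_add (hg₁ x) (hg₂ x))

theorem sSup_dominatedValues_smul (L : (X →ᵇ ℝ) →L[ℝ] ℝ) (c : ℝ≥0) (ψ : C_c(X, ℝ≥0)) :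
    sSup (dominatedValues L fun x => ((c • ψ) x : ℝ)) =
      c * sSup (dominatedValues L fun x => (ψ x : ℝ)) := by
  have key : ∀ (c : ℝ≥0) (ψ : C_c(X, ℝ≥0)), c ≠ 0 →
      c * sSup (dominatedValues L fun x => (ψ x : ℝ)) ≤
        sSup (dominatedValues L fun x => ((c • ψ) x : ℝ)) := by
    intro c ψ hc
    have hc' : (0 : ℝ) < c := NNReal.coe_pos.2 (pos_iff_ne_zero.2 hc)
    rw [← le_div_iff₀' hc']
    refine csSup_le (dominatedValues_nonempty L fun x => by positivity) ?_
    rintro _ ⟨g, hg, rfl⟩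
    rw [le_div_iff₀' hc']
    refine le_csSup (bddAbove_dominatedValues L _) ⟨(c : ℝ) • g, fun x => ?_, by simp⟩
    have := mul_le_mul_of_nonneg_left (hg x) c.2
    simpa [abs_mul] using this
  rcases eq_or_ne c 0 with rfl | hc
  · have : dominatedValues L (fun x => (((0 : ℝ≥0) • ψ) x : ℝ)) = {0} := by
      ext t
      constructor
      · rintro ⟨g, hg, rfl⟩
        have : g = 0 := by
          ext x
          simpa using hg x
        simp [this]
      · rintro rfl
        exact ⟨0, fun x => by simp, by simp⟩
    rw [this]
    simp
  · refine le_antisymm ?_ (key c ψ hc)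
    have h := key c⁻¹ (c • ψ) (inv_ne_zero hc)
    rw [inv_smul_smul₀ hc, NNReal.coe_inv, inv_mul_le_iff₀ (by positivity)] at h
    exact h

/-- The total variation functional of a bounded functional on continuous functions. -/
def totalVariationFunctional (L : (X →ᵇ ℝ) →L[ℝ] ℝ) : C_c(X, ℝ≥0) →ₗ[ℝ≥0] ℝ≥0 where
  toFun ψ := ⟨sSup (dominatedValues L fun x => (ψ x : ℝ)), sSup_dominatedValues_nonneg L ψ⟩
  map_add' ψ₁ ψ₂ := NNReal.eq (sSup_dominatedValues_add L ψ₁ ψ₂)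
  map_smul' c ψ := NNReal.eq (sSup_dominatedValues_smul L c ψ)

/-- A bounded functional on bounded continuous functions is dominated on compactly supported
functions by integration against a finite measure. -/
theorem exists_finite_measure_dominating [T2Space X] [LocallyCompactSpace X] [MeasurableSpace X]
    [BorelSpace X] (L : (X →ᵇ ℝ) →L[ℝ] ℝ) :
    ∃ μ : Measure X, IsFiniteMeasure μ ∧
      ∀ g : X →ᵇ ℝ, HasCompactSupport g → |L g| ≤ ∫ x, |g x| ∂μ := by
  let Λ := totalVariationFunctional L
  refine ⟨NNRealRMK.rieszMeasure Λ, ⟨?_⟩, fun g hg => ?_⟩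
  · refine lt_of_le_of_lt ?_ (ENNReal.ofReal_lt_top (r := ‖L‖))
    rw [isOpen_univ.measure_eq_iSup_isCompact]
    refine iSup₂_le fun K _ => iSup_le fun hK => ?_
    obtain ⟨h, hK1, -, hc, h01⟩ := exists_continuous_one_zero_of_isCompact hK
      (isClosed_empty (X := X)) (Set.disjoint_empty K)
    let ψ : C_c(X, ℝ≥0) := ⟨⟨fun x => (h x).toNNReal, by fun_prop⟩,
      hc.comp_left Real.toNNReal_zero⟩
    have h1 : NNRealRMK.rieszMeasure Λ K ≤ ∫⁻ x, ψ x ∂(NNRealRMK.rieszMeasure Λ) := by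
      calc _ = ∫⁻ x in K, 1 ∂(NNRealRMK.rieszMeasure Λ) := by simp
        _ ≤ ∫⁻ x in K, ψ x ∂(NNRealRMK.rieszMeasure Λ) := by
          refine setLIntegral_mono' hK.measurableSet fun x hx => ?_
          have : h x = 1 := hK1 hx
          change (1 : ℝ≥0∞) ≤ ((h x).toNNReal : ℝ≥0∞)
          simp [this]
        _ ≤ _ := setLIntegral_le_lintegral _ _
    rw [NNRealRMK.lintegral_rieszMeasure] at h1
    refine h1.trans ?_
    refine (ENNReal.le_ofReal_iff_toReal_le ENNReal.coe_ne_top (norm_nonneg L)).2 ?_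
    refine csSup_le (dominatedValues_nonempty L fun x => by positivity) fun t ht => ?_
    have := le_of_mem_dominatedValues L zero_le_one (fun x => ?_) ht
    · simpa using this
    · change (((h x).toNNReal : ℝ≥0) : ℝ) ≤ 1
      rw [Real.coe_toNNReal _ (h01 x).1]
      exact (h01 x).2
  · let ψ : C_c(X, ℝ≥0) := ⟨⟨fun x => ‖g x‖₊, by fun_prop⟩, hg.comp_left nnnorm_zero⟩
    have hψ : ∫ x, |g x| ∂(NNRealRMK.rieszMeasure Λ) = Λ ψ :=
      NNRealRMK.integral_rieszMeasure Λ ψ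
    rw [hψ]
    have hb := bddAbove_dominatedValues L ψ
    refine abs_le'.2 ⟨le_csSup hb ⟨g, fun x => le_rfl, rfl⟩,
      le_csSup hb ⟨-g, fun x => ?_, by simp⟩⟩
    simp [ψ]

end RieszDomination

section TestFunctions

/-- Continuously differentiable functions with compact support in `Ω`. -/
structure IsTest (Ω : Set 𝔼) (φ : 𝔼 → ℝ) : Prop where
  contDiff : ContDiff ℝ 1 φ
  hasCompactSupport : HasCompactSupport φ
  tsupport_subset : tsupport φ ⊆ Ω

/-- The `k`-th partial derivative. -/
def partialD (k : Fin n) (φ : 𝔼 → ℝ) (x : 𝔼) : ℝ := fderiv ℝ φ x (EuclideanSpace.single k 1)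

namespace IsTest

variable {Ω Ω' : Set (EuclideanSpace ℝ (Fin n))} {φ ψ : EuclideanSpace ℝ (Fin n) → ℝ}

theorem mono (h : IsTest Ω φ) (hΩ : Ω ⊆ Ω') : IsTest Ω' φ :=
  ⟨h.1, h.2, h.3.trans hΩ⟩

theorem continuous (h : IsTest Ω φ) : Continuous φ := h.1.continuous

theorem differentiable (h : IsTest Ω φ) : Differentiable ℝ φ := h.1.differentiable (by norm_num)

theorem eq_zero (h : IsTest Ω φ) {x : 𝔼} (hx : x ∉ Ω) : φ x = 0 :=
  image_eq_zero_of_notMem_tsupport fun hx' => hx (h.3 hx')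

theorem partialD_continuous (h : IsTest Ω φ) (k : Fin n) : Continuous (partialD k φ) :=
  (h.1.continuous_fderiv (by norm_num)).clm_apply continuous_const

theorem partialD_hasCompactSupport (h : IsTest Ω φ) (k : Fin n) :
    HasCompactSupport (partialD k φ) :=
  h.2.fderiv_apply (𝕜 := ℝ) _

theorem partialD_eq_zero_of_notMem_tsupport (k : Fin n) {x : 𝔼}
    (hx : x ∉ tsupport φ) : partialD k φ x = 0 := by
  have : fderiv ℝ φ x = 0 := by
    by_contra h
    exact hx (support_fderiv_subset ℝ h)
  simp [partialD, this]

theorem partialD_eq_zero (h : IsTest Ω φ) (k : Fin n) {x : 𝔼} (hx : x ∉ Ω) :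
    partialD k φ x = 0 :=
  partialD_eq_zero_of_notMem_tsupport k fun hx' => hx (h.3 hx')

theorem exists_bound (h : IsTest Ω φ) : ∃ C, 0 ≤ C ∧ ∀ x, |φ x| ≤ C := by
  obtain ⟨C, hC⟩ := h.2.exists_bound_of_continuous h.continuous
  exact ⟨C, (norm_nonneg _).trans (hC 0), hC⟩

theorem add (h : IsTest Ω φ) (h' : IsTest Ω ψ) : IsTest Ω (φ + ψ) :=
  ⟨h.1.add h'.1, h.2.add h'.2,
    (tsupport_add φ ψ).trans (Set.union_subset h.3 h'.3)⟩

theorem const_smul (h : IsTest Ω φ) (c : ℝ) : IsTest Ω (c • φ) :=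
  ⟨h.1.const_smul c, h.2.smul_left, (tsupport_smul_subset_right (fun _ => c) φ).trans h.3⟩

theorem mul_left (h : IsTest Ω φ) {g : 𝔼 → ℝ} (hg : ContDiff ℝ 1 g) :
    IsTest Ω (fun x => φ x * g x) :=
  ⟨h.1.mul hg, h.2.mul_right, (tsupport_mul_subset_left (f := φ)).trans h.3⟩

theorem partialD_add (h : IsTest Ω φ) (h' : IsTest Ω ψ) (k : Fin n) (x : 𝔼) :
    partialD k (φ + ψ) x = partialD k φ x + partialD k ψ x := by
  simp [partialD, fderiv_add (h.differentiable x) (h'.differentiable x)]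

theorem partialD_const_smul (h : IsTest Ω φ) (c : ℝ) (k : Fin n) (x : 𝔼) :
    partialD k (c • φ) x = c * partialD k φ x := by
  simp [partialD, fderiv_const_smul (h.differentiable x) c]

theorem integrable_mul (h : IsTest Ω φ) {μ : Measure 𝔼} {g : 𝔼 → ℝ} (hg : Integrable g μ) :
    Integrable (fun x => φ x * g x) μ := by
  obtain ⟨C, -, hC⟩ := h.exists_bound
  exact hg.bdd_mul h.continuous.aestronglyMeasurable (Eventually.of_forall hC)

end IsTest

/-- The space of test functions. -/
def testSpace (Ω : Set 𝔼) : Submodule ℝ (𝔼 → ℝ) where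
  carrier := {φ | IsTest Ω φ}
  add_mem' h h' := h.add h'
  zero_mem' := ⟨contDiff_const, HasCompactSupport.zero, by simp [tsupport]⟩
  smul_mem' c _ h := h.const_smul c

theorem LocallyIntegrableOn.integrable_mul_of_hasCompactSupport {Ω : Set 𝔼} {f ψ : 𝔼 → ℝ}
    (hf : LocallyIntegrableOn f Ω volume) (hψ : Continuous ψ) (hc : HasCompactSupport ψ)
    (hs : tsupport ψ ⊆ Ω) : Integrable (fun x => f x * ψ x) volume := by
  have hi : IntegrableOn f (tsupport ψ) volume := hf.integrableOn_compact_subset hs hc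
  obtain ⟨C, hC⟩ := hc.exists_bound_of_continuous hψ
  have h := hi.mul_bdd (g := ψ) (c := C) hψ.aestronglyMeasurable (Eventually.of_forall hC)
  refine (integrableOn_iff_integrable_of_support_subset ?_).1 h
  intro x hx
  exact subset_tsupport _ (right_ne_zero_of_mul hx)

theorem IsTest.tsupport_partialD_subset {Ω : Set 𝔼} {φ : 𝔼 → ℝ} (_ : IsTest Ω φ) (k : Fin n) :
    tsupport (partialD k φ) ⊆ tsupport φ := by
  refine closure_minimal (fun x hx => ?_) (isClosed_tsupport φ)
  by_contra h
  exact hx (IsTest.partialD_eq_zero_of_notMem_tsupport k h)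

theorem LocallyIntegrableOn.integrable_mul_partialD {Ω : Set 𝔼} {f φ : 𝔼 → ℝ}
    (hf : LocallyIntegrableOn f Ω volume) (h : IsTest Ω φ) (k : Fin n) :
    Integrable (fun x => f x * partialD k φ x) volume :=
  LocallyIntegrableOn.integrable_mul_of_hasCompactSupport hf (h.partialD_continuous k)
    (h.partialD_hasCompactSupport k) ((h.tsupport_partialD_subset k).trans h.3)

/-- The distributional partial derivative as a linear functional. -/
def distribD (f : 𝔼 → ℝ) {Ω : Set 𝔼} (hf : LocallyIntegrableOn f Ω volume) (k : Fin n) :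
    testSpace Ω →ₗ[ℝ] ℝ where
  toFun φ := ∫ x, f x * partialD k φ x
  map_add' φ ψ := by
    rw [← integral_add (LocallyIntegrableOn.integrable_mul_partialD hf φ.2 k)
      (LocallyIntegrableOn.integrable_mul_partialD hf ψ.2 k)]
    congr 1
    funext x
    rw [← mul_add, ← IsTest.partialD_add φ.2 ψ.2]
    rfl
  map_smul' c φ := by
    rw [RingHom.id_apply, smul_eq_mul, ← integral_const_mul]
    congr 1
    funext x
    rw [mul_left_comm, ← IsTest.partialD_const_smul φ.2]
    rfl

/-- A functional on test functions dominated by integration against a finite measure has a density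
bounded by one. -/
theorem exists_density_of_testSpace {Ω : Set 𝔼} (ν : Measure 𝔼) [IsFiniteMeasure ν]
    (ℓ : testSpace Ω →ₗ[ℝ] ℝ) (h : ∀ φ : testSpace Ω, |ℓ φ| ≤ ∫ x, |(φ : 𝔼 → ℝ) x| ∂ν) :
    ∃ σ : 𝔼 → ℝ, Measurable σ ∧ (∀ x, |σ x| ≤ 1) ∧
      ∀ φ : testSpace Ω, ℓ φ = ∫ x, (φ : 𝔼 → ℝ) x * σ x ∂ν := by
  have hm : ∀ (φ : testSpace Ω) (p : ℝ≥0∞), MemLp (φ : 𝔼 → ℝ) p ν := fun φ p => by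
    obtain ⟨C, -, hC⟩ := IsTest.exists_bound φ.2
    exact MemLp.of_bound (IsTest.continuous φ.2).aestronglyMeasurable C (Eventually.of_forall hC)
  let ι : testSpace Ω →ₗ[ℝ] Lp ℝ 1 ν :=
    { toFun := fun φ => (hm φ 1).toLp _
      map_add' := fun φ ψ => MemLp.toLp_add (hm φ 1) (hm ψ 1)
      map_smul' := fun c φ => MemLp.toLp_const_smul c (hm φ 1) }
  have hι : ∀ φ, ‖ι φ‖ = ∫ x, |(φ : 𝔼 → ℝ) x| ∂ν := fun φ => by
    rw [L1.norm_eq_integral_norm]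
    refine integral_congr_ae ?_
    filter_upwards [(hm φ 1).coeFn_toLp] with x hx
    exact congrArg norm hx
  obtain ⟨L, hL, hLv⟩ := exists_clm_of_abs_le_norm ι ℓ 1 zero_le_one fun φ => by
    rw [one_mul, hι]
    exact h φ
  obtain ⟨σ, hσ, hσ1, hσL⟩ := exists_density_of_clm_L1 ν L hL
  exact ⟨σ, hσ, hσ1, fun φ => by rw [← hLv]; exact hσL _ (hm φ 2) (hm φ 1)⟩

open scoped BoundedContinuousFunction in
/-- A functional on test functions which is bounded for the uniform norm is given by a bounded
density with respect to a finite measure. -/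
theorem exists_measure_density_of_testSpace {Ω : Set 𝔼} (ℓ : testSpace Ω →ₗ[ℝ] ℝ) {C : ℝ}
    (hC : 0 ≤ C)
    (h : ∀ (φ : testSpace Ω) (M : ℝ), 0 < M → (∀ x, |(φ : 𝔼 → ℝ) x| ≤ M) → |ℓ φ| ≤ C * M) :
    ∃ (ν : Measure 𝔼) (σ : 𝔼 → ℝ), IsFiniteMeasure ν ∧ Measurable σ ∧ (∀ x, |σ x| ≤ 1) ∧
      ∀ φ : testSpace Ω, ℓ φ = ∫ x, (φ : 𝔼 → ℝ) x * σ x ∂ν := by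
  choose B hB hBφ using fun φ : testSpace Ω => IsTest.exists_bound φ.2
  let ι : testSpace Ω →ₗ[ℝ] (𝔼 →ᵇ ℝ) :=
    { toFun := fun φ => BoundedContinuousFunction.ofNormedAddCommGroup φ
        (IsTest.continuous φ.2) (B φ) (hBφ φ)
      map_add' := fun φ ψ => by ext x; rfl
      map_smul' := fun c φ => by ext x; rfl }
  obtain ⟨L, -, hLv⟩ := exists_clm_of_abs_le_norm ι ℓ C hC fun φ => by
    refine le_of_forall_pos_le_add fun ε hε => ?_
    have h1 : 0 < ε / (C + 1) := by positivity
    have h2 := h φ (‖ι φ‖ + ε / (C + 1)) (by positivity)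
      fun x => ((ι φ).norm_coe_le_norm x).trans (by linarith)
    refine h2.trans ?_
    rw [mul_add]
    gcongr
    rw [← mul_div_assoc, div_le_iff₀ (by positivity)]
    nlinarith
  obtain ⟨ν, hν, hνL⟩ := exists_finite_measure_dominating L
  obtain ⟨σ, hσ, hσ1, hσL⟩ := exists_density_of_testSpace ν ℓ fun φ => by
    rw [← hLv]
    exact hνL (ι φ) (IsTest.hasCompactSupport φ.2)
  exact ⟨ν, σ, hν, hσ, hσ1, hσL⟩

theorem vdiv_eq_sum {Φ : 𝔼 → 𝔼} (hΦ : ContDiff ℝ 1 Φ) (x : 𝔼) :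
    vdiv n Φ x = ∑ i, partialD i (fun y => Φ y i) x := by
  refine Finset.sum_congr rfl fun i _ => ?_
  have h : HasFDerivAt (fun y => Φ y i) ((EuclideanSpace.proj i).comp (fderiv ℝ Φ x)) x :=
    (EuclideanSpace.proj (𝕜 := ℝ) i).hasFDerivAt.comp x
      ((hΦ.differentiable (by norm_num)) x).hasFDerivAt
  rw [partialD, h.fderiv]
  rfl

theorem isTest_component {Ω : Set 𝔼} {Φ : 𝔼 → 𝔼} (h : ContDiff ℝ 1 Φ)
    (hc : HasCompactSupport Φ) (hs : tsupport Φ ⊆ Ω) (i : Fin n) :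
    IsTest Ω (fun x => Φ x i) := by
  have hsub : tsupport (fun x => Φ x i) ⊆ tsupport Φ := by
    refine closure_mono fun x hx => ?_
    contrapose! hx
    rw [Function.notMem_support] at hx ⊢
    simp [hx]
  exact ⟨(contDiff_euclidean.1 h) i, hc.of_isClosed_subset (isClosed_tsupport _) hsub, hsub.trans hs⟩

end TestFunctions

section Gradient

/-- The distributional gradient of `F` on `Ω` is `a dx + b dμ₀`. -/
structure HasGradient (F : 𝔼 → ℝ) (Ω : Set 𝔼) (μ₀ : Measure 𝔼) (a b : 𝔼 → 𝔼) : Prop where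
  locallyIntegrableOn : LocallyIntegrableOn F Ω volume
  integrable_ac : Integrable a volume
  integrable_sing : Integrable b μ₀
  integral_eq : ∀ φ, IsTest Ω φ → ∀ k, ∫ x, F x * partialD k φ x =
    -((∫ x, φ x * a x k) + ∫ x, φ x * b x k ∂μ₀)

theorem HasGradient.mono {F : 𝔼 → ℝ} {Ω Ω' : Set 𝔼} {μ₀ : Measure 𝔼} {a b : 𝔼 → 𝔼}
    (h : HasGradient F Ω μ₀ a b) (hΩ : Ω' ⊆ Ω) : HasGradient F Ω' μ₀ a b :=
  ⟨h.1.mono_set hΩ, h.2, h.3, fun φ hφ => h.4 φ (hφ.mono hΩ)⟩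

theorem setIntegral_mul_vdiv {F : 𝔼 → ℝ} {Ω : Set 𝔼} (hF : LocallyIntegrableOn F Ω volume)
    {Φ : 𝔼 → 𝔼} (h : ContDiff ℝ 1 Φ) (hc : HasCompactSupport Φ) (hs : tsupport Φ ⊆ Ω) :
    ∫ x in Ω, F x * vdiv n Φ x = ∑ k, ∫ x, F x * partialD k (fun y => Φ y k) x := by
  have ht := isTest_component h hc hs
  rw [← integral_finsetSum]
  · rw [setIntegral_eq_integral_of_forall_compl_eq_zero]
    · simp_rw [vdiv_eq_sum h, Finset.mul_sum]
    · intro x hx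
      rw [vdiv_eq_sum h, Finset.sum_eq_zero, mul_zero]
      exact fun k _ => (ht k).partialD_eq_zero k hx
  · exact fun k _ => LocallyIntegrableOn.integrable_mul_partialD hF (ht k) k

theorem abs_integral_mul_partialD_le {f : 𝔼 → ℝ} {Ω : Set 𝔼}
    (hf : LocallyIntegrableOn f Ω volume) (hvar : variation n f Ω < ⊤) {φ : 𝔼 → ℝ}
    (hφ : IsTest Ω φ) {M : ℝ} (hM : 0 < M) (hφM : ∀ x, |φ x| ≤ M) (k : Fin n) :
    |∫ x, f x * partialD k φ x| ≤ (variation n f Ω).toReal * M := by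
  have key : ∀ c : ℝ, |c| = M⁻¹ →
      c * ∫ x, f x * partialD k φ x ≤ (variation n f Ω).toReal := by
    intro c hc
    let T : ℝ →L[ℝ] 𝔼 := ContinuousLinearMap.toSpanSingleton ℝ (EuclideanSpace.single k 1)
    have hT : ∀ t, T t = t • EuclideanSpace.single k 1 := fun t => rfl
    have hcφ := hφ.const_smul c
    have hcomp : ∀ i, (fun y => (T ∘ (c • φ)) y i) = if i = k then c • φ else 0 := by
      intro i
      funext y
      by_cases hi : i = k <;> simp [hT, hi]
    have hcd : ContDiff ℝ 1 (T ∘ (c • φ)) := T.contDiff.comp hcφ.1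
    have hcs : HasCompactSupport (T ∘ (c • φ)) := hcφ.2.comp_left (map_zero T)
    have hts : tsupport (T ∘ (c • φ)) ⊆ Ω :=
      (closure_mono (Function.support_comp_subset (map_zero T) _)).trans hcφ.3
    have hle : ENNReal.ofReal (∫ x in Ω, f x * vdiv n (T ∘ (c • φ)) x) ≤ variation n f Ω := by
      refine le_iSup_of_le (T ∘ (c • φ)) <| le_iSup_of_le hcd <| le_iSup_of_le hcs <|
        le_iSup_of_le hts <| le_iSup_of_le (fun x => ?_) le_rfl
      simp only [Function.comp, hT, norm_smul, Pi.smul_apply, smul_eq_mul, norm_mul,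
        Real.norm_eq_abs, hc, PiLp.norm_single, norm_one, mul_one]
      rw [inv_mul_le_iff₀ hM, mul_one]
      simpa using hφM x
    rw [setIntegral_mul_vdiv hf hcd hcs hts, Finset.sum_eq_single k] at hle
    · rw [hcomp, if_pos rfl] at hle
      simp_rw [hφ.partialD_const_smul, mul_left_comm _ c, integral_const_mul] at hle
      exact (ENNReal.ofReal_le_iff_le_toReal hvar.ne).1 hle
    · intro i _ hi
      rw [hcomp, if_neg hi]
      simp [partialD]
    · simp
  have h1 := key M⁻¹ (abs_of_pos (by positivity))
  have h2 := key (-M⁻¹) (by rw [abs_neg, abs_of_pos (by positivity)])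
  rw [inv_mul_le_iff₀ hM] at h1
  rw [neg_mul, ← mul_neg, inv_mul_le_iff₀ hM] at h2
  rw [abs_le]
  constructor <;> linarith

theorem integral_mul_eq_rnDeriv_add_singularPart (ν : Measure 𝔼) [IsFiniteMeasure ν] {g : 𝔼 → ℝ}
    (hg : Integrable g ν) :
    ∫ x, g x ∂ν = (∫ x, g x * (ν.rnDeriv volume x).toReal) + ∫ x, g x ∂(ν.singularPart volume) := by
  have h0 := ν.haveLebesgueDecomposition_add volume
  have hg' := hg
  rw [h0] at hg'
  conv_lhs => rw [h0]
  rw [integral_add_measure hg'.left_of_add_measure hg'.right_of_add_measure, add_comm]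
  congr 1
  rw [integral_withDensity_eq_integral_toReal_smul (Measure.measurable_rnDeriv _ _)
    (Measure.rnDeriv_lt_top _ _)]
  simp_rw [smul_eq_mul, mul_comm]

theorem exists_hasGradient {f : 𝔼 → ℝ} {Ω : Set 𝔼} (hΩ : MeasurableSet Ω)
    (hf : LocallyIntegrableOn f Ω volume)
    (hvar : variation n f Ω < ⊤) :
    ∃ (μ₀ : Measure 𝔼) (a b : 𝔼 → 𝔼), IsFiniteMeasure μ₀ ∧ μ₀ ⟂ₘ volume ∧ μ₀ Ωᶜ = 0 ∧
      HasGradient f Ω μ₀ a b := by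
  have H := fun k => exists_measure_density_of_testSpace (distribD f hf k)
    (C := (variation n f Ω).toReal) ENNReal.toReal_nonneg
    fun φ M hM hφ => abs_integral_mul_partialD_le hf hvar φ.2 hM hφ k
  choose ν σ hν hσ hσ1 hσν using H
  let s : Fin n → Measure 𝔼 := fun k => ((ν k).singularPart volume).restrict Ω
  have hs : ∀ k, IsFiniteMeasure (s k) := fun k => by
    simp only [s]
    infer_instance
  let μ₀ : Measure 𝔼 := Measure.sum s
  have hμ : IsFiniteMeasure μ₀ := by
    simp only [μ₀, Measure.sum_fintype]
    infer_instance
  have hsμ : ∀ k, s k ≪ μ₀ := fun k =>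
    Measure.absolutelyContinuous_of_le (Measure.le_sum s k)
  have hra : ∀ k, Integrable (fun x => σ k x * ((ν k).rnDeriv volume x).toReal) volume := fun k =>
    Measure.integrable_toReal_rnDeriv.bdd_mul (hσ k).aestronglyMeasurable
      (Eventually.of_forall (hσ1 k))
  have hrb : ∀ k, Integrable (fun x => σ k x * ((s k).rnDeriv μ₀ x).toReal) μ₀ := fun k =>
    Measure.integrable_toReal_rnDeriv.bdd_mul (hσ k).aestronglyMeasurable
      (Eventually.of_forall (hσ1 k))
  refine ⟨μ₀, fun x => WithLp.toLp 2 fun k => -(σ k x * ((ν k).rnDeriv volume x).toReal),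
    fun x => WithLp.toLp 2 fun k => -(σ k x * ((s k).rnDeriv μ₀ x).toReal), hμ, ?_, ?_, hf, ?_, ?_,
    ?_⟩
  · exact Measure.MutuallySingular.sum_left.2 fun k =>
      ((ν k).mutuallySingular_singularPart volume).restrict Ω
  · rw [Measure.sum_apply_eq_zero' hΩ.compl]
    intro k
    simp [s, Measure.restrict_apply hΩ.compl]
  · exact integrable_piLp_iff.2 fun k => (hra k).neg
  · exact integrable_piLp_iff.2 fun k => (hrb k).neg
  · intro φ hφ k
    have h1 := hσν k ⟨φ, hφ⟩
    change ∫ x, f x * partialD k φ x = ∫ x, φ x * σ k x ∂ν k at h1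
    have hi : Integrable (fun x => φ x * σ k x) (ν k) :=
      hφ.integrable_mul (Integrable.of_bound (hσ k).aestronglyMeasurable 1
        (Eventually.of_forall (hσ1 k)))
    rw [h1, integral_mul_eq_rnDeriv_add_singularPart _ hi]
    have h2 : ∫ x, φ x * σ k x ∂((ν k).singularPart volume) = ∫ x, φ x * σ k x ∂(s k) := by
      rw [setIntegral_eq_integral_of_forall_compl_eq_zero]
      intro x hx
      rw [hφ.eq_zero hx, zero_mul]
    have : (s k).HaveLebesgueDecomposition μ₀ :=
      Measure.haveLebesgueDecomposition_of_sigmaFinite _ _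
    rw [h2, ← integral_rnDeriv_smul (hsμ k)]
    simp only [smul_eq_mul, mul_neg, integral_neg, neg_add, neg_neg]
    congr 1
    · simp_rw [mul_assoc]
    · refine integral_congr_ae (Eventually.of_forall fun x => ?_)
      dsimp only
      ring

end Gradient

section VariationPair

theorem contDiff_single_smul {φ : 𝔼 → ℝ} (hφ : ContDiff ℝ 1 φ) (k : Fin n) :
    ContDiff ℝ 1 fun x => φ x • (EuclideanSpace.single k 1 : 𝔼) :=
  hφ.smul contDiff_const

/-- The measure in a polar decomposition of the gradient is unique. -/
theorem IsVariationPair.measure_unique {F : 𝔼 → ℝ} {Ω : Set 𝔼} (hΩ : IsOpen Ω)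
    {μ μ' : Measure 𝔼} {σ σ' : 𝔼 → 𝔼} (h : IsVariationPair n F Ω μ σ)
    (h' : IsVariationPair n F Ω μ' σ') : μ = μ' := by
  obtain ⟨hμ, hμΩ, hσ, hσ1, hInt⟩ := h
  obtain ⟨hμ', hμΩ', hσ', hσ1', hInt'⟩ := h'
  set m := μ + μ' with hm
  have hmf : IsFiniteMeasure m := by
    rw [hm]
    infer_instance
  have hld : ∀ (ρ : Measure 𝔼) [IsFiniteMeasure ρ], ρ.HaveLebesgueDecomposition m := fun ρ _ =>
    Measure.haveLebesgueDecomposition_of_sigmaFinite ρ m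
  have := hld μ
  have := hld μ'
  have hac : μ ≪ m := Measure.absolutelyContinuous_of_le (Measure.le_add_right le_rfl)
  have hac' : μ' ≪ m := Measure.absolutelyContinuous_of_le (Measure.le_add_left le_rfl)
  have hi : Integrable σ μ := Integrable.of_bound hσ 1 (hσ1.mono fun x hx => hx.le)
  have hi' : Integrable σ' μ' := Integrable.of_bound hσ' 1 (hσ1'.mono fun x hx => hx.le)
  have hI := (integrable_rnDeriv_smul_iff hac).2 hi
  have hI' := (integrable_rnDeriv_smul_iff hac').2 hi'
  have hz : ∀ k, ∀ᵐ x ∂m, x ∈ Ω → (μ.rnDeriv m x).toReal • σ x k -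
      (μ'.rnDeriv m x).toReal • σ' x k = 0 := by
    intro k
    have hIk := integrable_piLp_iff.1 hI k
    have hIk' := integrable_piLp_iff.1 hI' k
    refine hΩ.ae_eq_zero_of_integral_contDiff_smul_eq_zero
      ((hIk.sub hIk').locallyIntegrable.locallyIntegrableOn _) fun g hg hgc hgs => ?_
    have hg1 : ContDiff ℝ 1 g := hg.of_le (by exact_mod_cast le_top)
    have hgt : IsTest Ω g := ⟨hg1, hgc, hgs⟩
    have hsupp : tsupport (fun x => g x • (EuclideanSpace.single k 1 : 𝔼)) ⊆ Ω :=
      (tsupport_smul_subset_left g _).trans hgs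
    have e1 := hInt _ (contDiff_single_smul hg1 k) hgc.smul_right hsupp
    have e2 := hInt' _ (contDiff_single_smul hg1 k) hgc.smul_right hsupp
    rw [e1, neg_inj] at e2
    simp only [inner_smul_left, EuclideanSpace.inner_single_left, map_one, one_mul,
      conj_trivial] at e2
    rw [← integral_rnDeriv_smul hac, ← integral_rnDeriv_smul hac'] at e2
    simp only [smul_eq_mul, mul_sub]
    simp only [PiLp.smul_apply, smul_eq_mul] at hIk hIk'
    rw [integral_sub (hgt.integrable_mul hIk) (hgt.integrable_mul hIk'), sub_eq_zero]
    simp only [smul_eq_mul, mul_left_comm _ (g _)] at e2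
    exact e2
  have hmΩ : ∀ᵐ x ∂m, x ∈ Ω := by
    rw [ae_iff]
    change m Ωᶜ = 0
    simp [hm, hμΩ, hμΩ']
  have hn : ∀ {ρ : Measure 𝔼} (_ : IsFiniteMeasure ρ) {s : 𝔼 → 𝔼} (_ : ρ ≪ m)
      (_ : ∀ᵐ x ∂ρ, ‖s x‖ = 1),
      ∀ᵐ x ∂m, ENNReal.ofReal ‖(ρ.rnDeriv m x).toReal • s x‖ = ρ.rnDeriv m x := by
    intro ρ hρf s hρ hs
    have := hld ρ
    rw [← Measure.withDensity_rnDeriv_eq ρ m hρ,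
      ae_withDensity_iff (Measure.measurable_rnDeriv _ _)] at hs
    filter_upwards [hs, Measure.rnDeriv_lt_top ρ m] with x hx hx'
    by_cases h0 : ρ.rnDeriv m x = 0
    · simp [h0]
    · rw [norm_smul, hx h0, mul_one, Real.norm_of_nonneg ENNReal.toReal_nonneg,
        ENNReal.ofReal_toReal hx'.ne]
  rw [← Measure.withDensity_rnDeriv_eq μ m hac, ← Measure.withDensity_rnDeriv_eq μ' m hac']
  refine withDensity_congr_ae ?_
  filter_upwards [hmΩ, ae_all_iff.2 hz, hn hμ hac hσ1, hn hμ' hac' hσ1'] with x h1 h2 h3 h4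
  rw [← h3, ← h4]
  congr 2
  ext k
  exact sub_eq_zero.1 (h2 k h1)

variable {F : EuclideanSpace ℝ (Fin n) → ℝ} {Ω Ω' : Set (EuclideanSpace ℝ (Fin n))}
  {μ₀ : Measure (EuclideanSpace ℝ (Fin n))}
  {a b a' b' : EuclideanSpace ℝ (Fin n) → EuclideanSpace ℝ (Fin n)}

theorem HasGradient.congr_ae (h : HasGradient F Ω μ₀ a b) (ha : a =ᵐ[volume] a')
    (hb : b =ᵐ[μ₀] b') : HasGradient F Ω μ₀ a' b' := by
  refine ⟨h.1, h.2.congr ha, h.3.congr hb, fun φ hφ k => ?_⟩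
  rw [h.4 φ hφ k]
  congr 2
  · exact integral_congr_ae (ha.mono fun x hx => by simp only [hx])
  · exact integral_congr_ae (hb.mono fun x hx => by simp only [hx])

theorem HasGradient.restrict (h : HasGradient F Ω μ₀ a b) (hΩ : Ω' ⊆ Ω) :
    HasGradient F Ω' (μ₀.restrict Ω') a b := by
  refine ⟨h.1.mono_set hΩ, h.2, h.3.restrict, fun φ hφ k => ?_⟩
  rw [h.4 φ (hφ.mono hΩ) k, setIntegral_eq_integral_of_forall_compl_eq_zero (s := Ω')]
  intro x hx
  rw [hφ.eq_zero hx, zero_mul]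

theorem HasGradient.integral_mul_vdiv (h : HasGradient F Ω μ₀ a b) {Φ : 𝔼 → 𝔼}
    (h1 : ContDiff ℝ 1 Φ) (hc : HasCompactSupport Φ) (hs : tsupport Φ ⊆ Ω) :
    ∫ x in Ω, F x * vdiv n Φ x = -((∫ x, ⟪Φ x, a x⟫) + ∫ x, ⟪Φ x, b x⟫ ∂μ₀) := by
  have ht := isTest_component h1 hc hs
  rw [setIntegral_mul_vdiv h.1 h1 hc hs]
  simp_rw [fun k => h.4 _ (ht k) k, Finset.sum_neg_distrib, Finset.sum_add_distrib]
  have hin : ∀ x y : 𝔼, ⟪x, y⟫ = ∑ k, x k * y k := fun x y => by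
    rw [PiLp.inner_apply]
    exact Finset.sum_congr rfl fun k _ => by simp [mul_comm]
  simp_rw [hin]
  rw [integral_finsetSum, integral_finsetSum]
  · exact fun k _ => (ht k).integrable_mul (integrable_piLp_iff.1 h.3 k)
  · exact fun k _ => (ht k).integrable_mul (integrable_piLp_iff.1 h.2 k)

theorem variation_le_of_hasGradient (h : HasGradient F Ω μ₀ a b) :
    variation n F Ω ≤ ENNReal.ofReal ((∫ x, ‖a x‖) + ∫ x, ‖b x‖ ∂μ₀) := by
  refine iSup_le fun Φ => iSup_le fun h1 => iSup_le fun hc => iSup_le fun hs =>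
    iSup_le fun hb => ENNReal.ofReal_le_ofReal ?_
  rw [h.integral_mul_vdiv h1 hc hs]
  refine (neg_le_abs _).trans ((abs_add_le _ _).trans (add_le_add ?_ ?_))
  · rw [← Real.norm_eq_abs]
    refine norm_integral_le_of_norm_le h.2.norm (Eventually.of_forall fun x => ?_)
    exact (norm_inner_le_norm _ _).trans (mul_le_of_le_one_left (norm_nonneg _) (hb x))
  · rw [← Real.norm_eq_abs]
    refine norm_integral_le_of_norm_le h.3.norm (Eventually.of_forall fun x => ?_)
    exact (norm_inner_le_norm _ _).trans (mul_le_of_le_one_left (norm_nonneg _) (hb x))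

theorem HasGradient.exists_isVariationPair_of_measurable (h : HasGradient F Ω μ₀ a b)
    (ha : Measurable a) (hb : Measurable b) (hΩ : MeasurableSet Ω) (hs : μ₀ ⟂ₘ volume)
    (hμΩ : μ₀ Ωᶜ = 0) :
    ∃ σ, IsVariationPair n F Ω (μ₀.withDensity (fun x => ‖b x‖ₑ) +
      (volume.restrict Ω).withDensity (fun x => ‖a x‖ₑ)) σ := by
  set Z := hs.nullSetᶜ with hZ
  have hZm : MeasurableSet Z := hs.measurableSet_nullSet.compl
  have hZv : volume Z = 0 := hs.measure_compl_nullSet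
  have hZμ : μ₀ Zᶜ = 0 := by rw [hZ, compl_compl]; exact hs.measure_nullSet
  let s : 𝔼 → 𝔼 := Z.piecewise b a
  have hsm : Measurable s := hb.piecewise hZm ha
  have hsa : ∀ᵐ x ∂(volume.restrict Ω), s x = a x := by
    refine ae_restrict_of_ae ?_
    have : ∀ᵐ x, x ∉ Z := by
      rw [ae_iff]
      simpa using hZv
    filter_upwards [this] with x hx
    exact Set.piecewise_eq_of_notMem _ _ _ hx
  have hsb : ∀ᵐ x ∂μ₀, s x = b x := by
    have : ∀ᵐ x ∂μ₀, x ∈ Z := hZμ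
    filter_upwards [this] with x hx
    exact Set.piecewise_eq_of_mem _ _ _ hx
  have hP : μ₀.withDensity (fun x => ‖b x‖ₑ) + (volume.restrict Ω).withDensity (fun x => ‖a x‖ₑ) =
      (μ₀ + volume.restrict Ω).withDensity fun x => ‖s x‖ₑ := by
    rw [withDensity_add_measure]
    congr 1
    · exact withDensity_congr_ae (hsb.mono fun x hx => by simp only [hx])
    · exact withDensity_congr_ae (hsa.mono fun x hx => by simp only [hx])
  rw [hP]
  have hs1 : Integrable s μ₀ := h.3.congr (hsb.mono fun x hx => hx.symm)
  have hs2 : Integrable s (volume.restrict Ω) :=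
    h.2.restrict.congr (hsa.mono fun x hx => hx.symm)
  have hsi : Integrable s (μ₀ + volume.restrict Ω) := hs1.add_measure hs2
  have hnm : Measurable fun x => ‖s x‖ₑ := hsm.enorm
  refine ⟨fun x => ‖s x‖⁻¹ • s x, isFiniteMeasure_withDensity hsi.2.ne, ?_, ?_, ?_, ?_⟩
  · rw [withDensity_apply _ hΩ.compl, Measure.restrict_add, Measure.restrict_restrict hΩ.compl,
      Measure.restrict_eq_zero.2 hμΩ]
    simp
  · exact (hsm.norm.inv.smul hsm).aestronglyMeasurable
  · rw [ae_withDensity_iff hnm]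
    refine Eventually.of_forall fun x hx => ?_
    rw [enorm_ne_zero] at hx
    rw [norm_smul, norm_inv, norm_norm, inv_mul_cancel₀ (norm_ne_zero_iff.2 hx)]
  · intro Φ h1 hc hsΦ
    rw [h.integral_mul_vdiv h1 hc hsΦ, integral_withDensity_eq_integral_toReal_smul hnm
      (Eventually.of_forall fun x => enorm_lt_top)]
    have hpt : ∀ x, ‖s x‖ₑ.toReal • ⟪Φ x, ‖s x‖⁻¹ • s x⟫ = ⟪Φ x, s x⟫ := fun x => by
      rw [toReal_enorm, inner_smul_right, smul_eq_mul, ← mul_assoc]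
      by_cases hx : s x = 0
      · simp [hx]
      · rw [mul_inv_cancel₀ (norm_ne_zero_iff.2 hx), one_mul]
    simp_rw [hpt]
    obtain ⟨C, hC⟩ := hc.exists_bound_of_continuous h1.continuous
    have hb : ∀ {ρ : Measure 𝔼}, Integrable s ρ → Integrable (fun x => ⟪Φ x, s x⟫) ρ :=
      fun {ρ} hρ => (hρ.norm.const_mul C).mono'
        (h1.continuous.aestronglyMeasurable.inner hρ.1) (Eventually.of_forall fun x =>
          (norm_inner_le_norm _ _).trans (by gcongr; exact hC x))
    rw [integral_add_measure (hb hs1) (hb hs2), add_comm]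
    congr 2
    · exact integral_congr_ae (hsb.mono fun x hx => by simp only [hx])
    · rw [integral_congr_ae (g := fun x => ⟪Φ x, a x⟫) (hsa.mono fun x hx => by simp only [hx])]
      rw [setIntegral_eq_integral_of_forall_compl_eq_zero]
      intro x hx
      rw [image_eq_zero_of_notMem_tsupport fun hx' => hx (hsΦ hx'), inner_zero_left]

theorem HasGradient.exists_isVariationPair (h : HasGradient F Ω μ₀ a b)
    (hΩ : MeasurableSet Ω) (hs : μ₀ ⟂ₘ volume) (hμΩ : μ₀ Ωᶜ = 0) :
    ∃ σ, IsVariationPair n F Ω (μ₀.withDensity (fun x => ‖b x‖ₑ) +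
      (volume.restrict Ω).withDensity (fun x => ‖a x‖ₑ)) σ := by
  have ha := h.2.1.ae_eq_mk
  have hb := h.3.1.ae_eq_mk
  rw [withDensity_congr_ae (hb.mono fun x hx => congrArg _ hx),
    withDensity_congr_ae (ae_restrict_of_ae (ha.mono fun x hx => congrArg _ hx))]
  exact (h.congr_ae ha hb).exists_isVariationPair_of_measurable
    h.2.1.stronglyMeasurable_mk.measurable h.3.1.stronglyMeasurable_mk.measurable hΩ hs hμΩ

theorem HasGradient.var_eq (h : HasGradient F Ω μ₀ a b) (hΩ : IsOpen Ω) [SFinite μ₀]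
    (hs : μ₀ ⟂ₘ volume) (hμΩ : μ₀ Ωᶜ = 0) :
    absVar n F Ω = ∫⁻ x in Ω, ‖a x‖ₑ ∧
    cantorVar n F Ω = ∫⁻ x in Ω \ approxDiscontSet n F, ‖b x‖ₑ ∂μ₀ ∧
    jumpVar n F Ω = ∫⁻ x in jumpSet n F ∩ Ω, ‖b x‖ₑ ∂μ₀ := by
  obtain ⟨σ, hσ⟩ := h.exists_isVariationPair hΩ.measurableSet hs hμΩ
  have hex : ∃ p : Measure 𝔼 × (𝔼 → 𝔼), IsVariationPair n F Ω p.1 p.2 := ⟨⟨_, σ⟩, hσ⟩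
  have huniq := hex.choose_spec.measure_unique hΩ hσ
  have hwd : (volume.restrict Ω).withDensity (fun x => ‖a x‖ₑ) =
      volume.withDensity (Ω.indicator fun x => ‖a x‖ₑ) :=
    (withDensity_indicator hΩ.measurableSet _).symm
  have hsing : μ₀.withDensity (fun x => ‖b x‖ₑ) ⟂ₘ volume :=
    hs.mono_ac (withDensity_absolutelyContinuous _ _) Measure.AbsolutelyContinuous.rfl
  have ham : AEMeasurable (Ω.indicator fun x => ‖a x‖ₑ) volume :=
    h.2.1.enorm.indicator hΩ.measurableSet
  rw [hwd] at huniq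
  have hsp : hex.choose.1.singularPart volume = μ₀.withDensity fun x => ‖b x‖ₑ := by
    rw [huniq, withDensity_congr_ae ham.ae_eq_mk]
    exact (Measure.eq_singularPart ham.measurable_mk hsing rfl).symm
  have hrn := Measure.eq_rnDeriv₀ ham hsing huniq
  refine ⟨?_, ?_, ?_⟩
  · rw [absVar, dif_pos hex, ← withDensity_congr_ae hrn, ← hwd, withDensity_apply' _ Ω,
      Measure.restrict_restrict hΩ.measurableSet, Set.inter_self]
  · rw [cantorVar, dif_pos hex, hsp, withDensity_apply']
  · rw [jumpVar, dif_pos hex, hsp, withDensity_apply']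

end VariationPair

section LebesguePoints

/-- `F` has approximate limit `c` at `x`. -/
def LebAt (F : 𝔼 → ℝ) (x : 𝔼) (c : ℝ) : Prop :=
  Tendsto (fun r : ℝ => ⨍ y in ball x r, |F y - c| ∂volume) (𝓝[>] 0) (𝓝 0)

theorem notMem_approxDiscontSet_iff {F : 𝔼 → ℝ} {x : 𝔼} :
    x ∉ approxDiscontSet n F ↔ ∃ c, LebAt F x c := by
  rw [approxDiscontSet]
  exact not_not

/-- `g` and `f` have the same oscillation at `x`. -/
def CloseAt (f g : 𝔼 → ℝ) (x : 𝔼) : Prop :=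
  ∀ η > 0, ∃ r > 0, ∀ y ∈ ball x r, |g y - f y| ≤ η

theorem CloseAt.symm {f g : 𝔼 → ℝ} {x : 𝔼} (h : CloseAt f g x) : CloseAt g f x := by
  intro η hη
  obtain ⟨r, hr, h⟩ := h η hη
  exact ⟨r, hr, fun y hy => by rw [abs_sub_comm]; exact h y hy⟩

theorem setAverage_nonneg {A : Set 𝔼} {g : 𝔼 → ℝ} (hg : ∀ x, 0 ≤ g x) :
    0 ≤ ⨍ x in A, g x := by
  rw [setAverage_eq]
  exact smul_nonneg (inv_nonneg.2 measureReal_nonneg) (integral_nonneg hg)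

theorem IntegrableOn.abs_sub_const {F : 𝔼 → ℝ} {A B : Set 𝔼} (h : IntegrableOn F B)
    (hAB : A ⊆ B) (hA : volume A ≠ ⊤) (c : ℝ) : IntegrableOn (fun y => |F y - c|) A :=
  ((h.mono_set hAB).sub (integrableOn_const hA)).abs

theorem CloseAt.tendsto_setAverage {f g : 𝔼 → ℝ} {x : 𝔼} (h : CloseAt f g x) {r₀ : ℝ}
    (hr₀ : 0 < r₀) (hf : IntegrableOn f (ball x r₀)) (hg : IntegrableOn g (ball x r₀))
    {A : ℝ → Set 𝔼} (hA : ∀ r, A r ⊆ ball x r) (hAm : ∀ r, MeasurableSet (A r)) {c : ℝ}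
    (ht : Tendsto (fun r : ℝ => ⨍ y in A r, |f y - c| ∂volume) (𝓝[>] 0) (𝓝 0)) :
    Tendsto (fun r : ℝ => ⨍ y in A r, |g y - c| ∂volume) (𝓝[>] 0) (𝓝 0) := by
  rw [Metric.tendsto_nhds] at ht ⊢
  intro ε hε
  obtain ⟨r, hr, hfg⟩ := h (ε / 2) (by positivity)
  filter_upwards [ht (ε / 2) (by positivity), Ioo_mem_nhdsGT (lt_min hr hr₀)] with s hs hs'
  rw [Real.dist_0_eq_abs, abs_of_nonneg (setAverage_nonneg fun _ => abs_nonneg _)] at hs ⊢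
  have hs1 : s < r := hs'.2.trans_le (min_le_left _ _)
  have hs2 : s < r₀ := hs'.2.trans_le (min_le_right _ _)
  have hfin : volume (A s) ≠ ⊤ := ((measure_mono (hA s)).trans_lt measure_ball_lt_top).ne
  have hsub : A s ⊆ ball x r₀ := (hA s).trans (ball_subset_ball hs2.le)
  have hif := IntegrableOn.abs_sub_const hf hsub hfin c
  have hig := IntegrableOn.abs_sub_const hg hsub hfin c
  have hle : ∫ y in A s, |g y - c| ≤ ∫ y in A s, (|f y - c| + ε / 2) := by
    refine setIntegral_mono_on hig (hif.add (integrableOn_const hfin)) (hAm s) fun y hy => ?_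
    have := hfg y (ball_subset_ball hs1.le (hA s hy))
    have h3 := abs_add_le (g y - f y) (f y - c)
    rw [sub_add_sub_cancel] at h3
    linarith
  rw [integral_add hif (integrableOn_const hfin), setIntegral_const, smul_eq_mul] at hle
  rw [setAverage_eq, smul_eq_mul] at hs ⊢
  have hm : (0 : ℝ) ≤ volume.real (A s) := measureReal_nonneg
  calc (volume.real (A s))⁻¹ * ∫ y in A s, |g y - c|
      ≤ (volume.real (A s))⁻¹ * ((∫ y in A s, |f y - c|) + volume.real (A s) * (ε / 2)) := by
        gcongr
    _ = (volume.real (A s))⁻¹ * (∫ y in A s, |f y - c|) +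
        (volume.real (A s))⁻¹ * volume.real (A s) * (ε / 2) := by ring
    _ ≤ (volume.real (A s))⁻¹ * (∫ y in A s, |f y - c|) + 1 * (ε / 2) := by
        gcongr
        exact inv_mul_le_one
    _ < ε := by linarith

variable {f g : EuclideanSpace ℝ (Fin n) → ℝ} {x : EuclideanSpace ℝ (Fin n)} {r₀ : ℝ}

theorem CloseAt.lebAt (h : CloseAt f g x)
    (hr₀ : 0 < r₀) (hf : IntegrableOn f (ball x r₀)) (hg : IntegrableOn g (ball x r₀)) {c : ℝ}
    (ht : LebAt f x c) : LebAt g x c :=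
  h.tendsto_setAverage hr₀ hf hg (fun _ => le_rfl) (fun _ => measurableSet_ball) ht

theorem CloseAt.mem_approxDiscontSet_iff (h : CloseAt f g x)
    (hr₀ : 0 < r₀) (hf : IntegrableOn f (ball x r₀)) (hg : IntegrableOn g (ball x r₀)) :
    x ∈ approxDiscontSet n f ↔ x ∈ approxDiscontSet n g := by
  rw [← not_iff_not, notMem_approxDiscontSet_iff, notMem_approxDiscontSet_iff]
  exact ⟨fun ⟨c, hc⟩ => ⟨c, h.lebAt hr₀ hf hg hc⟩, fun ⟨c, hc⟩ => ⟨c, h.symm.lebAt hr₀ hg hf hc⟩⟩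

theorem CloseAt.mem_jumpSet (h : CloseAt f g x)
    (hr₀ : 0 < r₀) (hf : IntegrableOn f (ball x r₀)) (hg : IntegrableOn g (ball x r₀))
    (hx : x ∈ jumpSet n f) : x ∈ jumpSet n g := by
  obtain ⟨ν, hν, a, b, hab, ha, hb⟩ := hx
  have hm : Measurable fun y : 𝔼 => ⟪y - x, ν⟫ := by fun_prop
  exact ⟨ν, hν, a, b, hab,
    h.tendsto_setAverage hr₀ hf hg (fun _ => Set.sep_subset _ _)
      (fun _ => measurableSet_ball.inter (measurableSet_lt measurable_const hm)) ha,
    h.tendsto_setAverage hr₀ hf hg (fun _ => Set.sep_subset _ _)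
      (fun _ => measurableSet_ball.inter (measurableSet_lt hm measurable_const)) hb⟩

theorem setAverage_le_mul_setAverage {A B : Set 𝔼} {g : 𝔼 → ℝ} {K : ℝ} (hAB : A ⊆ B)
    (hg : ∀ x, 0 ≤ g x) (hi : IntegrableOn g B) (hA : 0 < volume.real A)
    (hB : 0 < volume.real B) (hK : volume.real B ≤ K * volume.real A) :
    ⨍ x in A, g x ≤ K * ⨍ x in B, g x := by
  rw [setAverage_eq, setAverage_eq, smul_eq_mul, smul_eq_mul, inv_mul_le_iff₀ hA]
  have h1 : ∫ x in A, g x ≤ ∫ x in B, g x :=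
    setIntegral_mono_set hi (Eventually.of_forall hg) (Eventually.of_forall hAB)
  have h2 : 0 ≤ ∫ x in B, g x := integral_nonneg hg
  have h3 : 1 ≤ volume.real A * (K * (volume.real B)⁻¹) := by
    rw [← mul_assoc, ← div_eq_mul_inv, le_div_iff₀ hB]
    linarith
  nlinarith

theorem measureReal_ball_pos (x : 𝔼) {r : ℝ} (hr : 0 < r) : 0 < volume.real (ball x r) :=
  ENNReal.toReal_pos (measure_ball_pos _ _ hr).ne' measure_ball_lt_top.ne

theorem measureReal_ball_eq (x : 𝔼) {r : ℝ} (hr : 0 < r) :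
    volume.real (ball x r) = r ^ n * volume.real (ball (0 : 𝔼) 1) := by
  rw [Measure.real, Measure.addHaar_ball_of_pos _ _ hr, ENNReal.toReal_mul,
    ENNReal.toReal_ofReal (by positivity), finrank_euclideanSpace_fin, Measure.real]

theorem measureReal_ball_le_two_pow_mul (x : 𝔼) {r s : ℝ} (hr : 0 < r) (hs : 0 < s)
    (h : s ≤ 2 * r) :
    volume.real (ball x s) ≤ 2 ^ n * volume.real (ball x r) := by
  rw [measureReal_ball_eq x hr, measureReal_ball_eq x hs, ← mul_assoc, ← mul_pow]
  gcongr

theorem tendsto_half_pow_nhdsGT :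
    Tendsto (fun i : ℕ => ((1 / 2 : ℝ)) ^ i) atTop (𝓝[>] 0) :=
  tendsto_nhdsWithin_iff.2 ⟨tendsto_pow_atTop_nhds_zero_of_lt_one (by norm_num) (by norm_num),
    Eventually.of_forall fun i => by simp⟩

theorem lebAt_of_dyadic {u : 𝔼 → ℝ} (hu : Integrable u) {x : 𝔼} {c : ℝ}
    (h : Tendsto (fun i : ℕ => ⨍ y in ball x ((1 / 2 : ℝ) ^ i), |u y - c|) atTop (𝓝 0)) :
    LebAt u x c := by
  rw [LebAt, Metric.tendsto_nhds]
  intro ε hε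
  rw [Metric.tendsto_atTop] at h
  obtain ⟨N, hN⟩ := h (ε / 2 ^ n) (by positivity)
  filter_upwards [Ioo_mem_nhdsGT (show (0 : ℝ) < (1 / 2) ^ N by positivity)] with r hr
  obtain ⟨i, hi, hi'⟩ := exists_nat_pow_near_of_lt_one hr.1
    (hr.2.le.trans (pow_le_one₀ (by norm_num) (by norm_num))) (y := (1 / 2 : ℝ)) (by norm_num)
    (by norm_num)
  have hNi : N ≤ i := by
    by_contra! hlt
    have := pow_le_pow_of_le_one (a := (1 / 2 : ℝ)) (by norm_num) (by norm_num)
      (Nat.succ_le_of_lt hlt)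
    exact absurd hr.2 (not_lt.2 (this.trans hi.le))
  have h1 := hN i hNi
  rw [Real.dist_0_eq_abs, abs_of_nonneg (setAverage_nonneg fun _ => abs_nonneg _)] at h1 ⊢
  have hp : (0 : ℝ) < (1 / 2) ^ i := by positivity
  refine (setAverage_le_mul_setAverage (ball_subset_ball hi') (fun _ => abs_nonneg _)
    (IntegrableOn.abs_sub_const hu.integrableOn le_rfl measure_ball_lt_top.ne c)
    (measureReal_ball_pos x hr.1) (measureReal_ball_pos x hp)
    (measureReal_ball_le_two_pow_mul x hr.1 hp ?_)).trans_lt ?_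
  · rw [pow_succ] at hi
    linarith
  · rw [lt_div_iff₀ (by positivity)] at h1
    linarith

theorem LebAt.tendsto_average {u : 𝔼 → ℝ} (hu : Integrable u) {x : 𝔼} {c : ℝ}
    (h : LebAt u x c) :
    Tendsto (fun r : ℝ => ⨍ y in ball x r, u y) (𝓝[>] 0) (𝓝 c) := by
  rw [tendsto_iff_dist_tendsto_zero]
  refine squeeze_zero' (Eventually.of_forall fun _ => dist_nonneg) ?_ h
  filter_upwards [self_mem_nhdsWithin] with r hr
  have hp := measureReal_ball_pos x hr
  have h1 : ∫ y in ball x r, (u y - c) = (∫ y in ball x r, u y) - volume.real (ball x r) * c := by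
    rw [integral_sub hu.integrableOn (integrableOn_const measure_ball_lt_top.ne), setIntegral_const,
      smul_eq_mul]
  have h2 : (⨍ y in ball x r, u y) - c = ⨍ y in ball x r, (u y - c) := by
    rw [setAverage_eq, setAverage_eq, h1, smul_eq_mul, smul_eq_mul, mul_sub,
      inv_mul_cancel_left₀ hp.ne']
  rw [Real.dist_eq, h2, setAverage_eq, setAverage_eq, smul_eq_mul, smul_eq_mul, abs_mul,
    abs_of_nonneg (inv_nonneg.2 hp.le)]
  gcongr
  exact abs_integral_le_integral_abs

theorem LebAt.congr_ae {u v : 𝔼 → ℝ} (huv : u =ᵐ[volume] v) {x : 𝔼} {c : ℝ} (h : LebAt u x c) :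
    LebAt v x c := by
  refine h.congr fun r => ?_
  rw [setAverage_eq, setAverage_eq]
  congr 1
  exact integral_congr_ae (ae_restrict_of_ae (huv.mono fun y hy => by simp only [hy]))

theorem measurable_setAverage_ball {h : 𝔼 → 𝔼 → ℝ} (hm : Measurable (Function.uncurry h))
    (r : ℝ) : Measurable fun x => ⨍ y in ball x r, h x y := by
  have h1 : ∀ x, ⨍ y in ball x r, h x y = (volume.real (ball (0 : 𝔼) r))⁻¹ *
      ∫ y, (ball x r).indicator (h x) y := fun x => by
    rw [setAverage_eq, smul_eq_mul, Measure.addHaar_real_ball_center, integral_indicator measurableSet_ball]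
  simp_rw [h1]
  have h2 : StronglyMeasurable (Function.uncurry fun x y => (ball x r).indicator (h x) y) := by
    have hs : MeasurableSet {p : 𝔼 × 𝔼 | dist p.2 p.1 < r} :=
      measurableSet_lt (by fun_prop) measurable_const
    exact (hm.indicator hs).stronglyMeasurable
  exact h2.integral_prod_right.measurable.const_mul _

theorem measurableSet_approxDiscontSet_of_integrable {u : 𝔼 → ℝ} (hu : Integrable u) :
    MeasurableSet (approxDiscontSet n u) := by
  set v := hu.1.mk u
  have huv : u =ᵐ[volume] v := hu.1.ae_eq_mk
  have hv : Integrable v := hu.congr huv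
  have hvm : Measurable v := hu.1.stronglyMeasurable_mk.measurable
  let L : 𝔼 → ℝ := fun x => limsup (fun i : ℕ => ⨍ y in ball x ((1 / 2 : ℝ) ^ i), v y) atTop
  have hL : Measurable L := Measurable.limsup fun i =>
    measurable_setAverage_ball (h := fun _ y => v y) (hvm.comp measurable_snd) _
  have hset : (approxDiscontSet n u)ᶜ = {x | Tendsto (fun i : ℕ =>
      ⨍ y in ball x ((1 / 2 : ℝ) ^ i), |v y - L x|) atTop (𝓝 0)} := by
    ext x
    rw [Set.mem_compl_iff, notMem_approxDiscontSet_iff]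
    constructor
    · rintro ⟨c, hc⟩
      have hc' := hc.congr_ae huv
      have hLx : L x = c := ((hc'.tendsto_average hv).comp tendsto_half_pow_nhdsGT).limsup_eq
      change Tendsto _ _ _
      rw [hLx]
      exact hc'.comp tendsto_half_pow_nhdsGT
    · exact fun h => ⟨L x, (lebAt_of_dyadic hv h).congr_ae huv.symm⟩
  rw [← MeasurableSet.compl_iff, hset]
  refine measurableSet_tendsto _ fun i => measurable_setAverage_ball ?_ _
  exact ((hvm.comp measurable_snd).sub (hL.comp measurable_fst)).abs

theorem ae_lebAt {u : 𝔼 → ℝ} (hu : Integrable u) : ∀ᵐ x, LebAt u x (u x) := by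
  filter_upwards [IsUnifLocDoublingMeasure.ae_tendsto_average_norm_sub volume
    hu.locallyIntegrable 1] with x hx
  have h := hx (l := 𝓝[>] (0 : ℝ)) (fun _ => x) id tendsto_id (by
    filter_upwards [self_mem_nhdsWithin] with r hr
    simpa using (le_of_lt hr : (0 : ℝ) ≤ r))
  refine h.congr' ?_
  filter_upwards [self_mem_nhdsWithin] with r hr
  have : closedBall x r =ᵐ[volume] ball x r := by
    refine (ae_eq_of_subset_of_measure_ge ball_subset_closedBall ?_
      measurableSet_ball.nullMeasurableSet measure_closedBall_lt_top.ne).symm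
    rw [← ball_union_sphere]
    refine (measure_union_le _ _).trans ?_
    rw [Measure.addHaar_sphere_of_ne_zero _ _ (ne_of_gt hr), add_zero]
  rw [id, setAverage_congr this]
  rfl

theorem LocallyIntegrableOn.exists_ball_integrableOn {F : 𝔼 → ℝ} {Ω : Set 𝔼} (hΩ : IsOpen Ω)
    (hF : LocallyIntegrableOn F Ω) {x : 𝔼} (hx : x ∈ Ω) :
    ∃ r > 0, ball x r ⊆ Ω ∧ IntegrableOn F (ball x r) := by
  have h := hF x hx
  rw [hΩ.nhdsWithin_eq hx] at h
  obtain ⟨s, hs, hi⟩ := h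
  obtain ⟨r, hr, hrs⟩ := Metric.mem_nhds_iff.1 (inter_mem hs (hΩ.mem_nhds hx))
  exact ⟨r, hr, hrs.trans Set.inter_subset_right, hi.mono_set (hrs.trans Set.inter_subset_left)⟩

theorem mem_approxDiscontSet_indicator_iff {F : 𝔼 → ℝ} {V : Set 𝔼} (hV : IsOpen V)
    (hF : IntegrableOn F V) {x : 𝔼} (hx : x ∈ V) :
    x ∈ approxDiscontSet n F ↔ x ∈ approxDiscontSet n (V.indicator F) := by
  obtain ⟨r, hr, hrV⟩ := Metric.isOpen_iff.1 hV x hx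
  have hc : CloseAt F (V.indicator F) x := fun η hη => ⟨r, hr, fun y hy => by
    rw [Set.indicator_of_mem (hrV hy), sub_self, abs_zero]
    exact hη.le⟩
  exact hc.mem_approxDiscontSet_iff hr (hF.mono_set hrV)
    ((hF.integrable_indicator hV.measurableSet).integrableOn)

theorem measurableSet_inter_approxDiscontSet {F : 𝔼 → ℝ} {Ω : Set 𝔼} (hΩ : IsOpen Ω)
    (hF : LocallyIntegrableOn F Ω) : MeasurableSet (Ω ∩ approxDiscontSet n F) := by
  obtain ⟨u, hu, hΩu, hi⟩ := hF.exists_nat_integrableOn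
  have : Ω ∩ approxDiscontSet n F =
      ⋃ i, (u i ∩ Ω) ∩ approxDiscontSet n ((u i ∩ Ω).indicator F) := by
    ext x
    simp only [Set.mem_inter_iff, Set.mem_iUnion]
    constructor
    · rintro ⟨hx, hxS⟩
      obtain ⟨i, hxi⟩ := Set.mem_iUnion.1 (hΩu hx)
      exact ⟨i, ⟨hxi, hx⟩, (mem_approxDiscontSet_indicator_iff ((hu i).inter hΩ) (hi i)
        ⟨hxi, hx⟩).1 hxS⟩
    · rintro ⟨i, hx, hxS⟩
      exact ⟨hx.2, (mem_approxDiscontSet_indicator_iff ((hu i).inter hΩ) (hi i) hx).2 hxS⟩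
  rw [this]
  exact .iUnion fun i => ((hu i).inter hΩ).measurableSet.inter
    (measurableSet_approxDiscontSet_of_integrable
      ((hi i).integrable_indicator ((hu i).inter hΩ).measurableSet))

end LebesguePoints

section Mollifier

/-- A smooth bump supported in the ball of radius `2⁻ʲ`. -/
def stdBump (n j : ℕ) : ContDiffBump (0 : EuclideanSpace ℝ (Fin n)) :=
  ⟨(1 / 2) ^ (j + 1), (1 / 2) ^ j, by positivity,
    pow_lt_pow_right_of_lt_one₀ (by norm_num) (by norm_num) (Nat.lt_succ_self j)⟩

/-- The standard mollifiers. -/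
def mol (j : ℕ) : 𝔼 → ℝ := (stdBump n j).normed volume

theorem mol_nonneg (j : ℕ) (x : 𝔼) : 0 ≤ mol j x := (stdBump n j).nonneg_normed x

theorem mol_contDiff (j : ℕ) : ContDiff ℝ 1 (mol j : 𝔼 → ℝ) := (stdBump n j).contDiff_normed

theorem mol_continuous (j : ℕ) : Continuous (mol j : 𝔼 → ℝ) := (stdBump n j).continuous_normed

theorem mol_hasCompactSupport (j : ℕ) : HasCompactSupport (mol j : 𝔼 → ℝ) :=
  (stdBump n j).hasCompactSupport_normed

theorem mol_sub_comm (j : ℕ) (x y : 𝔼) : mol j (x - y) = mol j (y - x) := by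
  rw [← neg_sub, mol, ContDiffBump.normed_neg]

theorem integral_mol (j : ℕ) : ∫ x : 𝔼, mol j x = 1 := (stdBump n j).integral_normed

theorem integrable_mol (j : ℕ) : Integrable (mol j : 𝔼 → ℝ) := (stdBump n j).integrable_normed

theorem mol_eq_zero {j : ℕ} {x : 𝔼} (h : (1 / 2) ^ j ≤ ‖x‖) : mol j x = 0 := by
  by_contra h0
  have : x ∈ Function.support (mol j : 𝔼 → ℝ) := h0
  rw [mol, ContDiffBump.support_normed_eq] at this
  exact absurd (mem_ball_zero_iff.1 this) (not_lt.2 h)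

theorem mol_sub_eq_zero {j : ℕ} {x y : 𝔼} (h : y ∉ ball x ((1 / 2) ^ j)) : mol j (x - y) = 0 := by
  refine mol_eq_zero ?_
  rw [mem_ball, not_lt, dist_comm, dist_eq_norm] at h
  exact h

theorem mol_le (j : ℕ) (x : 𝔼) :
    mol j x ≤ 2 ^ n / volume.real (ball (0 : 𝔼) ((1 / 2) ^ j)) := by
  have := (stdBump n j).normed_le_div_measure_closedBall_rOut volume 2 (by
    simp only [stdBump, pow_succ]
    linarith) x
  rw [finrank_euclideanSpace_fin] at this
  refine this.trans (div_le_div_of_nonneg_left (by positivity)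
    (measureReal_ball_pos _ (by positivity)) ?_)
  exact measureReal_mono ball_subset_closedBall measure_closedBall_lt_top.ne

theorem mol_exists_bound (j : ℕ) : ∃ C, 0 ≤ C ∧ ∀ x : 𝔼, |mol j x| ≤ C :=
  ⟨_, div_nonneg (pow_nonneg zero_le_two n) measureReal_nonneg, fun x => by
    rw [abs_of_nonneg (mol_nonneg j x)]
    exact mol_le j x⟩

variable {E : Type*} [NormedAddCommGroup E] [NormedSpace ℝ E]
  {m : Measure (EuclideanSpace ℝ (Fin n))}
  {g : EuclideanSpace ℝ (Fin n) → E}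

/-- The mollification of the measure `g m`. -/
def molM (m : Measure 𝔼) (g : 𝔼 → E) (j : ℕ) (x : 𝔼) : E := ∫ y, mol j (x - y) • g y ∂m

theorem integrable_mol_smul (hg : Integrable g m) (j : ℕ) (x : 𝔼) :
    Integrable (fun y => mol j (x - y) • g y) m := by
  obtain ⟨C, -, hC⟩ := mol_exists_bound (n := n) j
  exact hg.bdd_smul C ((mol_continuous j).comp (continuous_const.sub continuous_id)).aestronglyMeasurable
    (Eventually.of_forall fun y => hC _)

theorem molM_continuous (hg : Integrable g m) (j : ℕ) : Continuous (molM m g j) := by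
  obtain ⟨C, -, hC⟩ := mol_exists_bound (n := n) j
  refine continuous_of_dominated (bound := fun y => C * ‖g y‖)
    (fun x => (integrable_mol_smul hg j x).1) (fun x => Eventually.of_forall fun y => ?_)
    (hg.norm.const_mul C) (Eventually.of_forall fun y => ?_)
  · rw [norm_smul]
    exact mul_le_mul_of_nonneg_right (hC _) (norm_nonneg _)
  · exact ((mol_continuous j).comp (continuous_id.sub continuous_const)).smul continuous_const

theorem molM_apply {g : 𝔼 → 𝔼} (hg : Integrable g m) (j : ℕ) (x : 𝔼) (k : Fin n) :
    molM m g j x k = molM m (fun y => g y k) j x := by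
  have := (EuclideanSpace.proj k : 𝔼 →L[ℝ] ℝ).integral_comp_comm (integrable_mol_smul hg j x)
  exact this.symm

theorem molM_eq_zero {j : ℕ} {x : 𝔼} (h : ∀ y ∈ ball x ((1 / 2) ^ j), g y = 0) :
    molM m g j x = 0 := by
  refine integral_eq_zero_of_ae (Eventually.of_forall fun y => ?_)
  by_cases hy : y ∈ ball x ((1 / 2) ^ j)
  · simp [h y hy]
  · simp [mol_sub_eq_zero hy]

theorem molM_sub {g g' : 𝔼 → E} (hg : Integrable g m) (hg' : Integrable g' m) (j : ℕ) (x : 𝔼) :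
    molM m (fun y => g y - g' y) j x = molM m g j x - molM m g' j x := by
  rw [molM, molM, molM, ← integral_sub (integrable_mol_smul hg j x) (integrable_mol_smul hg' j x)]
  simp only [smul_sub]

theorem integral_mol_sub (j : ℕ) (y : 𝔼) : ∫ x : 𝔼, mol j (x - y) = 1 := by
  rw [integral_sub_right_eq_self (fun x => mol j x) y, integral_mol]

theorem integral_mol_sub' (j : ℕ) (x : 𝔼) : ∫ y : 𝔼, mol j (x - y) = 1 := by
  simp_rw [mol_sub_comm j x]
  exact integral_mol_sub j x

theorem integrable_mol_sub (j : ℕ) (y : 𝔼) : Integrable fun x : 𝔼 => mol j (x - y) :=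
  (integrable_mol j).comp_sub_right y

theorem integrable_prod_mol [SFinite m] (hg : Integrable g m) (j : ℕ) :
    Integrable (fun p : 𝔼 × 𝔼 => mol j (p.1 - p.2) • g p.2) (volume.prod m) := by
  have hm : AEStronglyMeasurable (fun p : 𝔼 × 𝔼 => mol j (p.1 - p.2) • g p.2)
      (volume.prod m) :=
    ((mol_continuous j).comp (continuous_fst.sub continuous_snd)).aestronglyMeasurable.smul
      hg.1.comp_snd
  rw [integrable_prod_iff' hm]
  refine ⟨Eventually.of_forall fun y => (integrable_mol_sub j y).smul_const (g y), ?_⟩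
  refine hg.norm.congr (Eventually.of_forall fun y => ?_)
  simp only [norm_smul, Real.norm_of_nonneg (mol_nonneg _ _)]
  rw [integral_mul_const, integral_mol_sub, one_mul]

theorem integrable_molM [SFinite m] (hg : Integrable g m) (j : ℕ) : Integrable (molM m g j) :=
  (integrable_prod_mol hg j).integral_prod_left

theorem integral_norm_molM_le [SFinite m] (hg : Integrable g m) (j : ℕ) :
    ∫ x, ‖molM m g j x‖ ≤ ∫ y, ‖g y‖ ∂m := by
  have hi := integrable_prod_mol hg j
  calc ∫ x, ‖molM m g j x‖ ≤ ∫ x, ∫ y, ‖mol j (x - y) • g y‖ ∂m :=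
        integral_mono (integrable_molM hg j).norm hi.norm.integral_prod_left
          fun x => norm_integral_le_integral_norm _
    _ = ∫ y, ∫ x, ‖mol j (x - y) • g y‖ ∂volume ∂m := integral_integral_swap hi.norm
    _ = ∫ y, ‖g y‖ ∂m := by
        congr 1
        funext y
        simp only [norm_smul, Real.norm_of_nonneg (mol_nonneg _ _)]
        rw [integral_mul_const, integral_mol_sub, one_mul]

theorem integral_mul_molM [SFinite m] {g ψ : 𝔼 → ℝ} (hg : Integrable g m) (hψ : Continuous ψ)
    {C : ℝ} (hC : ∀ x, |ψ x| ≤ C) (j : ℕ) :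
    ∫ x, ψ x * molM m g j x = ∫ y, molM volume ψ j y * g y ∂m := by
  have hi : Integrable (fun p : 𝔼 × 𝔼 => ψ p.1 * (mol j (p.1 - p.2) * g p.2)) (volume.prod m) :=
    (integrable_prod_mol hg j).bdd_mul (hψ.comp continuous_fst).aestronglyMeasurable
      (Eventually.of_forall fun p => hC _)
  calc ∫ x, ψ x * molM m g j x = ∫ x, ∫ y, ψ x * (mol j (x - y) * g y) ∂m := by
        simp only [molM, smul_eq_mul, integral_const_mul]
    _ = ∫ y, ∫ x, ψ x * (mol j (x - y) * g y) ∂volume ∂m := integral_integral_swap hi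
    _ = _ := by
        congr 1
        funext y
        rw [molM, ← integral_mul_const]
        congr 1
        funext x
        rw [mol_sub_comm, smul_eq_mul]
        ring

theorem abs_molM_le {ψ θ : 𝔼 → ℝ} (hθ : Continuous θ) (h : ∀ x, |ψ x| ≤ θ x)
    (j : ℕ) (x : 𝔼) : |molM volume ψ j x| ≤ molM volume θ j x := by
  rw [molM, ← Real.norm_eq_abs]
  refine norm_integral_le_of_norm_le ?_ (Eventually.of_forall fun y => ?_)
  · refine Continuous.integrable_of_hasCompactSupport
      (((mol_continuous j).comp (continuous_const.sub continuous_id)).smul hθ) ?_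
    refine HasCompactSupport.intro (isCompact_closedBall x ((1 / 2) ^ j)) fun y hy => ?_
    simp [mol_sub_eq_zero fun h => hy (ball_subset_closedBall h)]
  · rw [smul_eq_mul, norm_mul, Real.norm_of_nonneg (mol_nonneg _ _)]
    exact mul_le_mul_of_nonneg_left (h y) (mol_nonneg _ _)

/-- A mollification is close to `c` at `y` if the function is close to `c` near `y`. -/
theorem norm_molM_sub_le [CompleteSpace E] {h : 𝔼 → E} (hi : LocallyIntegrable h) {j : ℕ} {y : 𝔼} {c : E} {ε : ℝ}
    (hh : ∀ x ∈ ball y ((1 / 2) ^ j), ‖h x - c‖ ≤ ε) : ‖molM volume h j y - c‖ ≤ ε := by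
  have hi' : Integrable fun x => mol j (y - x) • h x := by
    refine hi.integrable_smul_left_of_hasCompactSupport
      ((mol_continuous j).comp (continuous_const.sub continuous_id)) ?_
    refine HasCompactSupport.intro (isCompact_closedBall y ((1 / 2) ^ j)) fun z hz => ?_
    exact mol_sub_eq_zero fun h => hz (ball_subset_closedBall h)
  have h1 : Integrable fun x => mol j (y - x) := by
    simp_rw [mol_sub_comm j y]
    exact integrable_mol_sub j y
  have : molM volume h j y - c = ∫ x, mol j (y - x) • (h x - c) := by
    simp_rw [smul_sub]
    rw [integral_sub hi' (h1.smul_const c), integral_smul_const, integral_mol_sub', one_smul, molM]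
  rw [this]
  have h2 : ∫ x, mol j (y - x) * ε = ε := by
    rw [integral_mul_const, integral_mol_sub', one_mul]
  rw [← h2]
  refine norm_integral_le_of_norm_le (h1.mul_const ε) (Eventually.of_forall fun x => ?_)
  rw [norm_smul, Real.norm_of_nonneg (mol_nonneg _ _)]
  by_cases hx : x ∈ ball y ((1 / 2) ^ j)
  · exact mul_le_mul_of_nonneg_left (hh x hx) (mol_nonneg _ _)
  · simp [mol_sub_eq_zero hx]

end Mollifier

section MollifierLimits

theorem molM_volume_eq_convolution {u : 𝔼 → ℝ} (j : ℕ) :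
    molM volume u j = convolution u (mol j) (ContinuousLinearMap.lsmul ℝ ℝ) volume := by
  funext x
  rw [convolution_def, molM]
  congr 1
  funext y
  rw [ContinuousLinearMap.lsmul_apply, smul_eq_mul, smul_eq_mul, mul_comm]

theorem molM_contDiff {u : 𝔼 → ℝ} (hu : Integrable u) (j : ℕ) :
    ContDiff ℝ 1 (molM volume u j) := by
  rw [molM_volume_eq_convolution]
  exact (mol_hasCompactSupport j).contDiff_convolution_right _ hu.locallyIntegrable
    (mol_contDiff j)

theorem partialD_molM {u : 𝔼 → ℝ} (hu : Integrable u) (j : ℕ) (k : Fin n) (x : 𝔼) :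
    partialD k (molM volume u j) x = ∫ y, u y * partialD k (mol j) (x - y) := by
  have h := (mol_hasCompactSupport j).hasFDerivAt_convolution_right
    (ContinuousLinearMap.lsmul ℝ ℝ) hu.locallyIntegrable (mol_contDiff j) x
  rw [← molM_volume_eq_convolution] at h
  rw [partialD, h.fderiv, convolution_precompR_apply _ hu.locallyIntegrable
    ((mol_hasCompactSupport j).fderiv (𝕜 := ℝ)) ((mol_contDiff j).continuous_fderiv (by norm_num))]
  rfl

theorem isTest_mol_sub {V : Set 𝔼} {x : 𝔼} {j : ℕ} (h : closedBall x ((1 / 2) ^ j) ⊆ V) :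
    IsTest V fun y => mol j (x - y) := by
  have hs : tsupport (fun y => mol j (x - y)) ⊆ closedBall x ((1 / 2) ^ j) := by
    refine closure_minimal (fun y hy => ?_) isClosed_closedBall
    by_contra h
    exact hy (mol_sub_eq_zero fun h' => h (ball_subset_closedBall h'))
  exact ⟨(mol_contDiff j).comp (contDiff_const.sub contDiff_id),
    (isCompact_closedBall _ _).of_isClosed_subset (isClosed_tsupport _) hs, hs.trans h⟩

theorem partialD_mol_sub (j : ℕ) (k : Fin n) (x y : 𝔼) :
    partialD k (fun y => mol j (x - y)) y = -partialD k (mol j) (x - y) := by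
  have h1 : HasFDerivAt (fun y : 𝔼 => x - y) (-ContinuousLinearMap.id ℝ 𝔼) y :=
    (hasFDerivAt_id y).const_sub x
  have h2 := (((mol_contDiff j).differentiable (by norm_num)) (x - y)).hasFDerivAt.comp y h1
  have h3 : fderiv ℝ (fun y => mol j (x - y)) y =
      (fderiv ℝ (mol j) (x - y)).comp (-ContinuousLinearMap.id ℝ 𝔼) := h2.fderiv
  rw [partialD, h3]
  simp [partialD]

theorem HasGradient.partialD_molM {u : 𝔼 → ℝ} {V : Set 𝔼} {μ₀ : Measure 𝔼} {a b : 𝔼 → 𝔼}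
    (h : HasGradient u V μ₀ a b) (hu : Integrable u) {j : ℕ} {x : 𝔼}
    (hx : closedBall x ((1 / 2) ^ j) ⊆ V) (k : Fin n) :
    partialD k (molM volume u j) x = (molM volume a j x + molM μ₀ b j x) k := by
  have h1 := h.integral_eq _ (isTest_mol_sub hx) k
  simp_rw [partialD_mol_sub, mul_neg, integral_neg, neg_inj] at h1
  rw [_root_.partialD_molM hu, h1, PiLp.add_apply, molM_apply h.integrable_ac,
    molM_apply h.integrable_sing]
  rfl

theorem LebAt.eventually_molM {u : 𝔼 → ℝ} (hu : Integrable u) {y : 𝔼} {c : ℝ} (h : LebAt u y c)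
    {ε : ℝ} (hε : 0 < ε) :
    ∀ᶠ j : ℕ in atTop, ∀ x ∈ ball y ((1 / 2) ^ j), |molM volume u j x - c| ≤ ε := by
  have h2 : Tendsto (fun i : ℕ => (2 : ℝ) * (1 / 2) ^ i) atTop (𝓝[>] 0) :=
    tendsto_nhdsWithin_iff.2 ⟨by
      simpa using (tendsto_pow_atTop_nhds_zero_of_lt_one (r := (1 / 2 : ℝ)) (by norm_num)
        (by norm_num)).const_mul 2, Eventually.of_forall fun i => by simp⟩
  have h3 := (Metric.tendsto_nhds.1 (h.comp h2)) (ε / 4 ^ n) (by positivity)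
  filter_upwards [h3] with j hj x hx
  have hr : (0 : ℝ) < (1 / 2) ^ j := by positivity
  set r : ℝ := (1 / 2) ^ j
  have hsub : ball x r ⊆ ball y (2 * r) := by
    refine ball_subset_ball' ?_
    rw [mem_ball] at hx
    linarith
  have hB : IntegrableOn (fun z => |u z - c|) (ball y (2 * r)) :=
    (hu.integrableOn.sub (integrableOn_const measure_ball_lt_top.ne)).abs
  have hA := hB.mono_set hsub
  have e1 : molM volume u j x - c = ∫ z, mol j (x - z) • (u z - c) := by
    have h1 : Integrable fun z => mol j (x - z) := by
      simp_rw [mol_sub_comm j x]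
      exact integrable_mol_sub j x
    simp_rw [smul_sub]
    rw [integral_sub (integrable_mol_smul hu j x) (h1.smul_const c), integral_smul_const,
      integral_mol_sub', one_smul, molM]
  have hv : volume.real (ball (0 : 𝔼) r) = volume.real (ball x r) := by
    rw [measureReal_ball_eq _ hr, measureReal_ball_eq _ hr]
  have e2 : |molM volume u j x - c| ≤ 2 ^ n * ⨍ z in ball x r, |u z - c| := by
    have e3 : ∫ z, (ball x r).indicator (fun z => 2 ^ n / volume.real (ball (0 : 𝔼) r) * |u z - c|) z
        = 2 ^ n * ⨍ z in ball x r, |u z - c| := by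
      rw [integral_indicator measurableSet_ball, integral_const_mul, setAverage_eq, smul_eq_mul, hv]
      ring
    rw [e1, ← e3, ← Real.norm_eq_abs]
    refine norm_integral_le_of_norm_le ((integrable_indicator_iff measurableSet_ball).2 (hA.const_mul _))
      (Eventually.of_forall fun z => ?_)
    by_cases hz : z ∈ ball x r
    · rw [Set.indicator_of_mem hz, norm_smul, Real.norm_of_nonneg (mol_nonneg _ _)]
      exact mul_le_mul_of_nonneg_right (mol_le j _) (abs_nonneg _)
    · simp [mol_sub_eq_zero hz, hz]
  have e4 : ⨍ z in ball x r, |u z - c| ≤ 2 ^ n * ⨍ z in ball y (2 * r), |u z - c| :=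
    setAverage_le_mul_setAverage hsub (fun _ => abs_nonneg _) hB (measureReal_ball_pos x hr)
      (measureReal_ball_pos y (by positivity)) (by
        rw [measureReal_ball_eq x hr, ← measureReal_ball_eq y hr]
        exact measureReal_ball_le_two_pow_mul y hr (by positivity) le_rfl)
  simp only [Function.comp_apply] at hj
  rw [Real.dist_eq, sub_zero, abs_of_nonneg (setAverage_nonneg fun _ => abs_nonneg _),
    lt_div_iff₀ (by positivity)] at hj
  calc _ ≤ 2 ^ n * (2 ^ n * ⨍ z in ball y (2 * r), |u z - c|) :=
        e2.trans (mul_le_mul_of_nonneg_left e4 (by positivity))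
    _ = (⨍ z in ball y (2 * r), |u z - c|) * 4 ^ n := by
        rw [show (4 : ℝ) = 2 * 2 by norm_num, mul_pow]
        ring
    _ ≤ ε := hj.le

theorem LebAt.tendsto_molM {u : 𝔼 → ℝ} (hu : Integrable u) {y : 𝔼} {c : ℝ} (h : LebAt u y c) :
    Tendsto (fun j => molM volume u j y) atTop (𝓝 c) := by
  rw [Metric.tendsto_nhds]
  intro ε hε
  filter_upwards [h.eventually_molM hu (half_pos hε)] with j hj
  rw [Real.dist_eq]
  have := hj y (mem_ball_self (by positivity))
  linarith

theorem ae_tendsto_molM {u : 𝔼 → ℝ} (hu : Integrable u) :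
    ∀ᵐ x, Tendsto (fun j => molM volume u j x) atTop (𝓝 (u x)) := by
  filter_upwards [ae_lebAt hu] with x hx using hx.tendsto_molM hu

/-- If the functions `h j` are locally uniformly close to `c` on shrinking balls then their
mollifications converge to `c`. -/
theorem tendsto_molM_of_eventually {h : ℕ → 𝔼 → ℝ} (hc : ∀ j, Continuous (h j)) {y : 𝔼} {c : ℝ}
    (hh : ∀ ε > 0, ∀ᶠ j : ℕ in atTop, ∀ x ∈ ball y ((1 / 2) ^ j), |h j x - c| ≤ ε) :
    Tendsto (fun j => molM volume (h j) j y) atTop (𝓝 c) := by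
  rw [Metric.tendsto_nhds]
  intro ε hε
  filter_upwards [hh _ (half_pos hε)] with j hj
  rw [dist_eq_norm]
  have := norm_molM_sub_le ((hc j).locallyIntegrable) (c := c) (ε := ε / 2) hj
  linarith

theorem Continuous.eventually_ball {E : Type*} [PseudoMetricSpace E] {g : 𝔼 → E}
    (hg : Continuous g) (y : 𝔼) {ε : ℝ} (hε : 0 < ε) :
    ∀ᶠ j : ℕ in atTop, ∀ x ∈ ball y ((1 / 2) ^ j), dist (g x) (g y) ≤ ε := by
  obtain ⟨r, hr, h⟩ := Metric.continuous_iff.1 hg y ε hε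
  have := (tendsto_pow_atTop_nhds_zero_of_lt_one (r := (1 / 2 : ℝ)) (by norm_num)
        (by norm_num)).eventually_lt_const hr
  filter_upwards [this] with j hj x hx
  exact (h x (lt_trans hx hj)).le

/-- Mollifications of integrable functions converge in `L¹`. -/
theorem tendsto_integral_norm_molM_sub {a : 𝔼 → 𝔼} (ha : Integrable a) :
    Tendsto (fun j => ∫ x, ‖molM volume a j x - a x‖) atTop (𝓝 0) := by
  rw [Metric.tendsto_nhds]
  intro ε hε
  obtain ⟨g, hgs, hg, hgc, hgi⟩ := ha.exists_hasCompactSupport_integral_sub_le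
    (show 0 < ε / 4 by positivity)
  have hcg : Tendsto (fun j => ∫ x, ‖molM volume g j x - g x‖) atTop (𝓝 0) := by
    obtain ⟨C, hC⟩ := hgs.exists_bound_of_continuous hgc
    set K := cthickening 1 (tsupport g)
    have hK : IsCompact K := hgs.isCompact.cthickening
    have hball : ∀ (j : ℕ) (x : 𝔼), x ∉ K → ∀ y ∈ ball x ((1 / 2) ^ j), g y = 0 :=
      fun j x hx y hy => by
        by_contra h0
        refine hx (mem_cthickening_of_dist_le x y 1 _ (subset_tsupport _ h0) ?_)
        rw [dist_comm]
        exact (mem_ball.1 hy).le.trans (pow_le_one₀ (by norm_num) (by norm_num))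
    have h0 : ∫ _ : 𝔼, (0 : ℝ) = 0 := by simp
    rw [← h0]
    refine tendsto_integral_of_dominated_convergence (K.indicator fun _ => 2 * C)
      (fun j => ((molM_continuous hgi j).sub hgc).norm.aestronglyMeasurable)
      ((integrable_indicator_iff hK.measurableSet).2 (integrableOn_const hK.measure_lt_top.ne))
      (fun j => Eventually.of_forall fun x => ?_) (Eventually.of_forall fun x => ?_)
    · by_cases hx : x ∈ K
      · rw [Set.indicator_of_mem hx, norm_norm]
        refine norm_molM_sub_le hgi.locallyIntegrable fun y _ => ?_
        have := norm_sub_le (g y) (g x)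
        linarith [hC x, hC y]
      · rw [molM_eq_zero (hball j x hx), hball j x hx x (mem_ball_self (by positivity))]
        simp [hx]
    · rw [Metric.tendsto_nhds]
      intro δ hδ
      filter_upwards [hgc.eventually_ball x (half_pos hδ)] with j hj
      rw [dist_zero_right, norm_norm]
      have := norm_molM_sub_le hgi.locallyIntegrable (c := g x) (ε := δ / 2) (j := j) (y := x)
        fun y hy => by rw [← dist_eq_norm]; exact hj y hy
      linarith
  filter_upwards [Metric.tendsto_nhds.1 hcg (ε / 4) (by positivity)] with j hj
  rw [Real.dist_eq, sub_zero, abs_of_nonneg (integral_nonneg fun _ => norm_nonneg _)] at hj ⊢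
  have i1 := integrable_molM (ha.sub hgi) j
  have i2 := (integrable_molM hgi j).sub hgi
  have i3 := ha.sub hgi
  have hle : ∫ x, ‖molM volume a j x - a x‖ ≤
      (∫ x, ‖molM volume (a - g) j x‖) + (∫ x, ‖molM volume g j x - g x‖) + ∫ x, ‖a x - g x‖ := by
    have := integral_add (i1.norm.add i2.norm) i3.norm
    have h' := integral_add i1.norm i2.norm
    simp only [Pi.add_apply, Pi.sub_apply] at this h'
    rw [← h', ← this]
    refine integral_mono ((integrable_molM ha j).sub ha).norm ((i1.norm.add i2.norm).add i3.norm)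
      fun x => ?_
    have e : molM volume (a - g) j x = molM volume a j x - molM volume g j x :=
      molM_sub ha hgi j x
    simp only
    rw [e]
    calc ‖molM volume a j x - a x‖ = ‖(molM volume a j x - molM volume g j x) +
          (molM volume g j x - g x) - (a x - g x)‖ := by congr 1; abel
      _ ≤ _ := (norm_sub_le _ _).trans (add_le_add_left (norm_add_le _ _) _)
  have := integral_norm_molM_le i3 j
  simp only [Pi.sub_apply] at this
  linarith

end MollifierLimits

section ChainRule

/-- The classical gradient. -/
def gradV (φ : 𝔼 → ℝ) (x : 𝔼) : 𝔼 := WithLp.toLp 2 fun k => partialD k φ x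

theorem gradV_apply (φ : 𝔼 → ℝ) (x : 𝔼) (k : Fin n) : gradV φ x k = partialD k φ x := rfl

theorem IsTest.integral_partialD_eq_zero {Ω : Set 𝔼} {θ : 𝔼 → ℝ} (h : IsTest Ω θ) (k : Fin n) :
    ∫ x, partialD k θ x = 0 := by
  have := integral_mul_fderiv_eq_neg_fderiv_mul_of_integrable (μ := (volume : Measure 𝔼))
    (f := fun _ : 𝔼 => (1 : ℝ)) (g := θ) (v := EuclideanSpace.single k 1)
    (by simp) (by
      simp only [one_mul]
      exact (h.partialD_continuous k).integrable_of_hasCompactSupport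
        (h.partialD_hasCompactSupport k))
    (by simpa using h.continuous.integrable_of_hasCompactSupport h.hasCompactSupport)
    (fun _ _ => differentiableAt_const _) (fun x _ => h.differentiable x)
  simp only [one_mul, fderiv_fun_const, Pi.zero_apply, zero_apply, zero_mul,
    integral_zero, neg_zero] at this
  exact this

theorem tendsto_integral_mul_comp_molM {u G g : 𝔼 → ℝ} {Ψ : ℝ → ℝ} (hu : Integrable u)
    (hG : Continuous G) (hΨ : Continuous Ψ) {C : ℝ} (hC : ∀ t, |Ψ t| ≤ C) {m : Measure 𝔼}
    (hm : m ≪ volume) (hg : Integrable g m) :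
    Tendsto (fun j => ∫ x, g x * Ψ (G x - molM volume u j x) ∂m) atTop
      (𝓝 (∫ x, g x * Ψ (G x - u x) ∂m)) := by
  refine tendsto_integral_of_dominated_convergence (fun x => ‖g x‖ * C)
    (fun j => hg.1.mul (hΨ.comp (hG.sub (molM_continuous hu j))).aestronglyMeasurable)
    (hg.norm.mul_const C) (fun j => Eventually.of_forall fun x => ?_) ?_
  · rw [norm_mul]
    exact mul_le_mul_of_nonneg_left (hC _) (norm_nonneg _)
  · filter_upwards [hm.ae_le (ae_tendsto_molM hu)] with x hx
    exact ((hΨ.tendsto _).comp (hx.const_sub _)).const_mul _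

theorem partialD_chain {φ η G v : 𝔼 → ℝ} {Φ Φ' : ℝ → ℝ} (hφ : Differentiable ℝ φ)
    (hη : Differentiable ℝ η) (hG : Differentiable ℝ G) (hv : Differentiable ℝ v)
    (hΦ : ∀ t, HasDerivAt Φ (Φ' t) t) (k : Fin n) (x : 𝔼) :
    partialD k (fun x => φ x * η x * Φ (G x - v x)) x =
      (η x * partialD k φ x) * Φ (G x - v x) + (φ x * partialD k η x) * Φ (G x - v x) +
        φ x * η x * Φ' (G x - v x) * (partialD k G x - partialD k v x) := by
  have h1 := ((hφ x).hasFDerivAt.mul (hη x).hasFDerivAt).mul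
    ((hΦ (G x - v x)).comp_hasFDerivAt x ((hG x).hasFDerivAt.sub (hv x).hasFDerivAt))
  have h2 := h1.fderiv
  rw [partialD]
  erw [h2]
  simp [partialD]
  ring

theorem eventually_forall_closedBall_subset {V K : Set 𝔼} (hV : IsOpen V) (hK : IsCompact K)
    (hKV : K ⊆ V) : ∀ᶠ j : ℕ in atTop, ∀ x ∈ K, closedBall x ((1 / 2) ^ j) ⊆ V := by
  obtain ⟨δ, hδ, h⟩ := hK.exists_cthickening_subset_open hV hKV
  have := (tendsto_pow_atTop_nhds_zero_of_lt_one (r := (1 / 2 : ℝ)) (by norm_num)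
        (by norm_num)).eventually_lt_const hδ
  filter_upwards [this] with j hj x hx
  exact (closedBall_subset_cthickening hx _).trans ((cthickening_mono hj.le _).trans h)


variable {u η G : EuclideanSpace ℝ (Fin n) → ℝ} {Φ Φ' : ℝ → ℝ} {V : Set (EuclideanSpace ℝ (Fin n))}
  {μ₀ : Measure (EuclideanSpace ℝ (Fin n))}
  {a b : EuclideanSpace ℝ (Fin n) → EuclideanSpace ℝ (Fin n)} {ε : ℝ}

theorem HasGradient.eventually_chain_identity [IsFiniteMeasure μ₀] (h : HasGradient u V μ₀ a b)
    (hV : IsOpen V)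
    (hu : Integrable u) (hη : IsTest V η) (hG : ContDiff ℝ 1 G) (hΦ : ∀ t, HasDerivAt Φ (Φ' t) t)
    (hΦc : Continuous Φ') (hΦ1 : ∀ t, |Φ' t| ≤ 1)
    {φ : 𝔼 → ℝ} (hφ : IsTest Set.univ φ) (k : Fin n) :
    ∀ᶠ j : ℕ in atTop,
      (∫ x, (η x * partialD k φ x) * Φ (G x - molM volume u j x)) +
        (∫ x, (φ x * partialD k η x) * Φ (G x - molM volume u j x)) +
        (∫ x, (φ x * η x * (partialD k G x - a x k)) * Φ' (G x - molM volume u j x)) -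
        (∫ x, (φ x * η x * Φ' (G x - molM volume u j x)) * (molM volume a j x k - a x k)) =
      ∫ y, molM volume (fun x => φ x * η x * Φ' (G x - molM volume u j x)) j y * b y k ∂μ₀ := by
  filter_upwards [eventually_forall_closedBall_subset hV hη.hasCompactSupport hη.tsupport_subset]
    with j hj
  have hΦcont : Continuous Φ := continuous_iff_continuousAt.2 fun t => (hΦ t).continuousAt
  have hΦcd : ContDiff ℝ 1 Φ := by
    rw [contDiff_one_iff_deriv]
    exact ⟨fun t => (hΦ t).differentiableAt, by rwa [show deriv Φ = Φ' from funext fun t => (hΦ t).deriv]⟩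
  obtain ⟨C, hC0, hC⟩ := hη.exists_bound
  obtain ⟨D, hD0, hD⟩ := hφ.exists_bound
  have hak : Integrable fun x => a x k := (EuclideanSpace.proj k : 𝔼 →L[ℝ] ℝ).integrable_comp h.integrable_ac
  have hbk : Integrable (fun x => b x k) μ₀ :=
    (EuclideanSpace.proj k : 𝔼 →L[ℝ] ℝ).integrable_comp h.integrable_sing
  have hma : Integrable fun x => molM volume a j x k :=
    (EuclideanSpace.proj k : 𝔼 →L[ℝ] ℝ).integrable_comp (integrable_molM h.integrable_ac j)
  have hmb : Integrable fun x => molM μ₀ (fun y => b y k) j x := integrable_molM hbk j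
  have hvc := molM_contDiff hu j
  have hvcont : Continuous fun x => G x - molM volume u j x := hG.continuous.sub hvc.continuous
  have hGk : Continuous (partialD k G) :=
    (hG.continuous_fderiv (by norm_num)).clm_apply continuous_const
  set ψ : 𝔼 → ℝ := fun x => φ x * η x * Φ' (G x - molM volume u j x) with hψ
  have hψc : Continuous ψ := (hφ.continuous.mul hη.continuous).mul (hΦc.comp hvcont)
  have hψb : ∀ x, |ψ x| ≤ D * C := fun x => by
    rw [hψ]
    simp only [abs_mul]
    calc _ ≤ D * C * 1 := by
          gcongr
          exacts [hD x, hC x, hΦ1 _]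
      _ = _ := mul_one _
  have hψi : ∀ {m : Measure 𝔼} {g : 𝔼 → ℝ}, Integrable g m → Integrable (fun x => ψ x * g x) m :=
    fun hg => hg.bdd_mul hψc.aestronglyMeasurable (Eventually.of_forall hψb)
  rw [← integral_mul_molM hbk hψc hψb]
  have hθ : IsTest V fun x => η x * (φ x * Φ (G x - molM volume u j x)) :=
    hη.mul_left (hφ.contDiff.mul (hΦcd.comp (hG.sub hvc)))
  have hθ' : IsTest V fun x => φ x * η x * Φ (G x - molM volume u j x) := by
    convert hθ using 2
    ring
  have h0 := hθ'.integral_partialD_eq_zero k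
  have hpt : ∀ x, partialD k (fun x => φ x * η x * Φ (G x - molM volume u j x)) x =
      (η x * partialD k φ x) * Φ (G x - molM volume u j x) +
        (φ x * partialD k η x) * Φ (G x - molM volume u j x) +
        (φ x * η x * (partialD k G x - a x k)) * Φ' (G x - molM volume u j x) -
        ψ x * (molM volume a j x k - a x k) - ψ x * molM μ₀ (fun y => b y k) j x := fun x => by
    rw [partialD_chain hφ.differentiable hη.differentiable (hG.differentiable (by norm_num))
      (hvc.differentiable (by norm_num)) hΦ]
    by_cases hx : x ∈ tsupport η
    · rw [h.partialD_molM hu (hj x hx), PiLp.add_apply, molM_apply h.integrable_sing]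
      simp only [hψ]
      ring
    · simp [hψ, image_eq_zero_of_notMem_tsupport hx]
  simp_rw [hpt] at h0
  have hcs : ∀ {f g : 𝔼 → ℝ}, Continuous f → HasCompactSupport f → Continuous g →
      Integrable fun x => f x * g x := fun hf hfs hg =>
    (hf.mul hg).integrable_of_hasCompactSupport hfs.mul_right
  have i1 : Integrable fun x => (η x * partialD k φ x) * Φ (G x - molM volume u j x) :=
    hcs (hη.continuous.mul (hφ.partialD_continuous k)) hη.hasCompactSupport.mul_right
      (hΦcont.comp hvcont)
  have i2 : Integrable fun x => (φ x * partialD k η x) * Φ (G x - molM volume u j x) :=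
    hcs (hφ.continuous.mul (hη.partialD_continuous k)) hφ.hasCompactSupport.mul_right
      (hΦcont.comp hvcont)
  have i3 : Integrable fun x => (φ x * η x * (partialD k G x - a x k)) *
      Φ' (G x - molM volume u j x) := by
    have e1 : Integrable fun x => ψ x * partialD k G x :=
      hcs hψc ((hφ.hasCompactSupport.mul_right).mul_right) hGk
    refine (e1.sub (hψi hak)).congr (Eventually.of_forall fun x => ?_)
    simp only [hψ, Pi.sub_apply]
    ring
  have i4 : Integrable fun x => ψ x * (molM volume a j x k - a x k) := hψi (hma.sub hak)
  have e1 := integral_sub (((i1.add i2).add i3).sub i4) (hψi hmb)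
  have e2 := integral_sub ((i1.add i2).add i3) i4
  have e3 := integral_add (i1.add i2) i3
  have e4 := integral_add i1 i2
  simp only [Pi.add_apply, Pi.sub_apply] at e1 e2 e3 e4
  linarith

end ChainRule

section ChainLimit

theorem exists_measurable_lebesgueValue {u : 𝔼 → ℝ} (hu : Integrable u) :
    ∃ L : 𝔼 → ℝ, Measurable L ∧ ∀ x c, LebAt u x c → L x = c :=
  ⟨fun x => limsup (fun j => molM volume u j x) atTop,
    Measurable.limsup fun j => (molM_continuous hu j).measurable,
    fun _ _ h => (h.tendsto_molM hu).limsup_eq⟩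

theorem tendsto_molM_const {θ : 𝔼 → ℝ} (hθ : Continuous θ) (y : 𝔼) :
    Tendsto (fun j => molM volume θ j y) atTop (𝓝 (θ y)) :=
  tendsto_molM_of_eventually (fun _ => hθ) fun _ hε => hθ.eventually_ball y hε

theorem abs_molM_le_of_bound {ψ : 𝔼 → ℝ} (hψ : Continuous ψ) {C : ℝ} (h : ∀ x, |ψ x| ≤ C)
    (j : ℕ) (x : 𝔼) : |molM volume ψ j x| ≤ C := by
  have := norm_molM_sub_le hψ.locallyIntegrable (c := 0) (ε := C) (j := j) (y := x)
    fun y _ => by simpa using h y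
  simpa using this

theorem molM_continuous_of_continuous {ψ : 𝔼 → ℝ} (hψ : Continuous ψ) {C : ℝ}
    (h : ∀ x, |ψ x| ≤ C) (j : ℕ) : Continuous (molM volume ψ j) := by
  have e : molM volume ψ j = fun x => ∫ z, mol j z * ψ (x - z) := by
    funext x
    rw [molM, ← integral_sub_left_eq_self _ volume x]
    simp
  rw [e]
  refine continuous_of_dominated (bound := fun z => mol j z * C)
    (fun x => ((mol_continuous j).mul (hψ.comp (continuous_const.sub
      continuous_id))).aestronglyMeasurable) (fun x => Eventually.of_forall fun z => ?_)
    ((integrable_mol j).mul_const C) (Eventually.of_forall fun z => ?_)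
  · rw [norm_mul, Real.norm_of_nonneg (mol_nonneg _ _)]
    exact mul_le_mul_of_nonneg_left (h _) (mol_nonneg _ _)
  · exact continuous_const.mul (hψ.comp (continuous_id.sub continuous_const))

theorem LebAt.tendsto_molM_comp {u p G : 𝔼 → ℝ} {Ψ : ℝ → ℝ} (hu : Integrable u) (hp : Continuous p)
    (hG : Continuous G) (hΨ : Continuous Ψ) {y : 𝔼} {c : ℝ} (h : LebAt u y c) :
    Tendsto (fun j => molM volume (fun x => p x * Ψ (G x - molM volume u j x)) j y) atTop
      (𝓝 (p y * Ψ (G y - c))) := by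
  refine tendsto_molM_of_eventually
    (fun j => hp.mul (hΨ.comp (hG.sub (molM_continuous hu j)))) fun ε hε => ?_
  have hΘ : Continuous fun q : 𝔼 × ℝ => p q.1 * Ψ (G q.1 - q.2) :=
    (hp.comp continuous_fst).mul (hΨ.comp ((hG.comp continuous_fst).sub continuous_snd))
  obtain ⟨δ, hδ, hΘ⟩ := Metric.continuous_iff.1 hΘ (y, c) ε hε
  filter_upwards [h.eventually_molM hu (half_pos hδ),
    continuous_id.eventually_ball y (half_pos hδ)] with j h1 h2 x hx
  refine (hΘ (x, molM volume u j x) ?_).le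
  rw [Prod.dist_eq, max_lt_iff]
  exact ⟨(h2 x hx).trans_lt (half_lt_self hδ), (h1 x hx).trans_lt (half_lt_self hδ)⟩

variable {u η G : EuclideanSpace ℝ (Fin n) → ℝ} {Φ Φ' : ℝ → ℝ} {V : Set (EuclideanSpace ℝ (Fin n))}
  {μ₀ : Measure (EuclideanSpace ℝ (Fin n))}
  {a b : EuclideanSpace ℝ (Fin n) → EuclideanSpace ℝ (Fin n)} {ε : ℝ}

theorem HasGradient.tendsto_chain (h : HasGradient u V μ₀ a b)
    (hu : Integrable u) (hη : IsTest V η) (hG : ContDiff ℝ 1 G) (hΦ : Continuous Φ)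
    (hΦc : Continuous Φ') (hΦε : ∀ t, |Φ t| ≤ ε) (hΦ1 : ∀ t, |Φ' t| ≤ 1)
    {φ : 𝔼 → ℝ} (hφ : IsTest Set.univ φ) (k : Fin n) :
    Tendsto (fun j =>
      (∫ x, (η x * partialD k φ x) * Φ (G x - molM volume u j x)) +
        (∫ x, (φ x * partialD k η x) * Φ (G x - molM volume u j x)) +
        (∫ x, (φ x * η x * (partialD k G x - a x k)) * Φ' (G x - molM volume u j x)) -
        (∫ x, (φ x * η x * Φ' (G x - molM volume u j x)) * (molM volume a j x k - a x k))) atTop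
      (𝓝 ((∫ x, (η x * partialD k φ x) * Φ (G x - u x)) +
        (∫ x, (φ x * partialD k η x) * Φ (G x - u x)) +
        (∫ x, (φ x * η x * (partialD k G x - a x k)) * Φ' (G x - u x)))) := by
  obtain ⟨C, hC0, hC⟩ := hη.exists_bound
  obtain ⟨D, hD0, hD⟩ := hφ.exists_bound
  have hak : Integrable fun x => a x k :=
    (EuclideanSpace.proj k : 𝔼 →L[ℝ] ℝ).integrable_comp h.integrable_ac
  have hGk : Continuous (partialD k G) :=
    (hG.continuous_fderiv (by norm_num)).clm_apply continuous_const
  have i1 : Integrable fun x => η x * partialD k φ x :=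
    (hη.continuous.mul (hφ.partialD_continuous k)).integrable_of_hasCompactSupport
      hη.hasCompactSupport.mul_right
  have i2 : Integrable fun x => φ x * partialD k η x :=
    (hφ.continuous.mul (hη.partialD_continuous k)).integrable_of_hasCompactSupport
      hφ.hasCompactSupport.mul_right
  have hφη : ∀ x, |φ x * η x| ≤ D * C := fun x => by
    rw [abs_mul]
    gcongr
    exacts [hD x, hC x]
  have i3 : Integrable fun x => φ x * η x * (partialD k G x - a x k) := by
    simp_rw [mul_sub]
    exact (((hφ.continuous.mul hη.continuous).mul hGk).integrable_of_hasCompactSupport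
      hφ.hasCompactSupport.mul_right.mul_right).sub
      (hak.bdd_mul (hφ.continuous.mul hη.continuous).aestronglyMeasurable
        (Eventually.of_forall hφη))
  have hz : Tendsto (fun j => ∫ x, (φ x * η x * Φ' (G x - molM volume u j x)) *
      (molM volume a j x k - a x k)) atTop (𝓝 0) := by
    have := (tendsto_integral_norm_molM_sub h.integrable_ac).const_mul (D * C)
    rw [mul_zero] at this
    refine squeeze_zero_norm (fun j => ?_) this
    rw [← integral_const_mul]
    refine norm_integral_le_of_norm_le
      (((integrable_molM h.integrable_ac j).sub h.integrable_ac).norm.const_mul _)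
      (Eventually.of_forall fun x => ?_)
    rw [norm_mul]
    refine mul_le_mul ?_ ?_ (norm_nonneg _) (by positivity)
    · rw [norm_mul]
      calc _ ≤ D * C * 1 := mul_le_mul (hφη x) (hΦ1 _) (abs_nonneg _) (by positivity)
        _ = _ := mul_one _
    · exact PiLp.norm_apply_le (molM volume a j x - a x) k
  have := (((tendsto_integral_mul_comp_molM hu hG.continuous hΦ hΦε Measure.AbsolutelyContinuous.rfl
    i1).add (tendsto_integral_mul_comp_molM hu hG.continuous hΦ hΦε
      Measure.AbsolutelyContinuous.rfl i2)).add (tendsto_integral_mul_comp_molM hu hG.continuous hΦc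
        hΦ1 Measure.AbsolutelyContinuous.rfl i3)).sub hz
  rw [sub_zero] at this
  exact this

theorem HasGradient.abs_chain_le [IsFiniteMeasure μ₀] (h : HasGradient u V μ₀ a b)
    (hV : IsOpen V) (hu : Integrable u) (hη : IsTest V η) (hη0 : ∀ x, 0 ≤ η x)
    (hG : ContDiff ℝ 1 G) (hΦ : ∀ t, HasDerivAt Φ (Φ' t) t)
    (hΦc : Continuous Φ') (hΦε : ∀ t, |Φ t| ≤ ε) (hΦ1 : ∀ t, |Φ' t| ≤ 1)
    {L : 𝔼 → ℝ} (hL : ∀ x c, LebAt u x c → L x = c)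
    {φ : 𝔼 → ℝ} (hφ : IsTest Set.univ φ) (k : Fin n) :
    |((∫ x, (η x * partialD k φ x) * Φ (G x - u x)) +
        (∫ x, (φ x * partialD k η x) * Φ (G x - u x)) +
        (∫ x, (φ x * η x * (partialD k G x - a x k)) * Φ' (G x - u x))) -
      ∫ x in (approxDiscontSet n u)ᶜ, (φ x * η x * Φ' (G x - L x)) * b x k ∂μ₀| ≤
      ∫ x in approxDiscontSet n u, |φ x| * (η x * |b x k|) ∂μ₀ := by
  obtain ⟨C, hC0, hC⟩ := hη.exists_bound
  obtain ⟨D, hD0, hD⟩ := hφ.exists_bound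
  have hS : MeasurableSet (approxDiscontSet n u) := measurableSet_approxDiscontSet_of_integrable hu
  have hΦcont : Continuous Φ := continuous_iff_continuousAt.2 fun t => (hΦ t).continuousAt
  have hbk : Integrable (fun x => b x k) μ₀ :=
    (EuclideanSpace.proj k : 𝔼 →L[ℝ] ℝ).integrable_comp h.integrable_sing
  set ψ : ℕ → 𝔼 → ℝ := fun j x => φ x * η x * Φ' (G x - molM volume u j x)
  have hpc : Continuous fun x => φ x * η x := hφ.continuous.mul hη.continuous
  have hψc : ∀ j, Continuous (ψ j) := fun j =>
    hpc.mul (hΦc.comp (hG.continuous.sub (molM_continuous hu j)))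
  have hψθ : ∀ j x, |ψ j x| ≤ |φ x| * η x := fun j x => by
    simp only [ψ, abs_mul, abs_of_nonneg (hη0 x)]
    exact mul_le_of_le_one_right (mul_nonneg (abs_nonneg _) (hη0 x)) (hΦ1 _)
  have hθb : ∀ x, |φ x| * η x ≤ D * C := fun x =>
    mul_le_mul (hD x) ((le_abs_self _).trans (hC x)) (hη0 x) hD0
  have hψb : ∀ j x, |ψ j x| ≤ D * C := fun j x => (hψθ j x).trans (hθb x)
  have hθc : Continuous fun x => |φ x| * η x := hφ.continuous.abs.mul hη.continuous
  have hθb' : ∀ x, |(|φ x| * η x)| ≤ D * C := fun x => by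
    rw [abs_of_nonneg (mul_nonneg (abs_nonneg _) (hη0 x))]
    exact hθb x
  have hi : ∀ j, Integrable (fun y => molM volume (ψ j) j y * b y k) μ₀ := fun j =>
    hbk.bdd_mul (molM_continuous_of_continuous (hψc j) (hψb j) j).aestronglyMeasurable
      (Eventually.of_forall fun y => abs_molM_le_of_bound (hψc j) (hψb j) j y)
  have hc : Tendsto (fun j => ∫ y in (approxDiscontSet n u)ᶜ, molM volume (ψ j) j y * b y k ∂μ₀)
      atTop (𝓝 (∫ x in (approxDiscontSet n u)ᶜ, (φ x * η x * Φ' (G x - L x)) * b x k ∂μ₀)) := by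
    refine tendsto_integral_of_dominated_convergence (fun y => D * C * ‖b y k‖)
      (fun j => (hi j).1.restrict) (hbk.norm.const_mul _).integrableOn
      (fun j => Eventually.of_forall fun y => ?_) ?_
    · rw [norm_mul]
      exact mul_le_mul_of_nonneg_right (abs_molM_le_of_bound (hψc j) (hψb j) j y) (norm_nonneg _)
    · filter_upwards [ae_restrict_mem hS.compl] with y hy
      obtain ⟨c, hc⟩ := notMem_approxDiscontSet_iff.1 hy
      rw [hL y c hc]
      exact (hc.tendsto_molM_comp hu hpc hG.continuous hΦc).mul_const _
  have hθi : Tendsto (fun j => ∫ y in approxDiscontSet n u,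
      molM volume (fun x => |φ x| * η x) j y * |b y k| ∂μ₀) atTop
      (𝓝 (∫ x in approxDiscontSet n u, |φ x| * (η x * |b x k|) ∂μ₀)) := by
    refine tendsto_integral_of_dominated_convergence (fun y => D * C * ‖b y k‖)
      (fun j => ((molM_continuous_of_continuous hθc hθb' j).aestronglyMeasurable.mul
        hbk.1.norm).restrict) (hbk.norm.const_mul _).integrableOn
      (fun j => Eventually.of_forall fun y => ?_) (Eventually.of_forall fun y => ?_)
    · rw [norm_mul, norm_abs_eq_norm]
      exact mul_le_mul_of_nonneg_right (abs_molM_le_of_bound hθc hθb' j y) (norm_nonneg _)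
    · rw [← mul_assoc]
      exact (tendsto_molM_const hθc y).mul_const _
  have hmain := h.tendsto_chain hu hη hG hΦcont hΦc hΦε hΦ1 hφ k
  have hmain' := hmain.congr' (h.eventually_chain_identity hV hu hη hG hΦ hΦc hΦ1 hφ k)
  refine le_of_tendsto_of_tendsto' (hmain'.sub hc).abs hθi fun j => ?_
  have e : (∫ y, molM volume (ψ j) j y * b y k ∂μ₀) -
      ∫ y in (approxDiscontSet n u)ᶜ, molM volume (ψ j) j y * b y k ∂μ₀ =
      ∫ y in approxDiscontSet n u, molM volume (ψ j) j y * b y k ∂μ₀ := by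
    rw [← integral_add_compl hS (hi j), add_sub_cancel_right]
  rw [e, ← Real.norm_eq_abs]
  refine norm_integral_le_of_norm_le ?_ (Eventually.of_forall fun y => ?_)
  · exact (hbk.abs.bdd_mul (molM_continuous_of_continuous hθc hθb' j).aestronglyMeasurable
      (Eventually.of_forall fun y => abs_molM_le_of_bound hθc hθb' j y)).integrableOn
  · rw [norm_mul]
    exact mul_le_mul_of_nonneg_right (abs_molM_le hθc (hψθ j) j y) (norm_nonneg _)

end ChainLimit

section Chain

theorem gradV_continuous {G : 𝔼 → ℝ} (hG : ContDiff ℝ 1 G) : Continuous (gradV G) :=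
  (PiLp.continuous_toLp 2 _).comp (continuous_pi fun _ =>
    (hG.continuous_fderiv (by norm_num)).clm_apply continuous_const)

theorem gradV_eq_zero {η : 𝔼 → ℝ} {x : 𝔼} (hx : x ∉ tsupport η) : gradV η x = 0 := by
  ext k
  exact IsTest.partialD_eq_zero_of_notMem_tsupport k hx

theorem integrable_of_eq_zero_of_continuous {E : Type*} [NormedAddCommGroup E] {g : 𝔼 → E}
    (hg : Continuous g)
    {K : Set 𝔼} (hK : IsCompact K) (h : ∀ x ∉ K, g x = 0) : Integrable g :=
  hg.integrable_of_hasCompactSupport (HasCompactSupport.intro hK h)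

/-- Integration of test functions against an integrable density. -/
def testPairing {Ω : Set 𝔼} {m : Measure 𝔼} {g : 𝔼 → ℝ} (hg : Integrable g m) :
    testSpace Ω →ₗ[ℝ] ℝ where
  toFun φ := ∫ x, (φ : 𝔼 → ℝ) x * g x ∂m
  map_add' φ ψ := by
    rw [← integral_add (IsTest.integrable_mul φ.2 hg) (IsTest.integrable_mul ψ.2 hg)]
    congr 1
    funext x
    exact add_mul _ _ _
  map_smul' c φ := by
    rw [RingHom.id_apply, smul_eq_mul, ← integral_const_mul]
    congr 1
    funext x
    exact mul_assoc _ _ _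

variable {u η G : EuclideanSpace ℝ (Fin n) → ℝ} {Φ Φ' : ℝ → ℝ} {V : Set (EuclideanSpace ℝ (Fin n))}
  {μ₀ : Measure (EuclideanSpace ℝ (Fin n))}
  {a b : EuclideanSpace ℝ (Fin n) → EuclideanSpace ℝ (Fin n)} {ε : ℝ}

/-- A weak chain rule for `η Φ(G - u)` with `Φ` and its derivative bounded. -/
theorem HasGradient.exists_chain [IsFiniteMeasure μ₀] (h : HasGradient u V μ₀ a b)
    (hV : IsOpen V) (hu : Integrable u) (hη : IsTest V η) (hη0 : ∀ x, 0 ≤ η x)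
    (hG : ContDiff ℝ 1 G) (hΦ : ∀ t, HasDerivAt Φ (Φ' t) t)
    (hΦc : Continuous Φ') (hΦε : ∀ t, |Φ t| ≤ ε) (hΦ1 : ∀ t, |Φ' t| ≤ 1) :
    ∃ β : 𝔼 → 𝔼, (∀ x k, |β x k| ≤ η x * |b x k|) ∧
      (∀ x c, LebAt u x c → β x = (η x * Φ' (G x - c)) • b x) ∧
      HasGradient (fun x => η x * Φ (G x - u x)) Set.univ μ₀
        (fun x => Φ (G x - u x) • gradV η x + (η x * Φ' (G x - u x)) • (gradV G x - a x))
        (fun x => -β x) := by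
  obtain ⟨C, hC0, hC⟩ := hη.exists_bound
  obtain ⟨L, hLm, hL⟩ := exists_measurable_lebesgueValue hu
  set S := approxDiscontSet n u with hSdef
  have hS : MeasurableSet S := measurableSet_approxDiscontSet_of_integrable hu
  have hΦcont : Continuous Φ := continuous_iff_continuousAt.2 fun t => (hΦ t).continuousAt
  have hvm : AEStronglyMeasurable (fun x => G x - u x) volume :=
    hG.continuous.aestronglyMeasurable.sub hu.1
  have hw : Integrable fun x => η x * Φ (G x - u x) :=
    (hη.continuous.integrable_of_hasCompactSupport hη.hasCompactSupport).mul_bdd (c := ε)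
      (hΦcont.comp_aestronglyMeasurable hvm) (Eventually.of_forall fun x => hΦε _)
  have hA : Integrable fun x =>
      Φ (G x - u x) • gradV η x + (η x * Φ' (G x - u x)) • (gradV G x - a x) := by
    refine Integrable.add ?_ ?_
    · exact (integrable_of_eq_zero_of_continuous (gradV_continuous hη.contDiff)
        hη.hasCompactSupport fun x hx => gradV_eq_zero hx).bdd_smul ε
        (hΦcont.comp_aestronglyMeasurable hvm) (Eventually.of_forall fun x => hΦε _)
    · have e1 : Integrable fun x => η x • (gradV G x - a x) := by
        simp_rw [smul_sub]
        exact (integrable_of_eq_zero_of_continuous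
          (hη.continuous.smul (gradV_continuous hG)) hη.hasCompactSupport fun x hx => by
            simp [image_eq_zero_of_notMem_tsupport hx]).sub
          (h.integrable_ac.bdd_smul C hη.continuous.aestronglyMeasurable
            (Eventually.of_forall fun x => hC x))
      refine (e1.bdd_smul 1 (hΦc.comp_aestronglyMeasurable hvm)
        (Eventually.of_forall fun x => hΦ1 _)).congr (Eventually.of_forall fun x => ?_)
      change Φ' (G x - u x) • η x • (gradV G x - a x) = _
      rw [smul_smul, mul_comm]
  set A : 𝔼 → 𝔼 := fun x =>
    Φ (G x - u x) • gradV η x + (η x * Φ' (G x - u x)) • (gradV G x - a x) with hAdef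
  have hAk : ∀ k, Integrable fun x => A x k := fun k =>
    (EuclideanSpace.proj k : 𝔼 →L[ℝ] ℝ).integrable_comp hA
  have hbk : ∀ k, Integrable (fun x => b x k) μ₀ := fun k =>
    (EuclideanSpace.proj k : 𝔼 →L[ℝ] ℝ).integrable_comp h.integrable_sing
  have hqm : Measurable fun x => η x * Φ' (G x - L x) :=
    hη.continuous.measurable.mul (hΦc.measurable.comp (hG.continuous.measurable.sub hLm))
  have hqb : ∀ x, |η x * Φ' (G x - L x)| ≤ η x := fun x => by
    rw [abs_mul, abs_of_nonneg (hη0 x)]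
    exact mul_le_of_le_one_right (hη0 x) (hΦ1 _)
  have hBk : ∀ k, Integrable (fun x => Sᶜ.indicator (fun x => η x * Φ' (G x - L x) * b x k) x) μ₀ :=
    fun k => ((hbk k).bdd_mul hqm.aestronglyMeasurable (Eventually.of_forall fun x =>
      (hqb x).trans ((le_abs_self _).trans (hC x)))).indicator hS.compl
  have hηb : ∀ k, AEMeasurable (fun x => ENNReal.ofReal (η x * |b x k|)) (μ₀.restrict S) :=
    fun k => ((hη.continuous.measurable.aemeasurable.mul
      (hbk k).1.aemeasurable.abs).ennreal_ofReal).restrict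
  have hηbi : ∀ k, Integrable (fun x => η x * |b x k|) (μ₀.restrict S) := fun k =>
    ((hbk k).abs.bdd_mul hη.continuous.aestronglyMeasurable (Eventually.of_forall hC)).restrict
  have htoReal : ∀ k x, (ENNReal.ofReal (η x * |b x k|)).toReal = η x * |b x k| := fun k x =>
    ENNReal.toReal_ofReal (mul_nonneg (hη0 x) (abs_nonneg _))
  have hσ : ∀ k : Fin n, ∃ σ : 𝔼 → ℝ, Measurable σ ∧ (∀ x, |σ x| ≤ 1) ∧
      ∀ φ, IsTest Set.univ φ → (∫ x, (η x * Φ (G x - u x)) * partialD k φ x) +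
        (∫ x, φ x * A x k) - (∫ x, φ x * Sᶜ.indicator (fun x => η x * Φ' (G x - L x) * b x k) x ∂μ₀)
        = ∫ x in S, φ x * (σ x * (η x * |b x k|)) ∂μ₀ := fun k => by
    let ν : Measure 𝔼 := (μ₀.restrict S).withDensity fun x => ENNReal.ofReal (η x * |b x k|)
    have : IsFiniteMeasure ν := isFiniteMeasure_withDensity_ofReal (hηbi k).2
    have hν : ∀ g : 𝔼 → ℝ, ∫ x, g x ∂ν = ∫ x in S, (η x * |b x k|) * g x ∂μ₀ := fun g => by
      rw [integral_withDensity_eq_integral_toReal_smul₀ (hηb k)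
        (Eventually.of_forall fun x => ENNReal.ofReal_lt_top)]
      simp_rw [htoReal, smul_eq_mul]
    obtain ⟨σ, hσm, hσ1, hσ⟩ := exists_density_of_testSpace (Ω := Set.univ) ν
      (distribD (fun x => η x * Φ (G x - u x)) (hw.locallyIntegrable.locallyIntegrableOn _) k +
        testPairing (hAk k) - testPairing (hBk k)) fun φ => by
      have hφ : IsTest Set.univ (φ : 𝔼 → ℝ) := φ.2
      have key := h.abs_chain_le hV hu hη hη0 hG hΦ hΦc hΦε hΦ1 hL hφ k
      rw [hν]
      have r1 : ∫ x in S, η x * |b x k| * |(φ : 𝔼 → ℝ) x| ∂μ₀ =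
          ∫ x in S, |(φ : 𝔼 → ℝ) x| * (η x * |b x k|) ∂μ₀ := by
        simp_rw [mul_comm]
      have r2 : ∫ x, (φ : 𝔼 → ℝ) x * Sᶜ.indicator (fun x => η x * Φ' (G x - L x) * b x k) x ∂μ₀ =
          ∫ x in Sᶜ, ((φ : 𝔼 → ℝ) x * η x * Φ' (G x - L x)) * b x k ∂μ₀ := by
        rw [← integral_indicator hS.compl]
        congr 1
        funext x
        by_cases hx : x ∈ Sᶜ
        · simp only [Set.indicator_of_mem hx]
          ring
        · simp only [Set.indicator_of_notMem hx, mul_zero]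
      have i1 : Integrable fun x => ((φ : 𝔼 → ℝ) x * partialD k η x) * Φ (G x - u x) :=
        ((hφ.continuous.mul (hη.partialD_continuous k)).integrable_of_hasCompactSupport
          hφ.hasCompactSupport.mul_right).mul_bdd (c := ε)
          (hΦcont.comp_aestronglyMeasurable hvm) (Eventually.of_forall fun x => hΦε _)
      have e0 : ∀ x, (φ : 𝔼 → ℝ) x * A x k = ((φ : 𝔼 → ℝ) x * partialD k η x) * Φ (G x - u x) +
          ((φ : 𝔼 → ℝ) x * η x * (partialD k G x - a x k)) * Φ' (G x - u x) := fun x => by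
        simp only [hAdef, PiLp.add_apply, PiLp.smul_apply, PiLp.sub_apply, gradV_apply, smul_eq_mul]
        ring
      have i2 : Integrable fun x => ((φ : 𝔼 → ℝ) x * η x * (partialD k G x - a x k)) *
          Φ' (G x - u x) := by
        refine ((hφ.integrable_mul (hAk k)).sub i1).congr (Eventually.of_forall fun x => ?_)
        simp only [Pi.sub_apply, e0]
        ring
      have r3 : ∫ x, (φ : 𝔼 → ℝ) x * A x k = (∫ x, ((φ : 𝔼 → ℝ) x * partialD k η x) * Φ (G x - u x)) +
          ∫ x, ((φ : 𝔼 → ℝ) x * η x * (partialD k G x - a x k)) * Φ' (G x - u x) := by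
        simp_rw [e0]
        exact integral_add i1 i2
      have r4 : ∫ x, (η x * Φ (G x - u x)) * partialD k (φ : 𝔼 → ℝ) x =
          ∫ x, (η x * partialD k (φ : 𝔼 → ℝ) x) * Φ (G x - u x) := by
        simp_rw [mul_right_comm]
      rw [r1]
      refine le_trans (le_of_eq ?_) key
      rw [LinearMap.sub_apply, LinearMap.add_apply]
      change |(∫ x, (η x * Φ (G x - u x)) * partialD k (φ : 𝔼 → ℝ) x) +
        (∫ x, (φ : 𝔼 → ℝ) x * A x k) - (∫ x, (φ : 𝔼 → ℝ) x *
          Sᶜ.indicator (fun x => η x * Φ' (G x - L x) * b x k) x ∂μ₀)| = _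
      rw [r2, r3, r4, add_assoc]
    refine ⟨σ, hσm, hσ1, fun φ hφ => ?_⟩
    have := hσ ⟨φ, hφ⟩
    rw [hν] at this
    refine Eq.trans this ?_
    congr 1
    funext x
    simp only
    ring
  choose σ hσm hσ1 hσ using hσ
  let β : 𝔼 → 𝔼 := fun x => WithLp.toLp 2 fun k =>
    Sᶜ.indicator (fun x => η x * Φ' (G x - L x) * b x k) x +
      S.indicator (fun x => σ k x * (η x * |b x k|)) x
  have hβk : ∀ x k, β x k = Sᶜ.indicator (fun x => η x * Φ' (G x - L x) * b x k) x +
      S.indicator (fun x => σ k x * (η x * |b x k|)) x := fun _ _ => rfl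
  have hσi : ∀ k, Integrable (fun x => S.indicator (fun x => σ k x * (η x * |b x k|)) x) μ₀ :=
    fun k => (integrable_indicator_iff hS).2 ((hηbi k).bdd_mul (hσm k).aestronglyMeasurable
      (Eventually.of_forall (hσ1 k)))
  refine ⟨β, fun x k => ?_, fun x c hc => ?_, ?_, hA, ?_, fun φ hφ k => ?_⟩
  · rw [hβk]
    by_cases hx : x ∈ S
    · rw [Set.indicator_of_notMem (by simpa using hx), Set.indicator_of_mem hx, zero_add, abs_mul,
        abs_of_nonneg (mul_nonneg (hη0 x) (abs_nonneg _))]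
      exact mul_le_of_le_one_left (mul_nonneg (hη0 x) (abs_nonneg _)) (hσ1 k x)
    · rw [Set.indicator_of_notMem hx, Set.indicator_of_mem (by simpa using hx), add_zero, abs_mul]
      exact mul_le_mul_of_nonneg_right (hqb x) (abs_nonneg _)
  · have hx : x ∉ S := notMem_approxDiscontSet_iff.2 ⟨c, hc⟩
    ext k
    rw [hβk, Set.indicator_of_notMem hx, Set.indicator_of_mem (by simpa using hx), add_zero,
      hL x c hc]
    rfl
  · exact hw.locallyIntegrable.locallyIntegrableOn _
  · refine Integrable.neg ?_
    rw [integrable_piLp_iff]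
    exact fun k => (hBk k).add (hσi k)
  · have h1 := hσ k φ hφ
    have h2 : ∫ x in S, φ x * (σ k x * (η x * |b x k|)) ∂μ₀ =
        ∫ x, φ x * S.indicator (fun x => σ k x * (η x * |b x k|)) x ∂μ₀ := by
      rw [← integral_indicator hS]
      congr 1
      funext x
      by_cases hx : x ∈ S
      · simp only [Set.indicator_of_mem hx]
      · simp only [Set.indicator_of_notMem hx, mul_zero]
    have h3 : ∫ x, φ x * (-β x) k ∂μ₀ =
        -((∫ x, φ x * Sᶜ.indicator (fun x => η x * Φ' (G x - L x) * b x k) x ∂μ₀) +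
        ∫ x, φ x * S.indicator (fun x => σ k x * (η x * |b x k|)) x ∂μ₀) := by
      rw [← integral_add (hφ.integrable_mul (hBk k)) (hφ.integrable_mul (hσi k)), ← integral_neg]
      congr 1
      funext x
      rw [PiLp.neg_apply, hβk]
      ring
    rw [h3]
    linarith

end Chain

section Cutoff

variable {F F' : EuclideanSpace ℝ (Fin n) → ℝ} {Ω V : Set (EuclideanSpace ℝ (Fin n))}
  {μ₀ : Measure (EuclideanSpace ℝ (Fin n))}
  {a b a' b' : EuclideanSpace ℝ (Fin n) → EuclideanSpace ℝ (Fin n)}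

theorem HasGradient.add (h : HasGradient F Ω μ₀ a b) (h' : HasGradient F' Ω μ₀ a' b') :
    HasGradient (fun x => F x + F' x) Ω μ₀ (fun x => a x + a' x) (fun x => b x + b' x) := by
  refine ⟨h.locallyIntegrableOn.add h'.locallyIntegrableOn, h.integrable_ac.add h'.integrable_ac,
    h.integrable_sing.add h'.integrable_sing, fun φ hφ k => ?_⟩
  have e : ∀ {m : Measure 𝔼} {g : 𝔼 → 𝔼}, Integrable g m → Integrable (fun x => φ x * g x k) m :=
    fun hg => hφ.integrable_mul ((EuclideanSpace.proj k : 𝔼 →L[ℝ] ℝ).integrable_comp hg)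
  simp only [add_mul, mul_add, PiLp.add_apply]
  rw [integral_add (LocallyIntegrableOn.integrable_mul_partialD h.locallyIntegrableOn hφ k)
    (LocallyIntegrableOn.integrable_mul_partialD h'.locallyIntegrableOn hφ k),
    integral_add (e h.integrable_ac) (e h'.integrable_ac),
    integral_add (e h.integrable_sing) (e h'.integrable_sing), h.integral_eq φ hφ k,
    h'.integral_eq φ hφ k]
  ring

theorem HasGradient.indicator (h : HasGradient F V μ₀ a b) (hV : MeasurableSet V) :
    HasGradient (V.indicator F) V μ₀ a b := by
  refine ⟨?_, h.integrable_ac, h.integrable_sing, fun φ hφ k => ?_⟩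
  · intro x hx
    obtain ⟨s, hs, hi⟩ := h.locallyIntegrableOn x hx
    exact ⟨s, hs, IntegrableOn.indicator hi hV⟩
  · rw [← h.integral_eq φ hφ k]
    congr 1
    funext x
    by_cases hx : x ∈ V
    · rw [Set.indicator_of_mem hx]
    · rw [hφ.partialD_eq_zero k hx, mul_zero, mul_zero]

/-- Smooth cutoff functions. -/
theorem exists_isTest_eq_one {L U : Set 𝔼} (hL : IsCompact L) (hU : IsOpen U) (hLU : L ⊆ U) :
    ∃ η : 𝔼 → ℝ, IsTest U η ∧ (∀ x, 0 ≤ η x) ∧ (∀ x, η x ≤ 1) ∧ ∀ x ∈ L, η x = 1 := by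
  obtain ⟨δ, hδ, hδU⟩ := hL.exists_cthickening_subset_open hU hLU
  obtain ⟨j, hj⟩ : ∃ j : ℕ, (1 / 2 : ℝ) ^ j < δ / 2 :=
    exists_pow_lt_of_lt_one (half_pos hδ) (by norm_num)
  set T := cthickening (δ / 2) L
  have hT : IsCompact T := hL.cthickening
  set v : 𝔼 → ℝ := T.indicator fun _ => 1
  have hv : Integrable v :=
    (integrable_indicator_iff hT.measurableSet).2 (integrableOn_const hT.measure_lt_top.ne)
  have hv0 : ∀ x, 0 ≤ v x := fun x => Set.indicator_nonneg (fun _ _ => zero_le_one) x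
  have hv1 : ∀ x, v x ≤ 1 := fun x => Set.indicator_le_self' (fun _ _ => zero_le_one) x
  have hs : tsupport (molM volume v j) ⊆ cthickening δ L := by
    refine closure_minimal (fun x hx => ?_) isClosed_cthickening
    by_contra hx'
    refine hx (molM_eq_zero fun y hy => Set.indicator_of_notMem (fun hyT => hx' ?_) _)
    have h1 : x ∈ cthickening (δ / 2) T :=
      mem_cthickening_of_dist_le x y _ _ hyT (by
        rw [dist_comm]
        exact (mem_ball.1 hy).le.trans hj.le)
    have h2 := cthickening_cthickening_subset (half_pos hδ).le (half_pos hδ).le L h1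
    rwa [add_halves] at h2
  refine ⟨molM volume v j, ⟨molM_contDiff hv j,
    hL.cthickening.of_isClosed_subset (isClosed_tsupport _) hs, hs.trans hδU⟩, fun x => ?_,
    fun x => ?_, fun x hx => ?_⟩
  · exact integral_nonneg fun y => mul_nonneg (mol_nonneg _ _) (hv0 y)
  · have h1 := norm_molM_sub_le (c := (0 : ℝ)) (ε := 1) (j := j) (y := x) hv.locallyIntegrable
      fun y _ => by
        rw [sub_zero, Real.norm_of_nonneg (hv0 y)]
        exact hv1 y
    rw [sub_zero] at h1
    exact (le_abs_self _).trans h1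
  · have h1 := norm_molM_sub_le (c := (1 : ℝ)) (ε := 0) (j := j) (y := x) hv.locallyIntegrable
      fun y hy => by
        have : y ∈ T := mem_cthickening_of_dist_le y x _ _ hx ((mem_ball.1 hy).le.trans hj.le)
        simp [v, this]
    exact sub_eq_zero.1 (norm_le_zero_iff.1 h1)

theorem exists_isCompact_setIntegral_diff_le [IsFiniteMeasure μ₀] (hb : Integrable b μ₀)
    {A : Set 𝔼} (hA : MeasurableSet A) {δ : ℝ} (hδ : 0 < δ) :
    ∃ L ⊆ A, IsCompact L ∧ ∫ x in A \ L, ‖b x‖ ∂μ₀ ≤ δ := by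
  set ν : Measure 𝔼 := μ₀.withDensity fun x => ‖b x‖ₑ
  have : IsFiniteMeasure ν := isFiniteMeasure_withDensity hb.2.ne
  obtain ⟨L, hLA, hL, h⟩ := hA.exists_isCompact_sdiff_lt (μ := ν) (measure_ne_top _ _)
    (ENNReal.ofReal_pos.2 hδ).ne'
  refine ⟨L, hLA, hL, ?_⟩
  rw [integral_norm_eq_lintegral_enorm hb.1.restrict]
  refine ENNReal.toReal_le_of_le_ofReal hδ.le ?_
  rw [← withDensity_apply _ (hA.diff hL.measurableSet)]
  exact h.le

theorem norm_le_of_forall_abs_le {x y : 𝔼} (h : ∀ k, |x k| ≤ |y k|) : ‖x‖ ≤ ‖y‖ := by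
  rw [EuclideanSpace.norm_eq, EuclideanSpace.norm_eq]
  refine Real.sqrt_le_sqrt (Finset.sum_le_sum fun k _ => ?_)
  exact pow_le_pow_left₀ (norm_nonneg _) (h k) 2

end Cutoff

section Correction

variable {F : EuclideanSpace ℝ (Fin n) → ℝ} {Ω : Set (EuclideanSpace ℝ (Fin n))}
  {μ₀ : Measure (EuclideanSpace ℝ (Fin n))}
  {a b : EuclideanSpace ℝ (Fin n) → EuclideanSpace ℝ (Fin n)}

theorem setIntegral_norm_union_le (hb : Integrable b μ₀) {A B : Set 𝔼} (hA : MeasurableSet A)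
    (hB : MeasurableSet B) :
    ∫ x in A ∪ B, ‖b x‖ ∂μ₀ ≤ (∫ x in A, ‖b x‖ ∂μ₀) + ∫ x in B, ‖b x‖ ∂μ₀ := by
  rw [← Set.union_sdiff_self, setIntegral_union Set.disjoint_sdiff_right (hB.diff hA)
    hb.norm.integrableOn hb.norm.integrableOn]
  exact add_le_add le_rfl (setIntegral_mono_set hb.norm.integrableOn
    (Eventually.of_forall fun _ => norm_nonneg _) Set.sdiff_subset.eventuallyLE)

theorem tendsto_setIntegral_norm_sub {β : ℕ → 𝔼 → 𝔼} {N : Set 𝔼} (hN : MeasurableSet N)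
    (hb : Integrable b μ₀) (hβm : ∀ j, AEStronglyMeasurable (β j) μ₀)
    (hβ : ∀ j x, ‖β j x‖ ≤ ‖b x‖) (hlim : ∀ x ∈ N, Tendsto (fun j => β j x) atTop (𝓝 (b x))) :
    Tendsto (fun j => ∫ x in N, ‖b x - β j x‖ ∂μ₀) atTop (𝓝 0) := by
  have := tendsto_integral_of_dominated_convergence (μ := μ₀.restrict N)
    (F := fun j x => ‖b x - β j x‖) (f := fun _ => 0) (fun x => 2 * ‖b x‖)
    (fun j => ((hb.1.sub (hβm j)).norm).restrict) ((hb.norm.const_mul 2).integrableOn)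
    (fun j => Eventually.of_forall fun x => by
      rw [norm_norm, two_mul]
      exact (norm_sub_le _ _).trans (add_le_add le_rfl (hβ j x)))
    ((ae_restrict_iff' hN).2 (Eventually.of_forall fun x hx => by
      have := ((tendsto_const_nhds (x := b x)).sub (hlim x hx)).norm
      rwa [sub_self, norm_zero] at this))
  simpa using this

theorem tendsto_integral_comp_molM_sub {u : 𝔼 → ℝ} (hu : Integrable u) {Φ : ℝ → ℝ} {ε : ℝ}
    (hΦ : Continuous Φ) (hΦ0 : Φ 0 = 0) (hΦε : ∀ t, |Φ t| ≤ ε) {g : 𝔼 → 𝔼} (hg : Integrable g) :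
    Tendsto (fun j => ∫ x, ‖Φ (molM volume u j x - u x) • g x‖) atTop (𝓝 0) := by
  have := tendsto_integral_of_dominated_convergence (μ := (volume : Measure 𝔼))
    (F := fun j x => ‖Φ (molM volume u j x - u x) • g x‖) (f := fun _ => 0) (fun x => ε * ‖g x‖)
    (fun j => ((hΦ.comp_aestronglyMeasurable
      ((molM_continuous hu j).aestronglyMeasurable.sub hu.1)).smul hg.1).norm)
    (hg.norm.const_mul ε)
    (fun j => Eventually.of_forall fun x => by
      rw [norm_norm, norm_smul]
      exact mul_le_mul_of_nonneg_right (hΦε _) (norm_nonneg _))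
    (by
      filter_upwards [ae_tendsto_molM hu] with x hx
      have h1 : Tendsto (fun j => molM volume u j x - u x) atTop (𝓝 0) := by
        have := hx.sub_const (u x)
        rwa [sub_self] at this
      have h2 := (((hΦ.tendsto 0).comp h1).smul_const (g x)).norm
      rw [hΦ0, zero_smul, norm_zero] at h2
      exact h2)
  simpa using this

theorem HasGradient.gradV_molM {u : 𝔼 → ℝ} {V : Set 𝔼}
    (h : HasGradient u V μ₀ a b) (hu : Integrable u) {j : ℕ} {x : 𝔼}
    (hx : closedBall x ((1 / 2) ^ j) ⊆ V) :
    gradV (molM volume u j) x = molM volume a j x + molM μ₀ (V.indicator b) j x := by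
  have e : molM μ₀ (V.indicator b) j x = molM μ₀ b j x := by
    refine integral_congr_ae (Eventually.of_forall fun y => ?_)
    by_cases hy : y ∈ ball x ((1 / 2) ^ j)
    · simp only [Set.indicator_of_mem (hx (ball_subset_closedBall hy))]
    · simp only [mol_sub_eq_zero hy, zero_smul]
  rw [e]
  ext k
  exact h.partialD_molM hu hx k

theorem hasDerivAt_mul_sin_div {ε : ℝ} (hε : ε ≠ 0) (t : ℝ) :
    HasDerivAt (fun t => ε * Real.sin (t / ε)) (Real.cos (t / ε)) t := by
  have := (((hasDerivAt_id t).div_const ε).sin).const_mul ε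
  rwa [mul_one_div, mul_div_cancel₀ _ hε] at this

end Correction

section Correction

variable {F : EuclideanSpace ℝ (Fin n) → ℝ} {Ω : Set (EuclideanSpace ℝ (Fin n))}
  {μ₀ : Measure (EuclideanSpace ℝ (Fin n))}
  {a b : EuclideanSpace ℝ (Fin n) → EuclideanSpace ℝ (Fin n)}

theorem HasGradient.exists_correction [IsFiniteMeasure μ₀] (h : HasGradient F Ω μ₀ a b)
    (hΩ : IsOpen Ω) (hμΩ : μ₀ Ωᶜ = 0) {K : Set 𝔼} (hK : IsCompact K) {δ ε : ℝ}
    (hδ : 0 < δ) (hε : 0 < ε)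
    (hKδ : ∫ x in (Ω ∩ approxDiscontSet n F) \ K, ‖b x‖ ∂μ₀ ≤ δ) :
    ∃ (w : 𝔼 → ℝ) (a' b' : 𝔼 → 𝔼), (∀ x, |w x| ≤ ε) ∧
      (∀ x ∈ K, ∃ r > 0, ∀ y ∈ ball x r, w y = 0) ∧
      HasGradient (fun x => F x + w x) Ω μ₀ a' b' ∧ (∀ x ∈ K, b' x = b x) ∧
      (∀ x, ‖b' x - b x‖ ≤ ‖b x‖) ∧ (∫ x in Kᶜ, ‖b' x‖ ∂μ₀) ≤ 5 * δ ∧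
      (∫ x, ‖a' x - a x‖) ≤ (∫ x in Kᶜ, ‖b x‖ ∂μ₀) + δ := by
  have hKm := hK.measurableSet
  have hb := h.integrable_sing
  have hU : IsOpen (Ω \ K) := hΩ.sdiff hK.isClosed
  obtain ⟨L, hLU, hL, hLδ⟩ := exists_isCompact_setIntegral_diff_le hb hU.measurableSet hδ
  obtain ⟨η, hη, hη0, hη1, hηL⟩ := exists_isTest_eq_one hL hU hLU
  have hT : IsCompact (tsupport η) := hη.hasCompactSupport
  obtain ⟨r, hr, hrU⟩ := hT.exists_cthickening_subset_open hU hη.tsupport_subset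
  set V := thickening r (tsupport η)
  have hV : IsOpen V := isOpen_thickening
  have hTV : tsupport η ⊆ V := self_subset_thickening hr _
  have hVc : V ⊆ cthickening r (tsupport η) := thickening_subset_cthickening _ _
  have hVU : V ⊆ Ω \ K := hVc.trans hrU
  have hFV : IntegrableOn F V :=
    (h.locallyIntegrableOn.integrableOn_compact_subset (hrU.trans Set.sdiff_subset)
      hT.cthickening).mono_set hVc
  set u := V.indicator F
  have hu : Integrable u := (integrable_indicator_iff hV.measurableSet).2 hFV
  have hg : HasGradient u V μ₀ a b :=
    (h.mono (hVU.trans Set.sdiff_subset)).indicator hV.measurableSet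
  have hηV : IsTest V η := ⟨hη.contDiff, hη.hasCompactSupport, hTV⟩
  have hηT : ∀ x ∉ tsupport η, η x = 0 := fun x hx => image_eq_zero_of_notMem_tsupport hx
  set Φ : ℝ → ℝ := fun t => ε * Real.sin (t / ε)
  set Φ' : ℝ → ℝ := fun t => Real.cos (t / ε)
  have hΦd : ∀ t, HasDerivAt Φ (Φ' t) t := hasDerivAt_mul_sin_div hε.ne'
  have hΦ'c : Continuous Φ' := Real.continuous_cos.comp (continuous_id.div_const ε)
  have hΦc : Continuous Φ := continuous_iff_continuousAt.2 fun t => (hΦd t).continuousAt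
  have hΦε : ∀ t, |Φ t| ≤ ε := fun t => by
    rw [abs_mul, abs_of_pos hε]
    exact mul_le_of_le_one_right hε.le (Real.abs_sin_le_one _)
  have hΦ1 : ∀ t, |Φ' t| ≤ 1 := fun t => Real.abs_cos_le_one _
  have hΦ0 : Φ 0 = 0 := by simp [Φ]
  have hΦ'0 : Φ' 0 = 1 := by simp [Φ']
  choose β hβb hβL hβg using fun j : ℕ =>
    hg.exists_chain hV hu hηV hη0 (molM_contDiff hu j) hΦd hΦ'c hΦε hΦ1
  have hβk : ∀ j x, ‖β j x‖ ≤ ‖b x‖ := fun j x => norm_le_of_forall_abs_le fun k =>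
    (hβb j x k).trans (mul_le_of_le_one_left (abs_nonneg _) (hη1 x))
  have hβm : ∀ j, AEStronglyMeasurable (β j) μ₀ := fun j => by
    have := (hβg j).integrable_sing.1.neg
    simpa [Pi.neg_def] using this
  have hβK : ∀ j, ∀ x ∈ K, β j x = 0 := fun j x hx => by
    have : η x = 0 := hηT x fun hx' => (hη.tsupport_subset hx').2 hx
    ext k
    have h1 := hβb j x k
    rw [this, zero_mul] at h1
    exact abs_nonpos_iff.1 h1
  -- the singular part
  set S := Ω ∩ approxDiscontSet n F
  have hS : MeasurableSet S := measurableSet_inter_approxDiscontSet hΩ h.locallyIntegrableOn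
  set N := L \ S
  have hN : MeasurableSet N := hL.measurableSet.diff hS
  have hNlim : ∀ x ∈ N, Tendsto (fun j => β j x) atTop (𝓝 (b x)) := by
    intro x hx
    have hxT : x ∈ tsupport η := subset_tsupport _ (by simp [hηL x hx.1])
    have hxS : x ∉ approxDiscontSet n u := by
      rw [← mem_approxDiscontSet_indicator_iff hV hFV (hTV hxT)]
      exact fun h' => hx.2 ⟨(hLU hx.1).1, h'⟩
    obtain ⟨c, hc⟩ := notMem_approxDiscontSet_iff.1 hxS
    have h1 : Tendsto (fun j => molM volume u j x - c) atTop (𝓝 0) := by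
      have := (hc.tendsto_molM hu).sub_const c
      rwa [sub_self] at this
    have h2 := (((hΦ'c.tendsto 0).comp h1).smul_const (b x))
    rw [hΦ'0, one_smul] at h2
    refine h2.congr fun j => ?_
    rw [hβL j x c hc, hηL x hx.1, one_mul]
    rfl
  have hsing := tendsto_setIntegral_norm_sub hN hb hβm hβk hNlim
  have hrest : ∀ j, (∫ x in Kᶜ, ‖b x - β j x‖ ∂μ₀) ≤
      (∫ x in N, ‖b x - β j x‖ ∂μ₀) + 4 * δ := by
    intro j
    have hi : Integrable (fun x => b x - β j x) μ₀ :=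
      hb.sub (hb.mono (hβm j) (Eventually.of_forall (hβk j)))
    set B := ((Ω \ K) \ L) ∪ (S \ K)
    have hB : MeasurableSet B := (hU.measurableSet.diff hL.measurableSet).union (hS.diff hKm)
    have h1 : (∫ x in Kᶜ, ‖b x - β j x‖ ∂μ₀) ≤ ∫ x in N ∪ B, ‖b x - β j x‖ ∂μ₀ := by
      refine setIntegral_mono_set hi.norm.integrableOn
        (Eventually.of_forall fun _ => norm_nonneg _) ?_
      have : ∀ᵐ x ∂μ₀, x ∈ Ω := by
        rw [ae_iff]
        exact hμΩ
      filter_upwards [this] with x hx hxK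
      by_cases hxL : x ∈ L
      · by_cases hxS : x ∈ S
        · exact Or.inr (Or.inr ⟨hxS, hxK⟩)
        · exact Or.inl ⟨hxL, hxS⟩
      · exact Or.inr (Or.inl ⟨⟨hx, hxK⟩, hxL⟩)
    have h2 := setIntegral_norm_union_le hi hN hB
    have h3 : (∫ x in B, ‖b x - β j x‖ ∂μ₀) ≤ ∫ x in B, 2 * ‖b x‖ ∂μ₀ :=
      integral_mono hi.norm.integrableOn (hb.norm.const_mul 2).integrableOn fun x => by
        change ‖b x - β j x‖ ≤ 2 * ‖b x‖
        rw [two_mul]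
        exact (norm_sub_le _ _).trans (add_le_add le_rfl (hβk j x))
    rw [integral_const_mul] at h3
    have h4 := setIntegral_norm_union_le hb (hU.measurableSet.diff hL.measurableSet) (hS.diff hKm)
    change (∫ x in B, ‖b x‖ ∂μ₀) ≤ _ at h4
    linarith
  -- the absolutely continuous part
  have hη' : Integrable (gradV η) :=
    integrable_of_eq_zero_of_continuous (gradV_continuous hη.contDiff) hT fun x hx =>
      gradV_eq_zero hx
  have ha := h.integrable_ac
  have hbV : Integrable (V.indicator b) μ₀ := hb.indicator hV.measurableSet
  have hac1 := tendsto_integral_comp_molM_sub hu hΦc hΦ0 hΦε hη'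
  have hac2 := tendsto_integral_norm_molM_sub ha
  have hac3 : ∀ j, (∫ x, ‖molM μ₀ (V.indicator b) j x‖) ≤ ∫ x in Kᶜ, ‖b x‖ ∂μ₀ := fun j => by
    refine (integral_norm_molM_le hbV j).trans ?_
    simp_rw [norm_indicator_eq_indicator_norm]
    rw [integral_indicator hV.measurableSet]
    exact setIntegral_mono_set hb.norm.integrableOn (Eventually.of_forall fun _ => norm_nonneg _)
      (Eventually.of_forall fun x hx => (hVU hx).2)
  have hev := eventually_forall_closedBall_subset hV hT hTV
  have hlim : Tendsto (fun j => (∫ x, ‖Φ (molM volume u j x - u x) • gradV η x‖) +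
      ∫ x, ‖molM volume a j x - a x‖) atTop (𝓝 0) := by
    have := hac1.add hac2
    rwa [add_zero] at this
  obtain ⟨j, hj1, hj2, hj3⟩ := ((hsing.eventually_lt_const hδ).and
    ((hlim.eventually_lt_const hδ).and hev)).exists
  have hw := (hβg j).mono (Set.subset_univ Ω)
  have hsum := h.add hw
  refine ⟨_, _, _, fun x => ?_, fun x hx => ?_, hsum, fun x hx => ?_, fun x => ?_, ?_, ?_⟩
  · rw [abs_mul, abs_of_nonneg (hη0 x)]
    exact (mul_le_of_le_one_left (abs_nonneg _) (hη1 x)).trans (hΦε _)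
  · have : (tsupport η)ᶜ ∈ 𝓝 x := (isClosed_tsupport η).isOpen_compl.mem_nhds
      fun hx' => (hη.tsupport_subset hx').2 hx
    obtain ⟨ρ, hρ, hρs⟩ := Metric.mem_nhds_iff.1 this
    exact ⟨ρ, hρ, fun y hy => by rw [hηT y (hρs hy), zero_mul]⟩
  · simp [hβK j x hx]
  · simpa using hβk j x
  · simp only [← sub_eq_add_neg]
    linarith [hrest j]
  · simp only [add_sub_cancel_left]
    have i1 : Integrable fun x => ‖Φ (molM volume u j x - u x) • gradV η x‖ :=
      (hη'.bdd_smul ε (hΦc.comp_aestronglyMeasurable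
      ((molM_continuous hu j).aestronglyMeasurable.sub hu.1))
        (Eventually.of_forall fun x => hΦε _)).norm
    have i2 : Integrable fun x => ‖molM volume a j x - a x‖ := ((integrable_molM ha j).sub ha).norm
    have i3 : Integrable fun x => ‖molM μ₀ (V.indicator b) j x‖ := (integrable_molM hbV j).norm
    have e := integral_add (i1.add i2) i3
    have e' := integral_add i1 i2
    simp only [Pi.add_apply] at e e'
    have hle := integral_mono hw.integrable_ac.norm ((i1.add i2).add i3) fun x => by
      by_cases hx : x ∈ tsupport η
      · simp only [Pi.add_apply]
        rw [hg.gradV_molM hu (hj3 x hx), add_assoc]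
        refine (norm_add_le _ _).trans (add_le_add le_rfl ?_)
        rw [norm_smul, Real.norm_eq_abs, abs_mul, abs_of_nonneg (hη0 x)]
        refine (mul_le_of_le_one_left (norm_nonneg _)
          (mul_le_one₀ (hη1 x) (abs_nonneg _) (hΦ1 _))).trans ?_
        rw [add_sub_right_comm]
        exact norm_add_le _ _
      · simp only [Pi.add_apply, gradV_eq_zero hx, hηT x hx, zero_mul, zero_smul, smul_zero,
          add_zero, norm_zero, zero_add]
        positivity
    simp only [Pi.add_apply] at hle
    linarith [hac3 j]

end Correction

section Limits

variable {Ω : Set (EuclideanSpace ℝ (Fin n))} {μ₀ : Measure (EuclideanSpace ℝ (Fin n))}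

theorem exists_seq_of_step {α : Type*} {P : ℕ → α → Prop} {R : ℕ → α → α → Prop} {x₀ : α}
    (h₀ : P 0 x₀) (h : ∀ k x, P k x → ∃ y, P (k + 1) y ∧ R k x y) :
    ∃ s : ℕ → α, s 0 = x₀ ∧ ∀ k, P k (s k) ∧ R k (s k) (s (k + 1)) := by
  choose! g hgP hgR using h
  set s : ℕ → α := fun k => Nat.rec x₀ g k
  have hs : ∀ k, P k (s k) := fun k => by
    induction k with
    | zero => exact h₀
    | succ k ih => exact hgP k _ ih
  exact ⟨s, rfl, fun k => ⟨hs k, hgR k _ (hs k)⟩⟩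

theorem exists_integrable_limit {g : ℕ → 𝔼 → 𝔼} (hg : ∀ k, Integrable (g k) μ₀) {C : ℝ}
    (h : ∀ k, (∫ x, ‖g (k + 1) x - g k x‖ ∂μ₀) ≤ C / 2 / 2 ^ k) :
    ∃ g', Integrable g' μ₀ ∧ ∀ k, (∫ x, ‖g k x - g' x‖ ∂μ₀) ≤ C / 2 ^ k := by
  have e : ∀ k, dist ((hg k).toL1) ((hg (k + 1)).toL1) ≤ C / 2 / 2 ^ k := fun k => by
    rw [dist_comm, dist_eq_norm, ← Integrable.toL1_sub, L1.norm_of_fun_eq_integral_norm]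
    exact h k
  obtain ⟨G, hG⟩ := cauchySeq_tendsto_of_complete (cauchySeq_of_le_geometric_two e)
  refine ⟨G, L1.integrable_coeFn G, fun k => ?_⟩
  have h1 := dist_le_of_le_geometric_two_of_tendsto e hG k
  rw [← Integrable.toL1_coeFn G (L1.integrable_coeFn G), dist_eq_norm, ← Integrable.toL1_sub,
    L1.norm_of_fun_eq_integral_norm] at h1
  exact h1

theorem locallyIntegrableOn_of_abs_sub_le {F F' : 𝔼 → ℝ} (hΩ : IsOpen Ω)
    (hF : LocallyIntegrableOn F Ω) (hm : AEStronglyMeasurable F' (volume.restrict Ω)) {C : ℝ}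
    (h : ∀ x, |F' x - F x| ≤ C) : LocallyIntegrableOn F' Ω := by
  intro x hx
  obtain ⟨r, hr, hrΩ, hi⟩ := LocallyIntegrableOn.exists_ball_integrableOn hΩ hF hx
  refine ⟨ball x r, mem_nhdsWithin_of_mem_nhds (ball_mem_nhds x hr), ?_⟩
  refine Integrable.mono' (g := fun y => ‖F y‖ + C)
    (hi.norm.add (integrableOn_const measure_ball_lt_top.ne))
    (hm.mono_measure (Measure.restrict_mono hrΩ le_rfl)) (Eventually.of_forall fun y => ?_)
  have h1 := norm_add_le (F y) (F' y - F y)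
  rw [add_sub_cancel] at h1
  exact h1.trans (add_le_add le_rfl (h y))

theorem tendsto_of_abs_sub_le_mul {x : ℕ → ℝ} {y M : ℝ} {c : ℕ → ℝ}
    (h : ∀ k, |x k - y| ≤ M * c k) (hc : Tendsto c atTop (𝓝 0)) : Tendsto x atTop (𝓝 y) := by
  rw [tendsto_iff_dist_tendsto_zero]
  have := hc.const_mul M
  rw [mul_zero] at this
  exact squeeze_zero (fun _ => dist_nonneg) h this

theorem IsTest.tendsto_integral_mul {φ : 𝔼 → ℝ} (hφ : IsTest Ω φ) {m : Measure 𝔼}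
    {g : ℕ → 𝔼 → 𝔼} {g' : 𝔼 → 𝔼} (hg : ∀ k, Integrable (g k) m) (hg' : Integrable g' m)
    {c : ℕ → ℝ} (h : ∀ k, (∫ x, ‖g k x - g' x‖ ∂m) ≤ c k) (hc : Tendsto c atTop (𝓝 0))
    (i : Fin n) :
    Tendsto (fun k => ∫ x, φ x * g k x i ∂m) atTop (𝓝 (∫ x, φ x * g' x i ∂m)) := by
  obtain ⟨M, hM0, hM⟩ := hφ.exists_bound
  have e : ∀ {g : 𝔼 → 𝔼}, Integrable g m → Integrable (fun x => φ x * g x i) m :=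
    fun hg => hφ.integrable_mul ((EuclideanSpace.proj i : 𝔼 →L[ℝ] ℝ).integrable_comp hg)
  refine tendsto_of_abs_sub_le_mul (M := M) (fun k => ?_) hc
  rw [← integral_sub (e (hg k)) (e hg'), ← Real.norm_eq_abs]
  refine (norm_integral_le_of_norm_le (((hg k).sub hg').norm.const_mul M)
    (Eventually.of_forall fun x => ?_)).trans ?_
  · rw [← mul_sub, norm_mul]
    exact mul_le_mul (hM x) (PiLp.norm_apply_le (g k x - g' x) i) (norm_nonneg _) hM0
  · rw [integral_const_mul]
    exact mul_le_mul_of_nonneg_left (h k) hM0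

theorem HasGradient.of_limit {F : ℕ → 𝔼 → ℝ} {F' : 𝔼 → ℝ} {a b : ℕ → 𝔼 → 𝔼} {a' b' : 𝔼 → 𝔼}
    {c : ℕ → ℝ} (h : ∀ k, HasGradient (F k) Ω μ₀ (a k) (b k)) (hF' : LocallyIntegrableOn F' Ω)
    (ha' : Integrable a') (hb' : Integrable b' μ₀) (hF : ∀ k x, |F k x - F' x| ≤ c k)
    (ha : ∀ k, (∫ x, ‖a k x - a' x‖) ≤ c k) (hb : ∀ k, (∫ x, ‖b k x - b' x‖ ∂μ₀) ≤ c k)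
    (hc : Tendsto c atTop (𝓝 0)) : HasGradient F' Ω μ₀ a' b' := by
  refine ⟨hF', ha', hb', fun φ hφ i => ?_⟩
  have hD : Integrable (partialD i φ) :=
    (hφ.partialD_continuous i).integrable_of_hasCompactSupport (hφ.partialD_hasCompactSupport i)
  have h1 : Tendsto (fun k => ∫ x, F k x * partialD i φ x) atTop
      (𝓝 (∫ x, F' x * partialD i φ x)) := by
    refine tendsto_of_abs_sub_le_mul (M := ∫ x, |partialD i φ x|) (fun k => ?_) hc
    rw [← integral_sub (LocallyIntegrableOn.integrable_mul_partialD (h k).locallyIntegrableOn hφ i)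
      (LocallyIntegrableOn.integrable_mul_partialD hF' hφ i), ← Real.norm_eq_abs]
    refine (norm_integral_le_of_norm_le (hD.norm.mul_const (c k))
      (Eventually.of_forall fun x => ?_)).trans ?_
    · rw [← sub_mul, norm_mul, mul_comm]
      exact mul_le_mul_of_nonneg_left (hF k x) (norm_nonneg _)
    · rw [integral_mul_const]
      rfl
  have h2 := ((hφ.tendsto_integral_mul (fun k => (h k).integrable_ac) ha' ha hc i).add
    (hφ.tendsto_integral_mul (fun k => (h k).integrable_sing) hb' hb hc i)).neg
  refine tendsto_nhds_unique h1 (h2.congr fun k => ?_)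
  exact ((h k).integral_eq φ hφ i).symm

end Limits

section Iteration

variable {Ω : Set (EuclideanSpace ℝ (Fin n))} {μ₀ : Measure (EuclideanSpace ℝ (Fin n))}

/-- A function together with the densities of its gradient and a compact subset of its approximate
discontinuity set. -/
structure Stage (n : ℕ) where
  toFun : EuclideanSpace ℝ (Fin n) → ℝ
  ac : EuclideanSpace ℝ (Fin n) → EuclideanSpace ℝ (Fin n)
  sing : EuclideanSpace ℝ (Fin n) → EuclideanSpace ℝ (Fin n)
  core : Set (EuclideanSpace ℝ (Fin n))

/-- The gradient of `s` has mass at most `δ` on the part of the approximate discontinuity set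
outside of the compact set `s.core`. -/
structure Stage.Valid (s : Stage n) (Ω : Set (EuclideanSpace ℝ (Fin n)))
    (μ₀ : Measure (EuclideanSpace ℝ (Fin n))) (δ : ℝ) : Prop where
  hasGradient : HasGradient s.toFun Ω μ₀ s.ac s.sing
  isCompact : IsCompact s.core
  core_subset : s.core ⊆ Ω ∩ approxDiscontSet n s.toFun
  integral_le : (∫ x in (Ω ∩ approxDiscontSet n s.toFun) \ s.core, ‖s.sing x‖ ∂μ₀) ≤ δ

/-- `t` improves `s`: away from `s.core` the singular part of the gradient has been made small. -/
structure Stage.Step (s t : Stage n) (μ₀ : Measure (EuclideanSpace ℝ (Fin n))) (δ : ℝ) : Prop where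
  core_subset : s.core ⊆ t.core
  abs_sub_le : ∀ x, |t.toFun x - s.toFun x| ≤ δ
  eq_near_core : ∀ x ∈ s.core, ∃ r > 0, ∀ y ∈ ball x r, t.toFun y = s.toFun y
  sing_eq : ∀ x ∈ s.core, t.sing x = s.sing x
  norm_sing_sub_le : ∀ x, ‖t.sing x - s.sing x‖ ≤ ‖s.sing x‖
  integral_sing_le : (∫ x in s.coreᶜ, ‖t.sing x‖ ∂μ₀) ≤ 5 * δ
  integral_ac_sub_le : (∫ x, ‖t.ac x - s.ac x‖) ≤ (∫ x in s.coreᶜ, ‖s.sing x‖ ∂μ₀) + δ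

theorem CloseAt.mem_approxDiscontSet {f g : 𝔼 → ℝ} {x : 𝔼} (h : CloseAt f g x) (hΩ : IsOpen Ω)
    (hx : x ∈ Ω) (hf : LocallyIntegrableOn f Ω) (hg : LocallyIntegrableOn g Ω) :
    (x ∈ approxDiscontSet n f → x ∈ approxDiscontSet n g) ∧
      (x ∈ jumpSet n f → x ∈ jumpSet n g) := by
  obtain ⟨r, hr, -, hfr⟩ := LocallyIntegrableOn.exists_ball_integrableOn hΩ hf hx
  obtain ⟨s, hs, -, hgs⟩ := LocallyIntegrableOn.exists_ball_integrableOn hΩ hg hx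
  have hm : 0 < min r s := lt_min hr hs
  have h1 := hfr.mono_set (ball_subset_ball (min_le_left r s))
  have h2 := hgs.mono_set (ball_subset_ball (min_le_right r s))
  exact ⟨(h.mem_approxDiscontSet_iff hm h1 h2).1, h.mem_jumpSet hm h1 h2⟩

theorem Stage.Valid.exists_step [IsFiniteMeasure μ₀] (hΩ : IsOpen Ω) (hμΩ : μ₀ Ωᶜ = 0)
    {s : Stage n} {δ δ' : ℝ} (h : s.Valid Ω μ₀ δ) (hδ : 0 < δ) (hδ' : 0 < δ') :
    ∃ t : Stage n, t.Valid Ω μ₀ δ' ∧ s.Step t μ₀ δ := by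
  obtain ⟨w, a', b', hw, hwK, hg, hbK, hbb, hb5, haa⟩ :=
    h.hasGradient.exists_correction hΩ hμΩ h.isCompact hδ hδ h.integral_le
  set F' : 𝔼 → ℝ := fun x => s.toFun x + w x
  have hS := measurableSet_inter_approxDiscontSet hΩ hg.locallyIntegrableOn
  obtain ⟨L, hLS, hL, hLδ⟩ := exists_isCompact_setIntegral_diff_le hg.integrable_sing hS hδ'
  refine ⟨⟨F', a', b', s.core ∪ L⟩, ⟨hg, h.isCompact.union hL, Set.union_subset (fun x hx => ?_) hLS,
    (setIntegral_mono_set hg.integrable_sing.norm.integrableOn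
      (Eventually.of_forall fun _ => norm_nonneg _) (Eventually.of_forall fun x hx =>
        ⟨hx.1, fun h' => hx.2 (Or.inr h')⟩)).trans hLδ⟩,
    ⟨Set.subset_union_left, fun x => ?_, fun x hx => ?_, hbK, hbb, hb5, haa⟩⟩
  · obtain ⟨r, hr, hy⟩ := hwK x hx
    have hc : CloseAt s.toFun F' x := fun η hη => ⟨r, hr, fun y hyr => by
      simp only [F', hy y hyr, add_zero, sub_self, abs_zero]
      exact hη.le⟩
    have hxS := h.core_subset hx
    exact ⟨hxS.1, (hc.mem_approxDiscontSet hΩ hxS.1 h.hasGradient.locallyIntegrableOn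
      hg.locallyIntegrableOn).1 hxS.2⟩
  · simpa [F'] using hw x
  · obtain ⟨r, hr, hy⟩ := hwK x hx
    exact ⟨r, hr, fun y hyr => by simp only [F', hy y hyr, add_zero]⟩

theorem HasGradient.exists_stages [IsFiniteMeasure μ₀] {f : 𝔼 → ℝ} {a b : 𝔼 → 𝔼}
    (h : HasGradient f Ω μ₀ a b) (hΩ : IsOpen Ω) (hμΩ : μ₀ Ωᶜ = 0) {δ : ℝ} (hδ : 0 < δ) :
    ∃ s : ℕ → Stage n, (s 0).toFun = f ∧ (s 0).ac = a ∧ (s 0).sing = b ∧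
      ∀ k, (s k).Valid Ω μ₀ (δ / 2 ^ k) ∧ (s k).Step (s (k + 1)) μ₀ (δ / 2 ^ k) := by
  have hS := measurableSet_inter_approxDiscontSet hΩ h.locallyIntegrableOn
  obtain ⟨L, hLS, hL, hLδ⟩ := exists_isCompact_setIntegral_diff_le h.integrable_sing hS hδ
  obtain ⟨s, hs0, hs⟩ := exists_seq_of_step (P := fun k (s : Stage n) => s.Valid Ω μ₀ (δ / 2 ^ k))
    (R := fun k s t => s.Step t μ₀ (δ / 2 ^ k)) (x₀ := ⟨f, a, b, L⟩)
    ⟨h, hL, hLS, by simpa using hLδ⟩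
    fun k s hs => hs.exists_step hΩ hμΩ (by positivity) (by positivity)
  exact ⟨s, by rw [hs0], by rw [hs0], by rw [hs0], hs⟩

variable {s : ℕ → Stage n} {δ : ℝ}

theorem core_mono (hs : ∀ k, (s k).Step (s (k + 1)) μ₀ (δ / 2 ^ k)) :
    Monotone fun k => (s k).core :=
  monotone_nat_of_le_succ fun k => (hs k).core_subset

theorem eq_near_core_of_le (hs : ∀ k, (s k).Step (s (k + 1)) μ₀ (δ / 2 ^ k)) {k m : ℕ}
    (hkm : k ≤ m) {x : 𝔼} (hx : x ∈ (s k).core) :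
    ∃ r > 0, ∀ y ∈ ball x r, (s m).toFun y = (s k).toFun y := by
  induction m, hkm using Nat.le_induction with
  | base => exact ⟨1, one_pos, fun _ _ => rfl⟩
  | succ m hkm ih =>
    obtain ⟨r, hr, h1⟩ := ih
    obtain ⟨r', hr', h2⟩ := (hs m).eq_near_core x (core_mono hs hkm hx)
    refine ⟨min r r', lt_min hr hr', fun y hy => ?_⟩
    rw [h2 y (ball_subset_ball (min_le_right _ _) hy), h1 y (ball_subset_ball (min_le_left _ _) hy)]

theorem exists_uniform_limit (hs : ∀ k, (s k).Step (s (k + 1)) μ₀ (δ / 2 ^ k)) :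
    ∃ G : 𝔼 → ℝ, ∀ k x, |(s k).toFun x - G x| ≤ 2 * δ / 2 ^ k := by
  have e : ∀ x k, dist ((s k).toFun x) ((s (k + 1)).toFun x) ≤ 2 * δ / 2 / 2 ^ k := fun x k => by
    rw [mul_div_cancel_left₀ _ two_ne_zero, dist_comm]
    exact (hs k).abs_sub_le x
  choose G hG using fun x => cauchySeq_tendsto_of_complete (cauchySeq_of_le_geometric_two (e x))
  exact ⟨G, fun k x => dist_le_of_le_geometric_two_of_tendsto (e x) (hG x) k⟩

theorem tendsto_div_two_pow (C : ℝ) : Tendsto (fun k : ℕ => C / 2 ^ k) atTop (𝓝 0) := by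
  have := (tendsto_pow_atTop_nhds_zero_of_lt_one (r := (1 / 2 : ℝ)) (by norm_num)
        (by norm_num)).const_mul C
  rw [mul_zero] at this
  refine this.congr fun k => ?_
  rw [one_div, inv_pow, div_eq_mul_inv]

theorem closeAt_limit (hs : ∀ k, (s k).Step (s (k + 1)) μ₀ (δ / 2 ^ k)) {G : 𝔼 → ℝ}
    (hG : ∀ k x, |(s k).toFun x - G x| ≤ 2 * δ / 2 ^ k) {k : ℕ} {x : 𝔼} (hx : x ∈ (s k).core) :
    CloseAt (s k).toFun G x := by
  intro η hη
  obtain ⟨m, hm, hkm⟩ := (((tendsto_div_two_pow (2 * δ)).eventually_lt_const hη).and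
    (eventually_ge_atTop k)).exists
  obtain ⟨r, hr, h⟩ := eq_near_core_of_le hs hkm hx
  refine ⟨r, hr, fun y hy => ?_⟩
  rw [← h y hy, abs_sub_comm]
  exact (hG m y).trans hm.le

theorem integral_compl_core_succ_le (hs : ∀ k, (s k).Step (s (k + 1)) μ₀ (δ / 2 ^ k))
    (hi : ∀ k, Integrable (s k).sing μ₀) (k : ℕ) :
    (∫ x in (s (k + 1)).coreᶜ, ‖(s (k + 1)).sing x‖ ∂μ₀) ≤ 5 * δ / 2 ^ k := by
  rw [mul_div_assoc]
  exact (setIntegral_mono_set (hi _).norm.integrableOn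
    (Eventually.of_forall fun _ => norm_nonneg _)
    (Eventually.of_forall (Set.compl_subset_compl.2 (hs k).core_subset))).trans
    (hs k).integral_sing_le

theorem Stage.Step.integral_sing_sub_le {s t : Stage n} {δ : ℝ} (h : s.Step t μ₀ δ)
    (hK : MeasurableSet s.core) (hs : Integrable s.sing μ₀) (ht : Integrable t.sing μ₀) :
    (∫ x, ‖t.sing x - s.sing x‖ ∂μ₀) ≤ ∫ x in s.coreᶜ, ‖s.sing x‖ ∂μ₀ := by
  rw [← integral_indicator hK.compl]
  refine integral_mono (ht.sub hs).norm (hs.norm.indicator hK.compl) fun x => ?_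
  by_cases hx : x ∈ s.core
  · simp [h.sing_eq x hx, hx]
  · rw [Set.indicator_of_mem (Set.mem_compl hx)]
    exact h.norm_sing_sub_le x

end Iteration

section Approximation

variable {Ω : Set (EuclideanSpace ℝ (Fin n))} {μ₀ : Measure (EuclideanSpace ℝ (Fin n))}

theorem ofReal_setIntegral_norm {m : Measure 𝔼} {g : 𝔼 → 𝔼} (hg : Integrable g m) (A : Set 𝔼) :
    ENNReal.ofReal (∫ x in A, ‖g x‖ ∂m) = ∫⁻ x in A, ‖g x‖ₑ ∂m :=
  ofReal_integral_norm_eq_lintegral_enorm hg.integrableOn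

theorem setLIntegral_enorm_le_add {m : Measure 𝔼} {g g' : 𝔼 → 𝔼} (hg : Integrable g m)
    (hg' : Integrable g' m) (A : Set 𝔼) {C : ℝ} (hC : (∫ x, ‖g x - g' x‖ ∂m) ≤ C) :
    ∫⁻ x in A, ‖g' x‖ₑ ∂m ≤ (∫⁻ x in A, ‖g x‖ₑ ∂m) + ENNReal.ofReal C := by
  have h1 : ∫⁻ x in A, ‖g x - g' x‖ₑ ∂m ≤ ENNReal.ofReal C := by
    refine le_trans ?_ (ENNReal.ofReal_le_ofReal hC)
    refine (setLIntegral_le_lintegral _ _).trans_eq ?_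
    exact (ofReal_integral_norm_eq_lintegral_enorm (hg.sub hg')).symm
  refine le_trans ?_ (add_le_add le_rfl h1)
  rw [← lintegral_add_left' hg.1.enorm.restrict]
  refine lintegral_mono fun x => ?_
  have := enorm_sub_le (a := g x) (b := g x - g' x)
  rwa [sub_sub_cancel] at this

/-- A function whose gradient is a measure is a uniform limit of functions whose gradients have no
Cantor part, with control of the absolutely continuous and jump parts. -/
theorem HasGradient.exists_approx [IsFiniteMeasure μ₀] {f : 𝔼 → ℝ} {a b : 𝔼 → 𝔼}
    (h : HasGradient f Ω μ₀ a b) (hΩ : IsOpen Ω) (hμΩ : μ₀ Ωᶜ = 0) {δ : ℝ} (hδ : 0 < δ) :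
    ∃ (G : 𝔼 → ℝ) (a' b' : 𝔼 → 𝔼), (∀ x, |f x - G x| ≤ 2 * δ) ∧ HasGradient G Ω μ₀ a' b' ∧
      ∫⁻ x in Ω \ approxDiscontSet n G, ‖b' x‖ₑ ∂μ₀ = 0 ∧
      ∫⁻ x in Ω, ‖a' x‖ₑ ≤ (∫⁻ x in Ω, ‖a x‖ₑ) +
        (∫⁻ x in Ω \ approxDiscontSet n f, ‖b x‖ₑ ∂μ₀) + ENNReal.ofReal (15 * δ) ∧
      ∫⁻ x in jumpSet n G ∩ Ω, ‖b' x‖ₑ ∂μ₀ ≤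
        (∫⁻ x in jumpSet n f ∩ Ω, ‖b x‖ₑ ∂μ₀) + ENNReal.ofReal (15 * δ) := by
  obtain ⟨s, rfl, rfl, rfl, hs⟩ := h.exists_stages hΩ hμΩ hδ
  have hV := fun k => (hs k).1
  have hR := fun k => (hs k).2
  have hg := fun k => (hV k).hasGradient
  have hia := fun k => (hg k).integrable_ac
  have hib := fun k => (hg k).integrable_sing
  have hKm := fun k => (hV k).isCompact.measurableSet
  obtain ⟨G, hG⟩ := exists_uniform_limit hR
  have hb := integral_compl_core_succ_le hR hib
  obtain ⟨b', hb', hbb⟩ := exists_integrable_limit (fun k => hib (k + 1)) (C := 10 * δ) fun k => by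
    refine ((hR (k + 1)).integral_sing_sub_le (hKm _) (hib _) (hib _)).trans ((hb k).trans_eq ?_)
    ring
  obtain ⟨a', ha', haa⟩ := exists_integrable_limit (fun k => hia (k + 1)) (C := 11 * δ) fun k => by
    refine (hR (k + 1)).integral_ac_sub_le.trans ?_
    refine (add_le_add (hb k) le_rfl).trans_eq ?_
    rw [pow_succ]
    field_simp
    norm_num
  have hGl : LocallyIntegrableOn G Ω := by
    refine locallyIntegrableOn_of_abs_sub_le hΩ (hg 0).locallyIntegrableOn
      (aestronglyMeasurable_of_tendsto_ae atTop
        (fun k => LocallyIntegrableOn.aestronglyMeasurable (hg k).locallyIntegrableOn)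
        (Eventually.of_forall fun x => ?_)) (C := 2 * δ / 2 ^ 0) fun x => ?_
    · refine tendsto_of_abs_sub_le_mul (M := 1) (fun k => ?_) (tendsto_div_two_pow (2 * δ))
      rw [one_mul]
      exact hG k x
    · rw [abs_sub_comm]
      exact hG 0 x
  have hGg : HasGradient G Ω μ₀ a' b' := by
    refine HasGradient.of_limit (c := fun k => 11 * δ / 2 ^ k) (fun k => hg (k + 1)) hGl ha' hb'
      (fun k x => (hG (k + 1) x).trans ?_) haa (fun k => (hbb k).trans ?_) (tendsto_div_two_pow _)
    · rw [pow_succ, div_le_div_iff₀ (by positivity) (by positivity)]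
      have : 0 < δ * 2 ^ k := by positivity
      linarith
    · gcongr
      norm_num
  have hclose : ∀ {k : ℕ} {x : 𝔼}, x ∈ (s k).core → CloseAt (s k).toFun G x :=
    fun hx => closeAt_limit hR hG hx
  have hcS : ∀ k, (s k).core ⊆ approxDiscontSet n G := fun k x hx =>
    ((hclose hx).mem_approxDiscontSet hΩ ((hV k).core_subset hx).1 (hg k).locallyIntegrableOn hGl).1
      ((hV k).core_subset hx).2
  refine ⟨G, a', b', fun x => ?_, hGg, ?_, ?_, ?_⟩
  · simpa using hG 0 x
  · have h1 : ∀ k : ℕ, ∫⁻ x in Ω \ approxDiscontSet n G, ‖b' x‖ₑ ∂μ₀ ≤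
        ENNReal.ofReal (15 * δ / 2 ^ k) := fun k => by
      calc ∫⁻ x in Ω \ approxDiscontSet n G, ‖b' x‖ₑ ∂μ₀
          ≤ ∫⁻ x in (s (k + 1)).coreᶜ, ‖b' x‖ₑ ∂μ₀ :=
            lintegral_mono_set fun x hx hx' => hx.2 (hcS _ hx')
        _ ≤ (∫⁻ x in (s (k + 1)).coreᶜ, ‖(s (k + 1)).sing x‖ₑ ∂μ₀) +
            ENNReal.ofReal (10 * δ / 2 ^ k) := setLIntegral_enorm_le_add (hib _) hb' _ (hbb k)
        _ ≤ ENNReal.ofReal (5 * δ / 2 ^ k) + ENNReal.ofReal (10 * δ / 2 ^ k) := by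
            rw [← ofReal_setIntegral_norm (hib _)]
            exact add_le_add (ENNReal.ofReal_le_ofReal (hb k)) le_rfl
        _ = ENNReal.ofReal (15 * δ / 2 ^ k) := by
            rw [← ENNReal.ofReal_add (by positivity) (by positivity)]
            congr 1
            ring
    have h2 := ENNReal.tendsto_ofReal (tendsto_div_two_pow (15 * δ))
    rw [ENNReal.ofReal_zero] at h2
    exact le_antisymm (ge_of_tendsto' h2 h1) zero_le
  · set C := ∫ x in (s 0).coreᶜ, ‖(s 0).sing x‖ ∂μ₀
    have hC0 : 0 ≤ C := integral_nonneg fun _ => norm_nonneg _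
    have hC : ENNReal.ofReal C ≤
        (∫⁻ x in Ω \ approxDiscontSet n (s 0).toFun, ‖(s 0).sing x‖ₑ ∂μ₀) + ENNReal.ofReal δ := by
      rw [ofReal_setIntegral_norm (hib 0)]
      have h1 : (s 0).coreᶜ ⊆ ((Ω \ approxDiscontSet n (s 0).toFun) ∪
          ((Ω ∩ approxDiscontSet n (s 0).toFun) \ (s 0).core)) ∪ Ωᶜ := fun x hx => by
        by_cases hxΩ : x ∈ Ω
        · by_cases hxS : x ∈ approxDiscontSet n (s 0).toFun
          · exact Or.inl (Or.inr ⟨⟨hxΩ, hxS⟩, hx⟩)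
          · exact Or.inl (Or.inl ⟨hxΩ, hxS⟩)
        · exact Or.inr hxΩ
      have h2 : ∫⁻ x in Ωᶜ, ‖(s 0).sing x‖ₑ ∂μ₀ = 0 := setLIntegral_measure_zero _ _ hμΩ
      have h3 := ENNReal.ofReal_le_ofReal (hV 0).integral_le
      rw [ofReal_setIntegral_norm (hib 0), pow_zero, div_one] at h3
      refine (lintegral_mono_set h1).trans ((lintegral_union_le _ _ _).trans ?_)
      rw [h2, add_zero]
      exact (lintegral_union_le _ _ _).trans (add_le_add le_rfl h3)
    have h1 := setLIntegral_enorm_le_add (hia 1) ha' Ω (haa 0)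
    have h2 : ∫⁻ x in Ω, ‖(s 1).ac x‖ₑ ≤ (∫⁻ x in Ω, ‖(s 0).ac x‖ₑ) +
        ENNReal.ofReal (C + δ / 2 ^ 0) := by
      refine setLIntegral_enorm_le_add (hia 0) (hia 1) Ω ?_
      simp_rw [norm_sub_rev ((s 0).ac _)]
      exact (hR 0).integral_ac_sub_le
    rw [ENNReal.ofReal_add hC0 (by positivity)] at h2
    calc ∫⁻ x in Ω, ‖a' x‖ₑ ≤ (∫⁻ x in Ω, ‖(s 0).ac x‖ₑ) +
          (((∫⁻ x in Ω \ approxDiscontSet n (s 0).toFun, ‖(s 0).sing x‖ₑ ∂μ₀) + ENNReal.ofReal δ) +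
            ENNReal.ofReal (δ / 2 ^ 0)) + ENNReal.ofReal (11 * δ / 2 ^ 0) := by
          refine h1.trans (add_le_add (h2.trans ?_) le_rfl)
          gcongr
      _ = (∫⁻ x in Ω, ‖(s 0).ac x‖ₑ) +
          (∫⁻ x in Ω \ approxDiscontSet n (s 0).toFun, ‖(s 0).sing x‖ₑ ∂μ₀) +
            ENNReal.ofReal (13 * δ) := by
          have : ENNReal.ofReal (13 * δ) = ENNReal.ofReal δ + ENNReal.ofReal (δ / 2 ^ 0) +
              ENNReal.ofReal (11 * δ / 2 ^ 0) := by
            rw [← ENNReal.ofReal_add (by positivity) (by positivity),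
              ← ENNReal.ofReal_add (by positivity) (by positivity)]
            congr 1
            ring
          rw [this]
          ring
      _ ≤ _ := by
          gcongr
          norm_num
  · have hJ : jumpSet n G ∩ (s 0).core ⊆ jumpSet n (s 0).toFun ∩ Ω := fun x hx => by
      have hxΩ := ((hV 0).core_subset hx.2).1
      exact ⟨((hclose hx.2).symm.mem_approxDiscontSet hΩ hxΩ hGl (hg 0).locallyIntegrableOn).2 hx.1,
        hxΩ⟩
    have h1 : ∫⁻ x in (s 0).core ∩ jumpSet n G, ‖(s 1).sing x‖ₑ ∂μ₀ ≤
        ∫⁻ x in jumpSet n (s 0).toFun ∩ Ω, ‖(s 0).sing x‖ₑ ∂μ₀ := by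
      have hK : ∀ᵐ x ∂μ₀.restrict ((s 0).core ∩ jumpSet n G), x ∈ (s 0).core :=
        ae_mono (Measure.restrict_mono Set.inter_subset_left le_rfl) (ae_restrict_mem (hKm 0))
      refine (lintegral_mono_ae (hK.mono fun x hx => ?_)).trans (lintegral_mono_set
        ((Set.inter_comm _ _).le.trans hJ))
      rw [(hR 0).sing_eq x hx]
    have h2 : ∫⁻ x in (s 0).coreᶜ, ‖(s 1).sing x‖ₑ ∂μ₀ ≤ ENNReal.ofReal (5 * δ) := by
      have := ENNReal.ofReal_le_ofReal (hR 0).integral_sing_le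
      rwa [ofReal_setIntegral_norm (hib 1), pow_zero, div_one] at this
    have hsub : jumpSet n G ∩ Ω ⊆ ((s 0).core ∩ jumpSet n G) ∪ (s 0).coreᶜ := fun x hx => by
      by_cases hxK : x ∈ (s 0).core
      · exact Or.inl ⟨hxK, hx.1⟩
      · exact Or.inr hxK
    calc ∫⁻ x in jumpSet n G ∩ Ω, ‖b' x‖ₑ ∂μ₀
        ≤ (∫⁻ x in jumpSet n G ∩ Ω, ‖(s 1).sing x‖ₑ ∂μ₀) + ENNReal.ofReal (10 * δ / 2 ^ 0) :=
          setLIntegral_enorm_le_add (hib 1) hb' _ (hbb 0)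
      _ ≤ (∫⁻ x in jumpSet n (s 0).toFun ∩ Ω, ‖(s 0).sing x‖ₑ ∂μ₀) + ENNReal.ofReal (5 * δ) +
          ENNReal.ofReal (10 * δ / 2 ^ 0) := by
          refine add_le_add ?_ le_rfl
          exact (lintegral_mono_set hsub).trans ((lintegral_union_le _ _ _).trans
            (add_le_add h1 h2))
      _ = _ := by
          rw [add_assoc, ← ENNReal.ofReal_add (by positivity) (by positivity)]
          congr 2
          ring

end Approximation

section SBV

theorem HasGradient.isSBVOn {G : 𝔼 → ℝ} {Ω Ω' : Set 𝔼} {μ₀ : Measure 𝔼} {a b : 𝔼 → 𝔼}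
    [IsFiniteMeasure μ₀] (h : HasGradient G Ω μ₀ a b) (hs : μ₀ ⟂ₘ volume)
    (h0 : ∫⁻ x in Ω \ approxDiscontSet n G, ‖b x‖ₑ ∂μ₀ = 0) (hΩ' : IsOpen Ω')
    (hc : IsCompact (closure Ω')) (hsub : closure Ω' ⊆ Ω) : IsSBVOn n G Ω' := by
  have hΩΩ : Ω' ⊆ Ω := subset_closure.trans hsub
  have hg := h.restrict hΩΩ
  refine ⟨⟨(h.locallyIntegrableOn.integrableOn_compact_subset hsub hc).mono_set subset_closure,
    (variation_le_of_hasGradient hg).trans_lt ENNReal.ofReal_lt_top⟩, ?_⟩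
  rw [(hg.var_eq hΩ' (hs.mono_ac Measure.restrict_le_self.absolutelyContinuous
    Measure.AbsolutelyContinuous.rfl) (by
    rw [Measure.restrict_apply hΩ'.measurableSet.compl, Set.compl_inter_self,
      measure_empty])).2.1]
  refine le_antisymm (le_trans ?_ h0.le) zero_le
  exact lintegral_mono' (Measure.restrict_mono' (Set.sdiff_subset_sdiff_left hΩΩ).eventuallyLE
    Measure.restrict_le_self) le_rfl

end SBV

end Auxiliary

/-- Approximation of a function of bounded variation by
`SBV_loc` functions in the `L^∞` norm, with control of the absolutely
continuous and jump parts. -/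
theorem BV_approximation_SBVloc_Linfty
    (n : ℕ) (hn : 1 ≤ n)
    (Ω : Set (EuclideanSpace ℝ (Fin n))) (hΩ : IsOpen Ω)
    (f : EuclideanSpace ℝ (Fin n) → ℝ) (hf : LocallyIntegrableOn f Ω volume)
    (hvar : variation n f Ω < ⊤) :
    ∃ F : ℕ → EuclideanSpace ℝ (Fin n) → ℝ,
      (∀ i, ∀ Ω' : Set (EuclideanSpace ℝ (Fin n)), IsOpen Ω' →
        IsCompact (closure Ω') → closure Ω' ⊆ Ω → IsSBVOn n (F i) Ω') ∧
      Tendsto (fun i => eLpNorm (fun x => F i x - f x) ⊤ (volume.restrict Ω))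
        atTop (𝓝 0) ∧
      limsup (fun i => absVar n (F i) Ω) atTop ≤
        absVar n f Ω + cantorVar n f Ω ∧
      limsup (fun i => jumpVar n (F i) Ω) atTop ≤ jumpVar n f Ω := by
  obtain ⟨μ₀, a, b, _, hs, hμΩ, h⟩ := exists_hasGradient hΩ.measurableSet hf hvar
  choose F a' b' hF hg h0 hac hj using fun i : ℕ =>
    h.exists_approx hΩ hμΩ (Nat.one_div_pos_of_nat (α := ℝ) (n := i))
  have hlim : ∀ (c : ℝ) (A : ℝ≥0∞), Tendsto (fun i : ℕ => A + ENNReal.ofReal (c * (1 / (i + 1))))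
      atTop (𝓝 A) := fun c A => by
    have h1 := tendsto_one_div_add_atTop_nhds_zero_nat (𝕜 := ℝ).const_mul c
    have h2 := (ENNReal.tendsto_ofReal h1).const_add A
    rwa [mul_zero, ENNReal.ofReal_zero, add_zero] at h2
  obtain ⟨e1, e2, e3⟩ := h.var_eq hΩ hs hμΩ
  refine ⟨F, fun i Ω' hΩ' hc hsub => (hg i).isSBVOn hs (h0 i) hΩ' hc hsub, ?_, ?_, ?_⟩
  · refine tendsto_of_tendsto_of_tendsto_of_le_of_le tendsto_const_nhds
      (hlim 2 0) (fun i => zero_le) fun i => ?_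
    change _ ≤ 0 + ENNReal.ofReal _
    rw [eLpNorm_exponent_top, zero_add]
    refine eLpNormEssSup_le_of_ae_bound (Eventually.of_forall fun x => ?_)
    rw [norm_sub_rev]
    exact hF i x
  · rw [e1, e2]
    refine (limsup_le_limsup (Eventually.of_forall fun i => ?_)).trans_eq (hlim 15 _).limsup_eq
    simp only [((hg i).var_eq hΩ hs hμΩ).1]
    exact hac i
  · rw [e3]
    refine (limsup_le_limsup (Eventually.of_forall fun i => ?_)).trans_eq (hlim 15 _).limsup_eq
    simp only [((hg i).var_eq hΩ hs hμΩ).2.2]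
    exact hj i

end
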